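/- There exist an exponent p ≥ 6, a constant δ_p > 0, an integer L₀ ≥ 0, and a constant C, all depending only on γ (and p), such that for every integer j ≥ 1, every l ∈ ℕ with l ≥ L₀, and every Schwartz function f on ℝ², ‖sup_{u∈[1,2]} |m_j^l(u,D) f|‖_{L^p(ℝ²)} ≤ C 2^{−δ_p j} ‖f‖_{L^p(ℝ²)}; in particular the constant C is uniform in l. -/

import Mathlib

open MeasureTheory Set Filter ENNReal NNReal

/-- The rescaled curve `γ_l(t) = γ(2^{-l} t)/γ(2^{-l})`. -/
noncomputable def gammaZ (γ : ℝ → ℝ) (l : ℤ) (t : ℝ) : ℝ :=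
  γ ((2 : ℝ) ^ (-l) * t) / γ ((2 : ℝ) ^ (-l))

/-- The Fourier transform on `ℝ²`. -/
noncomputable def ft (f : ℝ × ℝ → ℂ) (ξ : ℝ × ℝ) : ℂ :=
  ∫ x : ℝ × ℝ, Complex.exp (-2 * Real.pi * Complex.I * (x.1 * ξ.1 + x.2 * ξ.2)) * f x

/-- The inverse Fourier transform on `ℝ²`. -/
noncomputable def ftInv (f : ℝ × ℝ → ℂ) (x : ℝ × ℝ) : ℂ :=
  ∫ ξ : ℝ × ℝ, Complex.exp (2 * Real.pi * Complex.I * (x.1 * ξ.1 + x.2 * ξ.2)) * f ξ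

/-- The Fourier multiplier operator `a(D)f = (a f̂)^∨` with symbol `a`. -/
noncomputable def op (a : ℝ × ℝ → ℂ) (f : ℝ × ℝ → ℂ) : ℝ × ℝ → ℂ :=
  ftInv (fun ξ => a ξ * ft f ξ)

/-- The localized multiplier `m_j^l(u,ξ)`. -/
noncomputable def mjl (γ φ : ℝ → ℝ) (j l : ℕ) (u : ℝ) (ξ : ℝ × ℝ) : ℂ :=
  ((φ ((2 : ℝ) ^ (-(j : ℤ)) * ξ.1) * φ ((2 : ℝ) ^ (-(j : ℤ)) * ξ.2) : ℝ) : ℂ) *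
    ∫ t : ℝ, Complex.exp (Complex.I * ξ.1 * t) *
      Complex.exp (Complex.I * ξ.2 * u * gammaZ γ (l : ℤ) t) * (φ t : ℂ) / t

open FourierTransform in
lemma planchE (g : WithLp 2 (ℝ × ℝ) → ℂ) (hg : Integrable g) (h2 : MemLp g 2) :
    eLpNorm (𝓕 g) 2 volume = eLpNorm g 2 volume := by
  have hc : Continuous (𝓕 g) := by
    exact VectorFourier.fourierIntegral_continuous Real.continuous_fourierChar
      (by exact continuous_inner) hg
  have key : (𝓕 (h2.toLp g) : Lp ℂ 2 (volume : Measure (WithLp 2 (ℝ × ℝ)))) =ᵐ[volume] 𝓕 g := by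
    refine ae_eq_of_integral_contDiff_smul_eq ?_ hc.locallyIntegrable ?_
    · exact (Lp.memLp _).locallyIntegrable (by norm_num)
    · intro ψ hψ hψc
      have hψ' : ContDiff ℝ (⊤ : ℕ∞) (fun x => (ψ x : ℂ)) := Complex.ofRealCLM.contDiff.comp hψ
      have hψc' : HasCompactSupport (fun x => (ψ x : ℂ)) := hψc.comp_left (g := fun x : ℝ => (x : ℂ)) (by simp)
      let Ψ : SchwartzMap (WithLp 2 (ℝ × ℝ)) ℂ := hψc'.toSchwartzMap hψ'
      have e1 := congrArg (fun T => T Ψ) (Lp.fourier_toTemperedDistribution_eq (h2.toLp g))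
      simp only [TemperedDistribution.fourier_apply, Lp.toTemperedDistribution_apply] at e1
      have e2 : ∫ x, (𝓕 Ψ) x • (h2.toLp g) x = ∫ x, (𝓕 Ψ) x • g x := by
        apply integral_congr_ae
        filter_upwards [h2.coeFn_toLp] with x hx
        rw [hx]
      have e3 := VectorFourier.integral_fourierIntegral_smul_eq_flip (L := innerₗ (WithLp 2 (ℝ × ℝ)))
        (f := Ψ) (g := g) (μ := volume) (ν := volume) Real.continuous_fourierChar (by exact continuous_inner) Ψ.integrable hg
      have e4 : ∀ x, VectorFourier.fourierIntegral Real.fourierChar volume (innerₗ (WithLp 2 (ℝ × ℝ))).flip g x = 𝓕 g x := by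
        intro x; rw [flip_innerₗ]; rfl
      simp only [e4] at e3
      have e5 : ∫ x, (𝓕 Ψ) x • g x = ∫ x, Ψ x • 𝓕 g x := e3
      calc _ = ∫ x, Ψ x • (𝓕 (h2.toLp g) : Lp ℂ 2 (volume : Measure (WithLp 2 (ℝ × ℝ)))) x := by
            apply integral_congr_ae; filter_upwards with x; simp [Ψ]
        _ = ∫ x, Ψ x • 𝓕 g x := by rw [← e1, e2, e5]
        _ = _ := by apply integral_congr_ae; filter_upwards with x; simp [Ψ]
  rw [← eLpNorm_congr_ae key]
  have h := Lp.norm_fourier_eq (h2.toLp g)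
  rw [Lp.norm_def, Lp.norm_def, eLpNorm_congr_ae h2.coeFn_toLp] at h
  exact (ENNReal.toReal_eq_toReal_iff' (Lp.eLpNorm_ne_top _) h2.eLpNorm_ne_top).1 h

lemma eLp2 {Y : Type*} [MeasurableSpace Y] (μ : Measure Y) (f : Y → ℂ) :
    eLpNorm f 2 μ ^ 2 = ∫⁻ x, ‖f x‖ₑ ^ 2 ∂μ := by
  rw [eLpNorm_eq_lintegral_rpow_enorm_toReal (by norm_num) (by norm_num)]
  rw [← ENNReal.rpow_natCast, ← ENNReal.rpow_mul]
  simp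

lemma ft_cont {f : ℝ × ℝ → ℂ} (hf : Integrable f) : Continuous (ft f) := by
  unfold ft
  refine continuous_of_dominated (bound := fun x => ‖f x‖) ?_ ?_ hf.norm ?_
  · intro ξ; exact (Continuous.aestronglyMeasurable (by fun_prop)).mul hf.aestronglyMeasurable
  · intro ξ; filter_upwards with x
    rw [norm_mul, Complex.norm_exp]; simp
  · filter_upwards with x; fun_prop

lemma ftInv_eq (f : ℝ × ℝ → ℂ) (x : ℝ × ℝ) : ftInv f x = ft f (-x) := by
  unfold ftInv ft
  congr 1; ext y; simp; left; congr 1; ring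

lemma ftInv_cont {f : ℝ × ℝ → ℂ} (hf : Integrable f) : Continuous (ftInv f) := by
  have : ftInv f = fun x => ft f (-x) := funext (ftInv_eq f)
  rw [this]; exact (ft_cont hf).comp continuous_neg

lemma ft_le {f : ℝ × ℝ → ℂ} (ξ : ℝ × ℝ) : ‖ft f ξ‖ ≤ ∫ x, ‖f x‖ := by
  unfold ft
  refine (norm_integral_le_integral_norm _).trans (le_of_eq ?_)
  congr 1; ext x
  rw [norm_mul, Complex.norm_exp]; simp

open FourierTransform in
lemma planch {f : ℝ × ℝ → ℂ} (hf : Integrable f) (h2 : MemLp f 2) :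
    ∫⁻ ξ, ‖ft f ξ‖ₑ ^ 2 = ∫⁻ x, ‖f x‖ₑ ^ 2 := by
  have mp := WithLp.volume_preserving_ofLp ℝ ℝ
  have me : MeasurableEmbedding (@WithLp.ofLp 2 (ℝ × ℝ)) := (MeasurableEquiv.toLp 2 (ℝ × ℝ)).symm.measurableEmbedding
  set g : WithLp 2 (ℝ × ℝ) → ℂ := fun x => f x.ofLp with hg
  have gi : Integrable g := (mp.integrable_comp_emb me).2 hf
  have g2 : MemLp g 2 := h2.comp_measurePreserving mp
  have e : ∀ w, 𝓕 g w = ft f w.ofLp := by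
    intro w
    rw [Real.fourier_eq', ft, ← mp.integral_comp me]
    congr 1; ext v
    simp only [smul_eq_mul, hg, WithLp.prod_inner_apply]
    congr 2
    simp
    ring
  have h := planchE g gi g2
  have h' : (∫⁻ x, ‖𝓕 g x‖ₑ ^ 2) = ∫⁻ x, ‖g x‖ₑ ^ 2 := by
    rw [← eLp2, ← eLp2, h]
  simp only [e] at h'
  simp only [hg] at h'
  rwa [mp.lintegral_comp_emb me (fun x => ‖ft f x‖ₑ ^ 2), mp.lintegral_comp_emb me (fun x => ‖f x‖ₑ ^ 2)] at h'

lemma planchInv {f : ℝ × ℝ → ℂ} (hf : Integrable f) (h2 : MemLp f 2) :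
    ∫⁻ ξ, ‖ftInv f ξ‖ₑ ^ 2 = ∫⁻ x, ‖f x‖ₑ ^ 2 := by
  rw [← planch hf h2]
  simp only [ftInv_eq]
  exact lintegral_neg_eq_self (fun x => ‖ft f x‖ₑ ^ 2)

structure Cls (f : ℝ × ℝ → ℂ) : Prop where
  m : Measurable f
  i : Integrable f
  b : ∃ M, ∀ x, ‖f x‖ ≤ M

lemma memLp2_of {f : ℝ × ℝ → ℂ} (h : Integrable f) {M : ℝ} (hM : ∀ x, ‖f x‖ ≤ M) : MemLp f 2 := by
  rw [memLp_two_iff_integrable_sq_norm h.1]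
  simp only [sq]
  exact h.norm.bdd_mul h.norm.1 (c := M) (Eventually.of_forall fun x => by simpa using hM x)

lemma Cls.memLp2 {f : ℝ × ℝ → ℂ} (h : Cls f) : MemLp f 2 := by
  obtain ⟨M, hM⟩ := h.b
  exact memLp2_of h.i hM

lemma Cls.indicator {f : ℝ × ℝ → ℂ} (h : Cls f) {S : Set (ℝ × ℝ)} (hS : MeasurableSet S) :
    Cls (S.indicator f) := by
  refine ⟨h.m.indicator hS, h.i.indicator hS, ?_⟩
  obtain ⟨M, hM⟩ := h.b
  exact ⟨M, fun x => (norm_indicator_le_norm_self f x).trans (hM x)⟩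

lemma marc {ι : Type*} [Fintype ι] (T : ι → (ℝ × ℝ → ℂ) → ℝ × ℝ → ℂ) (A2 : ℝ≥0∞) (A : ℝ) (hA : 0 < A)
    (hadd : ∀ i f g, Cls f → Cls g → ∀ x, T i (f + g) x = T i f x + T i g x)
    (hmeas : ∀ i f, Cls f → Measurable (T i f))
    (h2 : ∀ f, Cls f → ∑ i, ∫⁻ x, ‖T i f x‖ₑ ^ 2 ≤ A2 * ∫⁻ x, ‖f x‖ₑ ^ 2)
    (hinf : ∀ i f M, Cls f → 0 ≤ M → (∀ x, ‖f x‖ ≤ M) → ∀ x, ‖T i f x‖ ≤ A * M)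
    (f : ℝ × ℝ → ℂ) (hf : Cls f) :
    ∑ i, ∫⁻ x, ‖T i f x‖ₑ ^ 6 ≤ 96 * A2 * ENNReal.ofReal (A ^ 4) * ∫⁻ x, ‖f x‖ₑ ^ 6 := by
  set μ' : Measure (ℝ × ℝ) := volume.withDensity (fun x => ‖f x‖ₑ ^ 2) with hμ'
  have hfm0 := hf.m
  have hfm : Measurable (fun x => ‖f x‖) := hf.m.norm
  have hset : ∀ s : ℝ, MeasurableSet {x | s < ‖f x‖} := fun s => measurableSet_lt measurable_const hfm
  -- RHS
  have hR : ∫⁻ x, ‖f x‖ₑ ^ 6 = 4 * ∫⁻ s in Ioi (0:ℝ), μ' {x | s < ‖f x‖} * ENNReal.ofReal (s ^ 3) := by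
    have := lintegral_rpow_eq_lintegral_meas_lt_mul μ' (f := fun x => ‖f x‖)
      (Eventually.of_forall fun x => norm_nonneg _) hfm.aemeasurable (p := 4) (by norm_num)
    norm_num at this
    rw [← this, hμ', lintegral_withDensity_eq_lintegral_mul _ (by fun_prop) (by fun_prop)]
    congr 1; ext x
    simp only [Pi.mul_apply]
    ring
  have hL : ∀ i, ∫⁻ x, ‖T i f x‖ₑ ^ 6 = ENNReal.ofReal ((2 * A) ^ 6) * (6 * ∫⁻ s in Ioi (0:ℝ),
      volume {x | s < ‖T i f x‖ / (2 * A)} * ENNReal.ofReal (s ^ 5)) := by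
    intro i
    have := lintegral_rpow_eq_lintegral_meas_lt_mul volume (f := fun x => ‖T i f x‖ / (2 * A))
      (Eventually.of_forall fun x => by positivity) ((hmeas i f hf).norm.div_const _).aemeasurable (p := 6) (by norm_num)
    norm_num at this
    norm_num
    rw [← this, ← lintegral_const_mul' _ _ (by simp)]
    congr 1; ext x
    rw [← ENNReal.ofReal_mul (by positivity), ← mul_pow, mul_div_cancel₀ _ (by positivity), ENNReal.ofReal_pow (norm_nonneg _), ofReal_norm]
  have key : ∀ s ∈ Ioi (0:ℝ), ∑ i, volume {x | s < ‖T i f x‖ / (2 * A)} * ENNReal.ofReal (s ^ 5) ≤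
      (A2 * ENNReal.ofReal (A⁻¹ ^ 2)) * (μ' {x | s < ‖f x‖} * ENNReal.ofReal (s ^ 3)) := by
    intro s hs
    have hs : 0 < s := hs
    set S := {x | s < ‖f x‖} with hS
    have c1 : Cls (S.indicator f) := hf.indicator (hset s)
    have c2 : Cls (Sᶜ.indicator f) := hf.indicator (hset s).compl
    have hb : ∀ x, ‖Sᶜ.indicator f x‖ ≤ s := by
      intro x
      by_cases hx : x ∈ S
      · rw [indicator_of_notMem (by simpa using hx)]; simpa using hs.le
      · rw [indicator_of_mem (by simpa using hx)]; simpa [hS] using hx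
    have e0 : S.indicator f + Sᶜ.indicator f = f := indicator_self_add_compl _ _
    have hm : ∀ i, volume {x | s < ‖T i f x‖ / (2 * A)} ≤ (∫⁻ x, ‖T i (S.indicator f) x‖ₑ ^ 2) * (ENNReal.ofReal ((A * s) ^ 2))⁻¹ := by
      intro i
      have hsub : {x | s < ‖T i f x‖ / (2 * A)} ⊆ {x | ENNReal.ofReal ((A * s) ^ 2) ≤ ‖T i (S.indicator f) x‖ₑ ^ 2} := by
        intro x hx
        simp only [mem_ofPred_eq] at hx ⊢
        rw [lt_div_iff₀ (by positivity)] at hx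
        have h3 := hadd i _ _ c1 c2 x
        rw [e0] at h3
        have h4 := hinf i _ s c2 hs.le hb x
        have h5 : A * s ≤ ‖T i (S.indicator f) x‖ := by
          have := norm_add_le (T i (S.indicator f) x) (T i (Sᶜ.indicator f) x)
          rw [← h3] at this
          linarith
        rw [← ofReal_norm, ← ENNReal.ofReal_pow (norm_nonneg _)]
        exact ENNReal.ofReal_le_ofReal (by gcongr)
      refine (measure_mono hsub).trans ?_
      have h0 : ENNReal.ofReal ((A * s) ^ 2) ≠ 0 := by
        rw [Ne, ENNReal.ofReal_eq_zero, not_le]; positivity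
      rw [← div_eq_mul_inv, ENNReal.le_div_iff_mul_le (Or.inl h0) (Or.inl (by simp)), mul_comm]
      exact mul_meas_ge_le_lintegral₀ (by have := hmeas i _ c1; fun_prop) _
    have hmu : μ' S = ∫⁻ x, ‖S.indicator f x‖ₑ ^ 2 := by
      have hSm : MeasurableSet S := hset s
      rw [hμ', withDensity_apply _ hSm, ← lintegral_indicator hSm]
      congr 1; ext x
      by_cases hx : x ∈ S <;> simp only [indicator_of_mem, indicator_of_notMem, hx, not_false_eq_true] <;> simp
    calc _ ≤ ∑ i, ((∫⁻ x, ‖T i (S.indicator f) x‖ₑ ^ 2) * (ENNReal.ofReal ((A * s) ^ 2))⁻¹) * ENNReal.ofReal (s ^ 5) := by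
          gcongr with i; exact hm i
      _ = (∑ i, ∫⁻ x, ‖T i (S.indicator f) x‖ₑ ^ 2) * ((ENNReal.ofReal ((A * s) ^ 2))⁻¹ * ENNReal.ofReal (s ^ 5)) := by
          rw [Finset.sum_mul]; simp only [mul_assoc]
      _ ≤ (A2 * μ' S) * ((ENNReal.ofReal ((A * s) ^ 2))⁻¹ * ENNReal.ofReal (s ^ 5)) := by
          gcongr; rw [hmu]; exact h2 _ c1
      _ = _ := by
          have : (ENNReal.ofReal ((A * s) ^ 2))⁻¹ * ENNReal.ofReal (s ^ 5) = ENNReal.ofReal (A⁻¹ ^ 2) * ENNReal.ofReal (s ^ 3) := by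
            rw [← ENNReal.ofReal_inv_of_pos (by positivity), ← ENNReal.ofReal_mul (by positivity), ← ENNReal.ofReal_mul (by positivity)]
            congr 1
            field_simp
          rw [this]; ring
  have hmL : ∀ i, Measurable (fun s : ℝ => volume {x | s < ‖T i f x‖ / (2 * A)}) := fun i =>
    Antitone.measurable (fun a b hab => measure_mono (fun x hx => lt_of_le_of_lt hab hx))
  simp only [hL]
  rw [← Finset.mul_sum, ← Finset.mul_sum, ← lintegral_finsetSum _ (fun i _ => Measurable.fun_mul (hmL i) (by fun_prop))]
  calc _ ≤ ENNReal.ofReal ((2 * A) ^ 6) * (6 * ∫⁻ s in Ioi (0:ℝ), (A2 * ENNReal.ofReal (A⁻¹ ^ 2)) * (μ' {x | s < ‖f x‖} * ENNReal.ofReal (s ^ 3))) := by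
        refine mul_le_mul_right (mul_le_mul_right ?_ _) _
        exact setLIntegral_mono' measurableSet_Ioi key
    _ = _ := by
        have hmm : Measurable (fun s : ℝ => μ' {x | s < ‖f x‖}) := 
          Antitone.measurable (fun a b hab => measure_mono (fun x hx => lt_of_le_of_lt hab hx))
        rw [lintegral_const_mul _ (Measurable.fun_mul hmm (by fun_prop)), hR]
        have : ENNReal.ofReal ((2 * A) ^ 6) * (6 * ENNReal.ofReal (A⁻¹ ^ 2)) = 96 * 4 * ENNReal.ofReal (A ^ 4) := by
          have h6 : (6 : ℝ≥0∞) = ENNReal.ofReal 6 := by simp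
          have h96 : (96 * 4 : ℝ≥0∞) = ENNReal.ofReal (96 * 4) := by
            rw [ENNReal.ofReal_mul (by norm_num)]; simp
          rw [h6, h96, ← ENNReal.ofReal_mul (by positivity), ← ENNReal.ofReal_mul (by positivity), ← ENNReal.ofReal_mul (by positivity)]
          congr 1; field_simp; ring
        calc _ = (ENNReal.ofReal ((2 * A) ^ 6) * (6 * ENNReal.ofReal (A⁻¹ ^ 2))) * A2 * ∫⁻ s in Ioi (0:ℝ), (μ' {x | s < ‖f x‖} * ENNReal.ofReal (s ^ 3)) := by ring
          _ = _ := by rw [this]; ring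

lemma card_diam (s : Finset ℕ) (D : ℕ) (h : ∀ a ∈ s, ∀ b ∈ s, a ≤ b + D) : s.card ≤ D + 1 := by
  rcases s.eq_empty_or_nonempty with rfl | hs
  · simp
  · have : s ⊆ Finset.Icc (s.min' hs) (s.min' hs + D) := by
      intro a ha
      rw [Finset.mem_Icc]
      exact ⟨s.min'_le a ha, h a ha _ (s.min'_mem hs)⟩
    refine (Finset.card_le_card this).trans ?_
    simp; omega

lemma card_pairs (Q : Finset (ℕ × ℕ)) (D E : ℕ) (h2 : ∀ p ∈ Q, ∀ p' ∈ Q, p.2 ≤ p'.2 + D)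
    (h1 : ∀ p ∈ Q, ∀ p' ∈ Q, p.2 = p'.2 → p.1 ≤ p'.1 + E) : Q.card ≤ (E + 1) * (D + 1) := by
  have e1 := Finset.card_le_mul_card_image (f := Prod.snd) Q (E + 1) (by
    intro b hb
    have : (Q.filter (fun p => p.2 = b)).card = ((Q.filter (fun p => p.2 = b)).image Prod.fst).card := by
      rw [Finset.card_image_of_injOn]
      intro p hp q hq hpq
      simp at hp hq
      exact Prod.ext hpq (hp.2.trans hq.2.symm)
    rw [this]
    apply card_diam
    intro x hx y hy
    simp only [Finset.mem_image, Finset.mem_filter] at hx hy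
    obtain ⟨p, ⟨hp, hpb⟩, rfl⟩ := hx
    obtain ⟨q, ⟨hq, hqb⟩, rfl⟩ := hy
    exact h1 p hp q hq (hpb.trans hqb.symm))
  refine e1.trans (Nat.mul_le_mul_left _ ?_)
  apply card_diam
  intro x hx y hy
  simp only [Finset.mem_image] at hx hy
  obtain ⟨p, hp, rfl⟩ := hx
  obtain ⟨q, hq, rfl⟩ := hy
  exact h2 p hp q hq

structure CntHyp (c0 C0 : ℝ) (M : ℕ) (S H : ℕ → ℝ) (G : ℕ → ℕ → ℝ) : Prop where
  lo : ∀ a b, a ≤ b → b < M ^ 2 → c0 * ((b : ℝ) - a) ≤ S b - S a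
  up : ∀ a b, a ≤ b → b < M ^ 2 → S b - S a ≤ C0 * ((b : ℝ) - a)
  hH : ∀ a b, a ≤ b → b < M ^ 2 → H b - H a = G a b * (S b - S a)
  G1 : ∀ a b, a ≤ b → b < M ^ 2 → |G a b| ≤ C0 * M ^ 2
  G2 : ∀ a b a' b', a ≤ b → b ≤ a' → a' ≤ b' → b' < M ^ 2 → c0 * ((a' : ℝ) - b) ≤ |G a' b' - G a b|

def PairOK (C0 : ℝ) (M : ℕ) (S H : ℕ → ℝ) (P : Finset (ℕ × ℕ)) : Prop :=
  (∀ p ∈ P, p.1 < M ^ 2 ∧ p.2 < M ^ 2) ∧ ∀ p ∈ P, ∀ q ∈ P, |S p.1 + S p.2 - S q.1 - S q.2| ≤ C0 ∧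
    |H p.1 + H p.2 - H q.1 - H q.2| ≤ C0 * M ^ 2

lemma inward {c0 C0 : ℝ} (hc : 0 < c0) (hC : 0 < C0) {M : ℕ} (hM : 1 ≤ M) {S H : ℕ → ℝ} {G : ℕ → ℕ → ℝ}
    (h : CntHyp c0 C0 M S H G) {a1 a2 b1 b2 : ℕ} (ha : a2 < M ^ 2) (h1 : a1 ≤ b1) (h2 : b1 + M ≤ b2) (h3 : b2 ≤ a2)
    (hs : |S a1 + S a2 - S b1 - S b2| ≤ C0) (hh : |H a1 + H a2 - H b1 - H b2| ≤ C0 * M ^ 2) :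
    (a2 : ℝ) - b2 ≤ (C0 + C0 ^ 2) / c0 ^ 2 * M := by
  have hMr : (1:ℝ) ≤ M := by exact_mod_cast hM
  have g2 := h.G2 a1 b1 b2 a2 h1 (by omega) h3 ha
  have g1 := h.G1 a1 b1 h1 (by omega)
  have e1 := h.hH a1 b1 h1 (by omega)
  have e2 := h.hH b2 a2 h3 ha
  have l1 := h.lo a1 b1 h1 (by omega)
  have l2 := h.lo b2 a2 h3 ha
  have h2' : (M : ℝ) ≤ b2 - b1 := by
    have : ((b1 + M : ℕ) : ℝ) ≤ b2 := by exact_mod_cast h2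
    push_cast at this; linarith
  have h1' : (a1 : ℝ) ≤ b1 := by exact_mod_cast h1
  have h3' : (b2 : ℝ) ≤ a2 := by exact_mod_cast h3
  set x := S b1 - S a1
  set y := S a2 - S b2
  set g := G a1 b1
  set g' := G b2 a2
  have hy : 0 ≤ y := le_trans (mul_nonneg hc.le (by linarith)) l2
  have hxy : |y - x| ≤ C0 := by
    have : y - x = S a1 + S a2 - S b1 - S b2 := by simp only [x, y]; ring
    rw [this]; exact hs
  have hHH : |g' * y - g * x| ≤ C0 * M ^ 2 := by
    have : g' * y - g * x = H a1 + H a2 - H b1 - H b2 := by rw [← e1, ← e2]; ring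
    rw [this]; exact hh
  have k1 : |(g' - g) * y| ≤ C0 * M ^ 2 + (C0 * M ^ 2) * C0 := by
    have : (g' - g) * y = (g' * y - g * x) - g * (y - x) := by ring
    rw [this]
    refine (abs_sub _ _).trans ?_
    rw [abs_mul]
    gcongr
  rw [abs_mul, abs_of_nonneg hy] at k1
  have k2 : (c0 * M) * (c0 * (a2 - b2)) ≤ C0 * M ^ 2 + (C0 * M ^ 2) * C0 := by
    refine le_trans ?_ k1
    apply mul_le_mul _ l2 (mul_nonneg hc.le (by linarith)) (abs_nonneg _)
    refine le_trans ?_ g2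
    gcongr
  rw [div_mul_eq_mul_div, le_div_iff₀ (by positivity)]
  have hM0 : (0:ℝ) < M := by linarith
  have : (M : ℝ) * (((a2:ℝ) - b2) * c0 ^ 2) ≤ M * ((C0 + C0 ^ 2) * M) := by nlinarith
  exact le_of_mul_le_mul_left this hM0

lemma count_good {c0 C0 : ℝ} (hc : 0 < c0) (hC : 0 < C0) (D : ℕ) (hD : (C0 + C0 ^ 2) / c0 ^ 2 ≤ D) (hD2 : C0 / c0 ≤ D) {M : ℕ} (hM : 1 ≤ M) {S H : ℕ → ℝ} {G : ℕ → ℕ → ℝ}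
    (h : CntHyp c0 C0 M S H G) {P : Finset (ℕ × ℕ)} (hP : PairOK C0 M S H P) (hg : ∀ p ∈ P, p.1 + M ≤ p.2) :
    P.card ≤ (D + 1) * (D * M + 1) := by
  have hMr : (1:ℝ) ≤ M := by exact_mod_cast hM
  have hDM : (D:ℝ) ≤ D * M := le_mul_of_one_le_right (by positivity) hMr
  apply card_pairs
  · intro p hp q hq
    rcases le_total p.2 q.2 with h22 | h22
    · omega
    have hs := (hP.2 p hp q hq).1
    have hh := (hP.2 p hp q hq).2
    have hp' := hP.1 p hp
    have hq' := hP.1 q hq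
    suffices (p.2 : ℝ) - q.2 ≤ D * M by
      have : (p.2 : ℝ) ≤ ((q.2 + D * M : ℕ) : ℝ) := by push_cast; linarith
      exact_mod_cast this
    rcases le_total p.1 q.1 with h11 | h11
    · refine (inward hc hC hM h hp'.2 h11 (hg q hq) h22 hs hh).trans ?_
      gcongr
    · have l1 := h.lo q.1 p.1 h11 (by omega)
      have l2 := h.lo q.2 p.2 h22 (by omega)
      have h11' : (q.1 : ℝ) ≤ p.1 := by exact_mod_cast h11
      have l1' : 0 ≤ S p.1 - S q.1 := le_trans (mul_nonneg hc.le (by linarith)) l1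
      have := (abs_le.1 hs).2
      refine le_trans ?_ (hD2.trans hDM)
      rw [le_div_iff₀ hc]; nlinarith
  · intro p hp q hq hpq
    rcases le_total p.1 q.1 with h11 | h11
    · omega
    have hs := (hP.2 p hp q hq).1
    have l1 := h.lo q.1 p.1 h11 (by have := hP.1 p hp; omega)
    rw [hpq] at hs
    have := (abs_le.1 hs).2
    have : (p.1 : ℝ) - q.1 ≤ D := by
      refine le_trans ?_ hD2
      rw [le_div_iff₀ hc]; nlinarith
    have : (p.1 : ℝ) ≤ ((q.1 + D : ℕ) : ℝ) := by push_cast; linarith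
    exact_mod_cast this

lemma count_bad {c0 C0 : ℝ} (hc : 0 < c0) (hC : 0 < C0) (D : ℕ) (hD : 5 * C0 / c0 ≤ D) {M : ℕ} (hM : 1 ≤ M) {S H : ℕ → ℝ} {G : ℕ → ℕ → ℝ}
    (h : CntHyp c0 C0 M S H G) {P : Finset (ℕ × ℕ)} (hP : PairOK C0 M S H P) (hg : ∀ p ∈ P, p.1 < p.2 + M ∧ p.2 < p.1 + M) :
    P.card ≤ (D + 1) * (D * M + 1) := by
  have hMr : (1:ℝ) ≤ M := by exact_mod_cast hM
  have hclose : ∀ p ∈ P, |S p.1 - S p.2| ≤ C0 * M := by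
    intro p hp
    have hb := hP.1 p hp
    have hg' := hg p hp
    rcases le_total p.1 p.2 with h12 | h12
    · have u := h.up p.1 p.2 h12 hb.2
      have l := h.lo p.1 p.2 h12 hb.2
      have h12' : (p.1:ℝ) ≤ p.2 := by exact_mod_cast h12
      have : (p.2:ℝ) ≤ p.1 + M := by exact_mod_cast hg'.2.le
      rw [abs_le]; constructor
      · nlinarith
      · nlinarith [mul_nonneg hc.le (sub_nonneg.2 h12')]
    · have u := h.up p.2 p.1 h12 hb.1
      have l := h.lo p.2 p.1 h12 hb.1
      have h12' : (p.2:ℝ) ≤ p.1 := by exact_mod_cast h12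
      have : (p.1:ℝ) ≤ p.2 + M := by exact_mod_cast hg'.1.le
      rw [abs_le]; constructor
      · nlinarith [mul_nonneg hc.le (sub_nonneg.2 h12')]
      · nlinarith
  apply card_pairs
  · intro p hp q hq
    rcases le_total p.2 q.2 with h22 | h22
    · omega
    have hs := (abs_le.1 (hP.2 p hp q hq).1).2
    have l2 := h.lo q.2 p.2 h22 (hP.1 p hp).2
    have k1 := (abs_le.1 (hclose p hp)).1
    have k2 := (abs_le.1 (hclose q hq)).2
    have k3 : C0 ≤ C0 * M := le_mul_of_one_le_right hC.le hMr
    suffices (p.2 : ℝ) - q.2 ≤ D * M by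
      have : (p.2 : ℝ) ≤ ((q.2 + D * M : ℕ) : ℝ) := by push_cast; linarith
      exact_mod_cast this
    refine le_trans ?_ (mul_le_mul_of_nonneg_right hD (by positivity))
    rw [div_mul_eq_mul_div, le_div_iff₀ hc]
    nlinarith
  · intro p hp q hq hpq
    rcases le_total p.1 q.1 with h11 | h11
    · omega
    have hs := (hP.2 p hp q hq).1
    have l1 := h.lo q.1 p.1 h11 (by have := hP.1 p hp; omega)
    rw [hpq] at hs
    have := (abs_le.1 hs).2
    have : (p.1 : ℝ) - q.1 ≤ D := by
      refine le_trans ?_ hD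
      rw [le_div_iff₀ hc]; nlinarith
    have : (p.1 : ℝ) ≤ ((q.1 + D : ℕ) : ℝ) := by push_cast; linarith
    exact_mod_cast this

lemma count_pairs {c0 C0 : ℝ} (hc : 0 < c0) (hC : 0 < C0) : ∃ C1 : ℕ, ∀ {M : ℕ}, 1 ≤ M → ∀ {S H : ℕ → ℝ} {G : ℕ → ℕ → ℝ},
    CntHyp c0 C0 M S H G → ∀ {P : Finset (ℕ × ℕ)}, PairOK C0 M S H P → P.card ≤ C1 * M := by
  obtain ⟨D, hD⟩ := exists_nat_ge (max ((C0 + C0 ^ 2) / c0 ^ 2) (5 * C0 / c0))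
  have hD1 := (le_max_left _ _).trans hD
  have hD2 := (le_max_right _ _).trans hD
  have hD3 : C0 / c0 ≤ D := by
    refine le_trans ?_ hD2
    gcongr; linarith
  refine ⟨3 * ((D + 1) * (D + 1)), fun {M} hM {S H G} h {P} hP => ?_⟩
  have sub : ∀ Q ⊆ P, PairOK C0 M S H Q := fun Q hQ => ⟨fun p hp => hP.1 p (hQ hp), fun p hp q hq => hP.2 p (hQ hp) q (hQ hq)⟩
  set P1 := P.filter (fun p => p.1 + M ≤ p.2)
  set P2 := P.filter (fun p => p.2 + M ≤ p.1)
  set P3 := P.filter (fun p => p.1 < p.2 + M ∧ p.2 < p.1 + M)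
  have hcov : P ⊆ (P1 ∪ P2) ∪ P3 := by
    intro p hp
    simp only [Finset.mem_union, P1, P2, P3, Finset.mem_filter, hp, true_and]
    omega
  have c1 : P1.card ≤ (D + 1) * (D * M + 1) := count_good hc hC D hD1 hD3 hM h (sub _ (Finset.filter_subset _ _)) (by
    intro p hp; exact (Finset.mem_filter.1 hp).2)
  have c3 : P3.card ≤ (D + 1) * (D * M + 1) := count_bad hc hC D hD2 hM h (sub _ (Finset.filter_subset _ _)) (by
    intro p hp; exact (Finset.mem_filter.1 hp).2)
  have c2 : P2.card ≤ (D + 1) * (D * M + 1) := by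
    have : P2.card = (P2.image Prod.swap).card := by
      rw [Finset.card_image_of_injective _ Prod.swap_injective]
    rw [this]
    have hs := sub P2 (Finset.filter_subset _ _)
    apply count_good hc hC D hD1 hD3 hM h
    · constructor
      · intro p hp
        simp only [Finset.mem_image] at hp
        obtain ⟨q, hq, rfl⟩ := hp
        exact (hs.1 q hq).symm
      · intro p hp p' hp'
        simp only [Finset.mem_image] at hp hp'
        obtain ⟨q, hq, rfl⟩ := hp
        obtain ⟨q', hq', rfl⟩ := hp'
        have := hs.2 q hq q' hq'
        simp only [Prod.fst_swap, Prod.snd_swap]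
        constructor
        · convert this.1 using 2; ring
        · convert this.2 using 2; ring
    · intro p hp
      simp only [Finset.mem_image] at hp
      obtain ⟨q, hq, rfl⟩ := hp
      exact (Finset.mem_filter.1 hq).2
  have := Finset.card_le_card hcov
  have u1 := Finset.card_union_le (P1 ∪ P2) P3
  have u2 := Finset.card_union_le P1 P2
  have : (D + 1) * (D * M + 1) ≤ (D + 1) * (D + 1) * M := by
    rw [mul_assoc]; apply Nat.mul_le_mul_left
    nlinarith
  have e : 3 * ((D + 1) * (D + 1)) * M = 3 * ((D + 1) * (D + 1) * M) := by ring
  rw [e]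
  omega

def sg (i : Fin 6) : ℝ := if i < 3 then 1 else -1

def TupOK (C0 : ℝ) (M : ℕ) (S H : ℕ → ℝ) (c : Fin 6 → ℕ) : Prop :=
  |∑ i, sg i * S (c i)| ≤ C0 / 2 ∧ |∑ i, sg i * H (c i)| ≤ C0 * M ^ 2 / 2

lemma sum_diff (S : ℕ → ℝ) (c d : Fin 6 → ℕ) (p q : Fin 6) (hpq : p ≠ q) (hs : sg p = sg q)
    (h : ∀ i, i ≠ p → i ≠ q → c i = d i) :
    |S (c p) + S (c q) - S (d p) - S (d q)| = |(∑ i, sg i * S (c i)) - ∑ i, sg i * S (d i)| := by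
  rw [← Finset.sum_sub_distrib]
  have : ∑ i, (sg i * S (c i) - sg i * S (d i)) = ∑ i ∈ {p, q}, (sg i * S (c i) - sg i * S (d i)) := by
    symm
    apply Finset.sum_subset (Finset.subset_univ _)
    intro i _ hi
    simp at hi
    rw [h i hi.1 hi.2]; ring
  rw [this, Finset.sum_pair hpq, ← hs]
  have h1 : |sg p| = 1 := by unfold sg; split_ifs <;> simp
  have : sg p * S (c p) - sg p * S (d p) + (sg p * S (c q) - sg p * S (d q)) = sg p * (S (c p) + S (c q) - S (d p) - S (d q)) := by ring
  rw [this, abs_mul, h1, one_mul]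

lemma count_tuples {C0 : ℝ} {C1 M : ℕ} {S H : ℕ → ℝ}
    (hcount : ∀ {P : Finset (ℕ × ℕ)}, PairOK C0 M S H P → P.card ≤ C1 * M)
    (A : Finset (Fin 6 → ℕ)) (hA : A ⊆ Fintype.piFinset (fun _ => Finset.range (M ^ 2)))
    (hok : ∀ c ∈ A, TupOK C0 M S H c) (i : Fin 6) (k : ℕ) :
    (A.filter (fun c => c i = k)).card ≤ C1 * M * (M ^ 2) ^ 3 := by
  obtain ⟨p, q, hpq, hs, hpi, hqi, hcard⟩ : ∃ p q : Fin 6, p ≠ q ∧ sg p = sg q ∧ p ≠ i ∧ q ≠ i ∧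
      (Finset.univ.filter (fun x : Fin 6 => x ≠ i ∧ x ≠ p ∧ x ≠ q)).card = 3 := by
    by_cases hi : i < 3
    · refine ⟨3, 4, by decide, by simp [sg], ?_, ?_, ?_⟩ <;> revert hi <;> revert i <;> decide
    · refine ⟨0, 1, by decide, by simp [sg], ?_, ?_, ?_⟩ <;> revert hi <;> revert i <;> decide
  let F : (Fin 6 → ℕ) → (Fin 6 → ℕ) := fun c x => if x = p ∨ x = q then 0 else c x
  have him : ((A.filter (fun c => c i = k)).image F).card ≤ (M ^ 2) ^ 3 := by
    have : (A.filter (fun c => c i = k)).image F ⊆ Fintype.piFinset (fun x => if x ≠ i ∧ x ≠ p ∧ x ≠ q then Finset.range (M ^ 2) else if x = i then {k} else {0}) := by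
      intro d hd
      simp only [Finset.mem_image, Finset.mem_filter] at hd
      obtain ⟨c, ⟨hc, hck⟩, rfl⟩ := hd
      rw [Fintype.mem_piFinset]
      intro x
      have := Fintype.mem_piFinset.1 (hA hc) x
      by_cases h1 : x = i
      · subst h1
        simp [F, hpi.symm, hqi.symm, hck]
      · by_cases h2 : x = p ∨ x = q
        · have : ¬ (x ≠ i ∧ x ≠ p ∧ x ≠ q) := by tauto
          rw [if_neg this, if_neg h1]; simp [F, h2]
        · have h3 : (x ≠ i ∧ x ≠ p ∧ x ≠ q) := by tauto
          rw [if_pos h3]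
          simpa [F, h2] using this
    refine (Finset.card_le_card this).trans ?_
    rw [Fintype.card_piFinset]
    have e : ∀ x : Fin 6, (if x ≠ i ∧ x ≠ p ∧ x ≠ q then Finset.range (M ^ 2) else if x = i then {k} else {0} : Finset ℕ).card = if x ≠ i ∧ x ≠ p ∧ x ≠ q then M ^ 2 else 1 := by
      intro x; split_ifs <;> simp
    simp only [e]
    rw [Finset.prod_ite]
    simp only [Finset.prod_const, one_pow, mul_one]
    rw [hcard]
  have hfib : ∀ b ∈ (A.filter (fun c => c i = k)).image F, ((A.filter (fun c => c i = k)).filter (fun c => F c = b)).card ≤ C1 * M := by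
    intro b _
    set B := (A.filter (fun c => c i = k)).filter (fun c => F c = b)
    have hB : ∀ c ∈ B, c ∈ A ∧ F c = b := by
      intro c hc; simp only [B, Finset.mem_filter] at hc; exact ⟨hc.1.1, hc.2⟩
    have hagree : ∀ c ∈ B, ∀ d ∈ B, ∀ x, x ≠ p → x ≠ q → c x = d x := by
      intro c hc d hd x hx1 hx2
      have := congrFun ((hB c hc).2.trans (hB d hd).2.symm) x
      simpa [F, hx1, hx2] using this
    have : B.card = (B.image (fun c => (c p, c q))).card := by
      rw [Finset.card_image_of_injOn]
      intro c hc d hd hcd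
      simp only [Prod.mk.injEq] at hcd
      ext x
      by_cases h1 : x = p
      · rw [h1]; exact hcd.1
      · by_cases h2 : x = q
        · rw [h2]; exact hcd.2
        · exact hagree c hc d hd x h1 h2
    rw [this]
    apply hcount
    constructor
    · intro r hr
      simp only [Finset.mem_image] at hr
      obtain ⟨c, hc, rfl⟩ := hr
      have h1 := Fintype.mem_piFinset.1 (hA (hB c hc).1)
      exact ⟨by simpa using h1 p, by simpa using h1 q⟩
    · intro r hr r' hr'
      simp only [Finset.mem_image] at hr hr'
      obtain ⟨c, hc, rfl⟩ := hr
      obtain ⟨d, hd, rfl⟩ := hr'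
      have o1 := hok c (hB c hc).1
      have o2 := hok d (hB d hd).1
      constructor
      · simp only
        rw [sum_diff S c d p q hpq hs (hagree c hc d hd)]
        refine (abs_sub _ _).trans ?_
        linarith [o1.1, o2.1]
      · simp only
        rw [sum_diff H c d p q hpq hs (hagree c hc d hd)]
        refine (abs_sub _ _).trans ?_
        linarith [o1.2, o2.2]
  calc _ ≤ (C1 * M) * ((A.filter (fun c => c i = k)).image F).card := Finset.card_le_mul_card_image _ _ hfib
    _ ≤ _ := Nat.mul_le_mul_left _ him

structure Curve (c C p0 e : ℝ) (Γ Γ1 Γ2 Γ3 : ℝ → ℝ) : Prop where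
  hc : 0 < c
  hC : 1 ≤ C
  m0 : Measurable Γ
  m1 : Measurable Γ1
  d0 : ∀ t ∈ Icc p0 (p0 + 3/2), HasDerivAt Γ (Γ1 t) t
  d1 : ∀ t ∈ Icc p0 (p0 + 3/2), HasDerivAt Γ1 (Γ2 t) t
  d2 : ∀ t ∈ Icc p0 (p0 + 3/2), HasDerivAt Γ2 (Γ3 t) t
  b0 : ∀ t ∈ Icc p0 (p0 + 3/2), |Γ t| ≤ C
  b1 : ∀ t ∈ Icc p0 (p0 + 3/2), |Γ1 t| ≤ C
  b2 : ∀ t ∈ Icc p0 (p0 + 3/2), |Γ2 t| ≤ C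
  b3 : ∀ t ∈ Icc p0 (p0 + 3/2), |Γ3 t| ≤ C
  he : e = 1 ∨ e = -1
  lo : ∀ t ∈ Icc p0 (p0 + 3/2), c ≤ e * Γ2 t
  cv : ∀ t ∈ Icc p0 (p0 + 3/2), c ≤ |Γ2 t ^ 2 - Γ1 t * Γ3 t|

lemma mvt_eq {f f' : ℝ → ℝ} {A B : ℝ} (h : ∀ t ∈ Icc A B, HasDerivAt f (f' t) t) {x y : ℝ} (hx : A ≤ x) (hy : y ≤ B)
    (hxy : x ≤ y) : ∃ η ∈ Icc x y, f y - f x = f' η * (y - x) := by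
  rcases hxy.eq_or_lt with rfl | hlt
  · exact ⟨x, by simp, by simp⟩
  · have hsub : ∀ t ∈ Icc x y, t ∈ Icc A B := fun t ht => ⟨hx.trans ht.1, ht.2.trans hy⟩
    obtain ⟨η, hη, he⟩ := exists_hasDerivAt_eq_slope f f' hlt
      (fun t ht => (h t (hsub t ht)).continuousAt.continuousWithinAt) (fun t ht => h t (hsub t (Ioo_subset_Icc_self ht)))
    refine ⟨η, Ioo_subset_Icc_self hη, ?_⟩
    rw [he, div_mul_cancel₀]
    linarith

lemma mvt_le {f f' : ℝ → ℝ} {A B L : ℝ} (h : ∀ t ∈ Icc A B, HasDerivAt f (f' t) t) (hL : ∀ t ∈ Icc A B, |f' t| ≤ L) {x y : ℝ}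
    (hx : x ∈ Icc A B) (hy : y ∈ Icc A B) : |f y - f x| ≤ L * |y - x| := by
  have key : ∀ x y, x ∈ Icc A B → y ∈ Icc A B → x ≤ y → |f y - f x| ≤ L * |y - x| := by
    intro x y hx hy hxy
    obtain ⟨η, hη, he⟩ := mvt_eq h hx.1 hy.2 hxy
    rw [he, abs_mul]
    gcongr
    exact hL η ⟨hx.1.trans hη.1, hη.2.trans hy.2⟩
  rcases le_total x y with hxy | hxy
  · exact key x y hx hy hxy
  · rw [abs_sub_comm, abs_sub_comm y x]; exact key y x hy hx hxy

namespace Curve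
variable {c C p0 e : ℝ} {Γ Γ1 Γ2 Γ3 : ℝ → ℝ} (h : Curve c C p0 e Γ Γ1 Γ2 Γ3)
include h

lemma ee : e * e = 1 := by rcases h.he with h | h <;> rw [h] <;> norm_num
lemma eabs : |e| = 1 := by rcases h.he with h | h <;> rw [h] <;> norm_num
lemma lo' {t : ℝ} (ht : t ∈ Icc p0 (p0 + 3/2)) : c ≤ |Γ2 t| := by
  have := h.lo t ht
  have h2 := le_abs_self (e * Γ2 t)
  rw [abs_mul, h.eabs, one_mul] at h2
  linarith
lemma ne {t : ℝ} (ht : t ∈ Icc p0 (p0 + 3/2)) : Γ2 t ≠ 0 := by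
  have h1 := h.lo' ht
  have h2 := h.hc
  intro h0
  rw [h0, abs_zero] at h1
  linarith

lemma dg : ∀ t ∈ Icc p0 (p0 + 3/2), HasDerivAt (fun t => Γ1 t / Γ2 t) ((Γ2 t ^ 2 - Γ1 t * Γ3 t) / Γ2 t ^ 2) t := by
  intro t ht
  have := (h.d1 t ht).div (h.d2 t ht) (h.ne ht)
  exact this.congr_deriv (by rw [sq (Γ2 t)])

lemma gup : ∀ t ∈ Icc p0 (p0 + 3/2), |(Γ2 t ^ 2 - Γ1 t * Γ3 t) / Γ2 t ^ 2| ≤ 2 * C ^ 2 / c ^ 2 := by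
  intro t ht
  have hc := h.hc
  have hC := h.hC
  rw [abs_div, abs_pow]
  gcongr
  · refine (abs_sub _ _).trans ?_
    rw [abs_pow, abs_mul]
    have := mul_le_mul (h.b1 t ht) (h.b3 t ht) (abs_nonneg _) (by linarith)
    have := pow_le_pow_left₀ (abs_nonneg _) (h.b2 t ht) 2
    linarith
  · exact h.lo' ht

lemma glo : ∀ t ∈ Icc p0 (p0 + 3/2), c / C ^ 2 ≤ |(Γ2 t ^ 2 - Γ1 t * Γ3 t) / Γ2 t ^ 2| := by
  intro t ht
  have hc := h.hc
  have hC := h.hC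
  rw [abs_div, abs_pow]
  have := h.lo' ht
  gcongr
  · exact pow_pos (lt_of_lt_of_le hc this) 2
  · exact h.cv t ht
  · exact h.b2 t ht

lemma gb {t : ℝ} (ht : t ∈ Icc p0 (p0 + 3/2)) : |Γ1 t / Γ2 t| ≤ C / c := by
  have hc := h.hc
  have hC := h.hC
  rw [abs_div]
  gcongr
  · exact h.b1 t ht
  · exact h.lo' ht

lemma cauchy (s : ℝ) {x y : ℝ} (hx : p0 ≤ x) (hy : y ≤ p0 + 3/2) (hxy : x ≤ y) : ∃ η ∈ Icc x y,
    (Γ y - s * Γ1 y) - (Γ x - s * Γ1 x) = (Γ1 η / Γ2 η - s) * (Γ1 y - Γ1 x) := by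
  rcases hxy.eq_or_lt with rfl | hlt
  · exact ⟨x, by simp, by simp⟩
  · have hsub : ∀ t ∈ Icc x y, t ∈ Icc p0 (p0 + 3/2) := fun t ht => ⟨hx.trans ht.1, ht.2.trans hy⟩
    have hd : ∀ t ∈ Icc x y, HasDerivAt (fun t => Γ t - s * Γ1 t) (Γ1 t - s * Γ2 t) t := fun t ht =>
      (h.d0 t (hsub t ht)).sub ((h.d1 t (hsub t ht)).const_mul s)
    obtain ⟨η, hη, he⟩ := exists_ratio_hasDerivAt_eq_ratio_slope (fun t => Γ t - s * Γ1 t) (fun t => Γ1 t - s * Γ2 t) hlt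
      (fun t ht => (hd t ht).continuousAt.continuousWithinAt) (fun t ht => hd t (Ioo_subset_Icc_self ht))
      Γ1 Γ2 (fun t ht => (h.d1 t (hsub t ht)).continuousAt.continuousWithinAt) (fun t ht => h.d1 t (hsub t (Ioo_subset_Icc_self ht)))
    refine ⟨η, Ioo_subset_Icc_self hη, ?_⟩
    have hne := h.ne (hsub η (Ioo_subset_Icc_self hη))
    field_simp
    linear_combination -he
end Curve

lemma six_comb (r h1 h2 : Fin 6 → ℝ) (r0 κ ω0 ω1 ω2 : ℝ) (hr : ∀ i, |r i| ≤ 4) (hr0 : ∀ i, |r i - r0| ≤ κ)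
    (hκ : 0 ≤ κ) (h0 : |∑ i, sg i * (r i * h1 i)| ≤ ω0) (hd : ∀ i, |h2 i - h1 i| ≤ ω1) (hb : ∀ i, |h2 i| ≤ ω2) :
    |r0| * |∑ i, sg i * h2 i| ≤ ω0 + 24 * ω1 + 6 * κ * ω2 := by
  rw [← abs_mul]
  have e : r0 * ∑ i, sg i * h2 i = (∑ i, sg i * (r i * h1 i)) + ∑ i, (sg i * (r i * (h2 i - h1 i)) - sg i * ((r i - r0) * h2 i)) := by
    rw [Finset.mul_sum, ← Finset.sum_add_distrib]
    apply Finset.sum_congr rfl; intro i _; ring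
  rw [e]
  have hs : ∀ i, |sg i| = 1 := by intro i; unfold sg; split_ifs <;> simp
  have : |∑ i, (sg i * (r i * (h2 i - h1 i)) - sg i * ((r i - r0) * h2 i))| ≤ ∑ _i : Fin 6, (4 * ω1 + κ * ω2) := by
    refine (Finset.abs_sum_le_sum_abs _ _).trans (Finset.sum_le_sum fun i _ => ?_)
    refine (abs_sub _ _).trans ?_
    rw [abs_mul, abs_mul, abs_mul, abs_mul, hs, one_mul, one_mul]
    exact add_le_add (mul_le_mul (hr i) (hd i) (abs_nonneg _) (by norm_num)) (mul_le_mul (hr0 i) (hb i) (abs_nonneg _) hκ)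
  simp only [Finset.sum_const, Finset.card_univ, Fintype.card_fin, nsmul_eq_mul] at this
  push_cast at this
  refine (abs_add_le _ _).trans ?_
  linarith

lemma sg_sum : ∑ i, sg i = 0 := by
  simp [Fin.sum_univ_six, sg]

noncomputable def yy (p a : ℝ) (M c : ℕ) : ℝ := p + c * (a / (M : ℝ) ^ 2)
noncomputable def SS (e : ℝ) (Γ1 : ℝ → ℝ) (p a : ℝ) (M c : ℕ) : ℝ := e * (Γ1 (yy p a M c) - Γ1 p) * ((M : ℝ) ^ 2 / a)
noncomputable def hh (Γ Γ1 Γ2 : ℝ → ℝ) (p t : ℝ) : ℝ := (Γ t - Γ1 p / Γ2 p * Γ1 t) - (Γ p - Γ1 p / Γ2 p * Γ1 p)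
noncomputable def HH (e : ℝ) (Γ Γ1 Γ2 : ℝ → ℝ) (p a : ℝ) (M c : ℕ) : ℝ :=
  e * hh Γ Γ1 Γ2 p (yy p a M c) * ((M : ℝ) ^ 2 / a) ^ 2

lemma yy_mono {p a : ℝ} (ha : 0 < a) {M b c : ℕ} (h : b ≤ c) : yy p a M b ≤ yy p a M c := by
  unfold yy
  have : (b : ℝ) ≤ c := by exact_mod_cast h
  gcongr

lemma yy_zero (p a : ℝ) (M : ℕ) : yy p a M 0 = p := by simp [yy]
lemma yy_last {p a : ℝ} {M : ℕ} (hM : 1 ≤ M) : yy p a M (M ^ 2) = p + a := by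
  have : (M : ℝ) ≠ 0 := by positivity
  unfold yy; push_cast; field_simp

lemma yy_mem {p a : ℝ} (ha : 0 < a) {M c : ℕ} (hM : 1 ≤ M) (h : c ≤ M ^ 2) : yy p a M c ∈ Icc p (p + a) := by
  constructor
  · have := yy_mono (p := p) ha (Nat.zero_le c) (M := M)
    rwa [yy_zero] at this
  · have := yy_mono (p := p) (M := M) ha h
    rwa [yy_last hM] at this

namespace Curve
variable {c C p0 e : ℝ} {Γ Γ1 Γ2 Γ3 : ℝ → ℝ} (h : Curve c C p0 e Γ Γ1 Γ2 Γ3)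
include h

lemma cnt {p a C0 : ℝ} (ha : 0 < a) (hp : p0 ≤ p) (hpa : p + a ≤ p0 + 3/2) {M : ℕ} (hM : 1 ≤ M)
    (h1 : C ≤ C0) (h2 : 2 * C ^ 2 / c ^ 2 ≤ C0) :
    ∃ G, CntHyp (c / C ^ 2) C0 M (SS e Γ1 p a M) (HH e Γ Γ1 Γ2 p a M) G := by
  have hc := h.hc
  have hC := h.hC
  have hMr : (0:ℝ) < (M:ℝ)^2 := by positivity
  have hsub : ∀ t ∈ Icc p (p + a), t ∈ Icc p0 (p0 + 3/2) := fun t ht => ⟨hp.trans ht.1, ht.2.trans hpa⟩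
  have key : ∀ i k : ℕ, ∃ η, i ≤ k → k < M ^ 2 → η ∈ Icc (yy p a M i) (yy p a M k) ∧
    (Γ (yy p a M k) - Γ1 p / Γ2 p * Γ1 (yy p a M k)) - (Γ (yy p a M i) - Γ1 p / Γ2 p * Γ1 (yy p a M i)) =
      (Γ1 η / Γ2 η - Γ1 p / Γ2 p) * (Γ1 (yy p a M k) - Γ1 (yy p a M i)) := by
    intro i k
    by_cases hik : i ≤ k ∧ k < M ^ 2
    · obtain ⟨η, h1, h2⟩ := h.cauchy (Γ1 p / Γ2 p) (hsub _ (yy_mem ha hM (hik.1.trans hik.2.le))).1 (hsub _ (yy_mem ha hM hik.2.le)).2 (yy_mono ha hik.1)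
      exact ⟨η, fun _ _ => ⟨h1, h2⟩⟩
    · exact ⟨0, fun h1 h2 => absurd ⟨h1, h2⟩ hik⟩
  choose η hη using key
  have hηm : ∀ i k, i ≤ k → k < M ^ 2 → η i k ∈ Icc p (p + a) := fun i k h1 h2 =>
    ⟨(yy_mem ha hM (h1.trans h2.le)).1.trans (hη i k h1 h2).1.1, (hη i k h1 h2).1.2.trans (yy_mem ha hM h2.le).2⟩
  have ydiff : ∀ i k : ℕ, yy p a M k - yy p a M i = ((k:ℝ) - i) * (a / (M:ℝ)^2) := by
    intro i k; unfold yy; ring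
  have hS : ∀ i k : ℕ, i ≤ k → k < M ^ 2 → ∃ s, c ≤ s ∧ s ≤ C ∧ SS e Γ1 p a M k - SS e Γ1 p a M i = s * ((k:ℝ) - i) := by
    intro i k hik hk
    obtain ⟨s, hs, he⟩ := mvt_eq h.d1 (hsub _ (yy_mem ha hM (hik.trans hk.le))).1 (hsub _ (yy_mem ha hM hk.le)).2 (yy_mono ha hik)
    have hs' : s ∈ Icc p0 (p0 + 3/2) := hsub _ ⟨(yy_mem ha hM (hik.trans hk.le)).1.trans hs.1, hs.2.trans (yy_mem ha hM hk.le).2⟩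
    refine ⟨e * Γ2 s, h.lo s hs', ?_, ?_⟩
    · refine (le_abs_self _).trans ?_
      rw [abs_mul, h.eabs, one_mul]; exact h.b2 s hs'
    · have : SS e Γ1 p a M k - SS e Γ1 p a M i = e * (Γ1 (yy p a M k) - Γ1 (yy p a M i)) * ((M : ℝ) ^ 2 / a) := by unfold SS; ring
      rw [this, he, ydiff]
      field_simp
  have hcC : c / C ^ 2 ≤ c := by
    apply div_le_self hc.le
    nlinarith
  refine ⟨fun i k => ((M:ℝ)^2 / a) * (Γ1 (η i k) / Γ2 (η i k) - Γ1 p / Γ2 p), ?_, ?_, ?_, ?_, ?_⟩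
  · intro i k hik hk
    obtain ⟨s, h1, h2, h3⟩ := hS i k hik hk
    have : (i:ℝ) ≤ k := by exact_mod_cast hik
    rw [h3]; apply mul_le_mul_of_nonneg_right _ (by linarith); linarith
  · intro i k hik hk
    obtain ⟨s, h1, h2, h3⟩ := hS i k hik hk
    have : (i:ℝ) ≤ k := by exact_mod_cast hik
    rw [h3]; apply mul_le_mul_of_nonneg_right _ (by linarith); linarith
  · intro i k hik hk
    have := (hη i k hik hk).2
    unfold HH SS hh
    linear_combination e * ((M:ℝ)^2 / a)^2 * this
  · intro i k hik hk
    have := mvt_le h.dg h.gup (hsub p ⟨le_refl _, by linarith⟩) (hsub _ (hηm i k hik hk))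
    have m := hηm i k hik hk
    rw [abs_mul, abs_of_pos (by positivity)]
    have h3 : |η i k - p| ≤ a := by rw [abs_le]; constructor <;> linarith [m.1, m.2]
    calc (M:ℝ)^2 / a * |Γ1 (η i k) / Γ2 (η i k) - Γ1 p / Γ2 p| ≤ (M:ℝ)^2 / a * (2 * C ^ 2 / c ^ 2 * |η i k - p|) := by gcongr
      _ ≤ (M:ℝ)^2 / a * (C0 * a) := by gcongr; linarith
      _ = C0 * M ^ 2 := by field_simp
  · intro i k i' k' h1 h2 h3 h4
    have m := (hη i k h1 (by omega)).1
    have m' := (hη i' k' h3 h4).1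
    have hle : η i k ≤ η i' k' := m.2.trans ((yy_mono ha h2).trans m'.1)
    obtain ⟨s, hs, he⟩ := mvt_eq h.dg (hsub _ (hηm i k h1 (by omega))).1 (hsub _ (hηm i' k' h3 h4)).2 hle
    have hs' : s ∈ Icc p0 (p0 + 3/2) := ⟨(hsub _ (hηm i k h1 (by omega))).1.trans hs.1, hs.2.trans (hsub _ (hηm i' k' h3 h4)).2⟩
    have e1 : (M:ℝ)^2 / a * (Γ1 (η i' k') / Γ2 (η i' k') - Γ1 p / Γ2 p) - (M:ℝ)^2 / a * (Γ1 (η i k) / Γ2 (η i k) - Γ1 p / Γ2 p)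
      = (M:ℝ)^2 / a * (Γ1 (η i' k') / Γ2 (η i' k') - Γ1 (η i k) / Γ2 (η i k)) := by ring
    rw [e1, he, abs_mul, abs_of_pos (by positivity : (0:ℝ) < (M:ℝ)^2 / a), abs_mul, abs_of_nonneg (sub_nonneg.2 hle)]
    have y1 := ydiff k i'
    have y2 : ((i':ℝ) - k) * (a / (M:ℝ)^2) ≤ η i' k' - η i k := by rw [← y1]; linarith [m.2, m'.1]
    calc c / C ^ 2 * ((i':ℝ) - k) = (M:ℝ)^2 / a * (c / C ^ 2 * (((i':ℝ) - k) * (a / (M:ℝ)^2))) := by field_simp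
      _ ≤ (M:ℝ)^2 / a * (|(Γ2 s ^ 2 - Γ1 s * Γ3 s) / Γ2 s ^ 2| * (η i' k' - η i k)) := by
        gcongr
        · have : (k:ℝ) ≤ i' := by exact_mod_cast h2
          have : (0:ℝ) ≤ i' - k := by linarith
          positivity
        · exact h.glo s hs'

set_option maxHeartbeats 800000 in
lemma tup {p a D N r0 : ℝ} (ha : 0 < a) (ha2 : a ≤ 3/2) (hp : p0 ≤ p) (hpa : p + a ≤ p0 + 3/2) {M : ℕ} (hM : 1 ≤ M)
    (hD : 0 ≤ D) (hN : N ≤ a ^ 2 / (M:ℝ)^2) (hr0 : 1/4 ≤ |r0|) (hr0' : |r0| ≤ 3) {k : Fin 6 → ℕ} (hk : ∀ i, k i < M ^ 2) {r t : Fin 6 → ℝ}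
    (ht : ∀ i, t i ∈ Icc (yy p a M (k i)) (yy p a M (k i + 1))) (hr : ∀ i, |r i - r0| ≤ 1 / (M:ℝ)^2)
    (s0 : |∑ i, sg i * r i| ≤ D * N) (s1 : |∑ i, sg i * (r i * Γ1 (t i))| ≤ D * N) (s2 : |∑ i, sg i * (r i * Γ (t i))| ≤ D * N)
    {C0 : ℝ} (hC0 : 32 * C * (1 + C ^ 2 / c ^ 2) * (D + 30) ≤ C0) :
    TupOK C0 M (SS e Γ1 p a M) (HH e Γ Γ1 Γ2 p a M) k := by
  have hc := h.hc
  have hC := h.hC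
  have hM1 : (1:ℝ) ≤ (M:ℝ)^2 := by
    have : (1:ℝ) ≤ M := by exact_mod_cast hM
    nlinarith
  have hMr : (0:ℝ) < (M:ℝ)^2 := by positivity
  have hsub : ∀ t ∈ Icc p (p + a), t ∈ Icc p0 (p0 + 3/2) := fun t ht => ⟨hp.trans ht.1, ht.2.trans hpa⟩
  have hy : ∀ i, yy p a M (k i) ∈ Icc p (p + a) := fun i => yy_mem ha hM (hk i).le
  have hy1 : ∀ i, yy p a M (k i + 1) ∈ Icc p (p + a) := fun i => yy_mem ha hM (hk i)
  have htm : ∀ i, t i ∈ Icc p (p + a) := fun i => ⟨(hy i).1.trans (ht i).1, (ht i).2.trans (hy1 i).2⟩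
  have hty : ∀ i, |yy p a M (k i) - t i| ≤ a / (M:ℝ)^2 := by
    intro i
    have : yy p a M (k i + 1) - yy p a M (k i) = a / (M:ℝ)^2 := by unfold yy; push_cast; ring
    rw [abs_le]; constructor <;> linarith [(ht i).1, (ht i).2]
  have hyp : ∀ i, |yy p a M (k i) - p| ≤ a := by
    intro i; rw [abs_le]; constructor <;> linarith [(hy i).1, (hy i).2]
  have hpm : p ∈ Icc p (p + a) := ⟨le_refl _, by linarith⟩
  have hr4 : ∀ i, |r i| ≤ 4 := by
    intro i
    have h1 := hr i
    have h2 : 1 / (M:ℝ)^2 ≤ 1 := by rw [div_le_one hMr]; exact hM1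
    have := abs_sub_abs_le_abs_sub (r i) r0
    linarith
  set g := Γ1 p / Γ2 p with hg
  have hgb : |g| ≤ C / c := h.gb (hsub p hpm)
  set Q := 1 + C ^ 2 / c ^ 2 with hQ
  have hQ1 : 1 ≤ Q := by rw [hQ]; have : 0 ≤ C ^ 2 / c ^ 2 := by positivity
                         linarith
  have hCc : C / c ≤ Q := by
    rw [hQ]
    have : (C / c) ^ 2 = C ^ 2 / c ^ 2 := by ring
    nlinarith [sq_nonneg (C / c - 1)]
  have hN0 : D * N ≤ D * (a ^ 2 / (M:ℝ)^2) := by gcongr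
  -- first
  have A := six_comb r (fun i => Γ1 (t i) - Γ1 p) (fun i => Γ1 (yy p a M (k i)) - Γ1 p) r0 (1 / (M:ℝ)^2) (D * N + C * (D * N)) (C * (a / (M:ℝ)^2)) (C * a)
    hr4 hr (by positivity) (by
      have e1 : ∑ i, sg i * (r i * (Γ1 (t i) - Γ1 p)) = (∑ i, sg i * (r i * Γ1 (t i))) - Γ1 p * ∑ i, sg i * r i := by
        rw [Finset.mul_sum, ← Finset.sum_sub_distrib]; apply Finset.sum_congr rfl; intro i _; ring
      rw [e1]
      refine (abs_sub _ _).trans (add_le_add s1 ?_)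
      rw [abs_mul]
      exact mul_le_mul (h.b1 p (hsub p hpm)) s0 (abs_nonneg _) (by linarith))
    (by
      intro i
      have := mvt_le h.d1 h.b2 (hsub _ (htm i)) (hsub _ (hy i))
      rw [sub_sub_sub_cancel_right]
      exact this.trans (by gcongr; exact hty i))
    (by
      intro i
      have := mvt_le h.d1 h.b2 (hsub _ hpm) (hsub _ (hy i))
      exact this.trans (by gcongr; exact hyp i))
  -- second
  have hhd : ∀ s ∈ Icc p (p + a), HasDerivAt (hh Γ Γ1 Γ2 p) (Γ1 s - g * Γ2 s) s := fun s hs =>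
    ((h.d0 s (hsub s hs)).sub ((h.d1 s (hsub s hs)).const_mul g)).sub_const _
  have hhb : ∀ s ∈ Icc p (p + a), |Γ1 s - g * Γ2 s| ≤ C * (2 * Q) * a := by
    intro s hs
    have e1 : Γ1 s - g * Γ2 s = Γ2 s * (Γ1 s / Γ2 s - Γ1 p / Γ2 p) := by
      have := h.ne (hsub s hs)
      rw [hg]; field_simp
    have h1 := mvt_le h.dg h.gup (hsub p hpm) (hsub s hs)
    have h2 : |s - p| ≤ a := by rw [abs_le]; constructor <;> linarith [hs.1, hs.2]
    have h3 : 2 * C ^ 2 / c ^ 2 ≤ 2 * Q := by rw [hQ, mul_div_assoc]; linarith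
    rw [e1, abs_mul, mul_assoc]
    refine mul_le_mul (h.b2 s (hsub s hs)) (h1.trans ?_) (abs_nonneg _) (by linarith)
    gcongr
  have B := six_comb r (fun i => hh Γ Γ1 Γ2 p (t i)) (fun i => hh Γ Γ1 Γ2 p (yy p a M (k i))) r0 (1 / (M:ℝ)^2)
    (D * N + Q * (D * N) + (C + Q * C) * (D * N)) (C * (2 * Q) * a * (a / (M:ℝ)^2)) (C * (2 * Q) * a * a)
    hr4 hr (by positivity) (by
      have e1 : ∑ i, sg i * (r i * hh Γ Γ1 Γ2 p (t i)) = (∑ i, sg i * (r i * Γ (t i))) - g * (∑ i, sg i * (r i * Γ1 (t i))) - (Γ p - g * Γ1 p) * ∑ i, sg i * r i := by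
        rw [Finset.mul_sum, Finset.mul_sum, ← Finset.sum_sub_distrib, ← Finset.sum_sub_distrib]; apply Finset.sum_congr rfl; intro i _
        unfold hh; ring
      rw [e1]
      refine (abs_sub _ _).trans (add_le_add ((abs_sub _ _).trans (add_le_add s2 ?_)) ?_)
      · rw [abs_mul]
        exact mul_le_mul (hgb.trans hCc) s1 (abs_nonneg _) (by linarith)
      · rw [abs_mul]
        refine mul_le_mul ((abs_sub _ _).trans (add_le_add (h.b0 p (hsub p hpm)) ?_)) s0 (abs_nonneg _) (by positivity)
        rw [abs_mul]
        exact mul_le_mul (hgb.trans hCc) (h.b1 p (hsub p hpm)) (abs_nonneg _) (by positivity))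
    (by
      intro i
      exact (mvt_le hhd hhb (htm i) (hy i)).trans (by gcongr; exact hty i))
    (by
      intro i
      have e0 : hh Γ Γ1 Γ2 p p = 0 := by simp [hh]
      have := mvt_le hhd hhb hpm (hy i)
      rw [e0, sub_zero] at this
      exact this.trans (by gcongr; exact hyp i))
  have hs4 : ∀ x y : ℝ, 0 ≤ x → |r0| * x ≤ y → x ≤ 4 * y := by intro x y hx hxy; nlinarith
  have A' := hs4 _ _ (abs_nonneg _) A
  have B' := hs4 _ _ (abs_nonneg _) B
  have hDN : D * N ≤ D * (a ^ 2 / (M:ℝ)^2) := hN0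
  constructor
  · have e1 : ∑ i, sg i * SS e Γ1 p a M (k i) = e * ((M:ℝ)^2 / a) * ∑ i, sg i * (Γ1 (yy p a M (k i)) - Γ1 p) := by
      rw [Finset.mul_sum]; apply Finset.sum_congr rfl; intro i _; unfold SS; ring
    rw [e1, abs_mul, abs_mul, h.eabs, one_mul, abs_of_pos (by positivity : (0:ℝ) < (M:ℝ)^2 / a)]
    calc _ ≤ (M:ℝ)^2 / a * (4 * (D * (a ^ 2 / (M:ℝ)^2) + C * (D * (a ^ 2 / (M:ℝ)^2)) + 24 * (C * (a / (M:ℝ)^2)) + 6 * (1 / (M:ℝ)^2) * (C * a))) := by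
          gcongr; refine A'.trans ?_; gcongr
      _ = 4 * ((1 + C) * D * a + 30 * C) := by field_simp; ring
      _ ≤ 4 * ((C + C) * D * 2 + 30 * C) := by gcongr; linarith
      _ ≤ (32 * C * 1 * (D + 30)) / 2 := by
          have : 0 ≤ C * D := by positivity
          linarith
      _ ≤ (32 * C * Q * (D + 30)) / 2 := by gcongr
      _ ≤ C0 / 2 := by linarith
  · have e1 : ∑ i, sg i * HH e Γ Γ1 Γ2 p a M (k i) = e * ((M:ℝ)^2 / a)^2 * ∑ i, sg i * hh Γ Γ1 Γ2 p (yy p a M (k i)) := by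
      rw [Finset.mul_sum]; apply Finset.sum_congr rfl; intro i _; unfold HH; ring
    rw [e1, abs_mul, abs_mul, h.eabs, one_mul, abs_of_pos (by positivity : (0:ℝ) < ((M:ℝ)^2 / a)^2)]
    calc _ ≤ ((M:ℝ)^2 / a)^2 * (4 * (D * (a ^ 2 / (M:ℝ)^2) + Q * (D * (a ^ 2 / (M:ℝ)^2)) + (C + Q * C) * (D * (a ^ 2 / (M:ℝ)^2)) + 24 * (C * (2 * Q) * a * (a / (M:ℝ)^2)) + 6 * (1 / (M:ℝ)^2) * (C * (2 * Q) * a * a))) := by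
          gcongr; refine B'.trans ?_; gcongr
      _ = 4 * ((1 + Q) * (1 + C) * D + 60 * C * Q) * (M:ℝ)^2 := by field_simp; ring
      _ ≤ 4 * ((Q + Q) * (C + C) * D + 60 * C * Q) * (M:ℝ)^2 := by gcongr
      _ ≤ (32 * C * Q * (D + 30)) / 2 * (M:ℝ)^2 := by
          have : 0 ≤ C * Q := by positivity
          have : 4 * ((Q + Q) * (C + C) * D + 60 * C * Q) ≤ 32 * C * Q * (D + 30) / 2 := by
            have e1 : 4 * ((Q + Q) * (C + C) * D + 60 * C * Q) = 16 * (C * Q * D) + 240 * (C * Q) := by ring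
            have e2 : 32 * C * Q * (D + 30) / 2 = 16 * (C * Q * D) + 480 * (C * Q) := by ring
            rw [e1, e2]; linarith
          exact mul_le_mul_of_nonneg_right this hMr.le
      _ ≤ C0 / 2 * (M:ℝ)^2 := mul_le_mul_of_nonneg_right (by linarith) hMr.le
      _ = C0 * (M:ℝ)^2 / 2 := by ring
end Curve

open scoped FourierTransform in
lemma cc_fourier (α : ℝ → ℝ) (hs : ContDiff ℝ (⊤ : ℕ∞) α) (hc : HasCompactSupport α) :
    ∃ a : ℝ → ℂ, Continuous a ∧ Integrable a ∧ (∀ x, (α x : ℂ) = ∫ y, Complex.exp ((2 * Real.pi * (x * y) : ℝ) * Complex.I) * a y) ∧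
      (∀ x, a x = ∫ y, Complex.exp ((-(2 * Real.pi * (x * y)) : ℝ) * Complex.I) * α y) := by
  have h1 : HasCompactSupport (fun x => (α x : ℂ)) := hc.comp_left (g := fun x : ℝ => (x : ℂ)) (by simp)
  have h2 : ContDiff ℝ (⊤ : ℕ∞) (fun x => (α x : ℂ)) := Complex.ofRealCLM.contDiff.comp hs
  set ψ : SchwartzMap ℝ ℂ := h1.toSchwartzMap h2 with hψ
  have hψa : ∀ x, ψ x = α x := fun x => rfl
  set Fψ : SchwartzMap ℝ ℂ := 𝓕 ψ with hF
  refine ⟨⇑Fψ, Fψ.continuous, Fψ.integrable, ?_, ?_⟩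
  · intro x
    have : (𝓕⁻ Fψ) x = ψ x := by simp [hF]
    rw [← hψa, ← this, SchwartzMap.fourierInv_coe, Real.fourierInv_eq_fourier_neg, Real.fourier_real_eq_integral_exp_smul]
    congr 1; ext y; rw [smul_eq_mul]; congr 3; push_cast; ring
  · intro x
    rw [hF, SchwartzMap.fourier_coe, Real.fourier_real_eq_integral_exp_smul]
    congr 1; ext y; rw [smul_eq_mul, hψa]; congr 3; push_cast; ring

open scoped FourierTransform in
lemma exists_weight : ∃ (w : ℝ → ℝ) (Ω : ℝ), 0 < Ω ∧ Continuous w ∧ (∀ v, 0 ≤ w v) ∧ Integrable w ∧ (∀ v, |v| ≤ 1 → 1 ≤ w v) ∧ (∃ Cw, ∀ v, w v ≤ Cw) ∧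
    ∀ ω : ℝ, Ω ≤ |ω| → ∫ v : ℝ, Complex.exp ((ω * v : ℝ) * Complex.I) * w v = 0 := by
  let b : ContDiffBump (0:ℝ) := ⟨1, 2, by norm_num, by norm_num⟩
  have h1 : HasCompactSupport (fun x => (b x : ℂ)) := b.hasCompactSupport.comp_left (g := fun x : ℝ => (x : ℂ)) (by simp)
  have h2 : ContDiff ℝ (⊤ : ℕ∞) (fun x => (b x : ℂ)) := Complex.ofRealCLM.contDiff.comp b.contDiff
  set ψ : SchwartzMap ℝ ℂ := h1.toSchwartzMap h2 with hψ
  have hψa : ∀ x, ψ x = b x := fun x => rfl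
  have h0 : (𝓕 ψ) 0 ≠ 0 := by
    rw [SchwartzMap.fourier_coe, Real.fourier_real_eq_integral_exp_smul]
    simp only [mul_zero, Complex.ofReal_zero, zero_mul, Complex.exp_zero, one_smul, hψa]
    rw [integral_complex_ofReal]
    exact_mod_cast b.integral_pos.ne'
  have hcont : Continuous (fun v => ‖(𝓕 ψ) v‖) := (𝓕 ψ).continuous.norm
  set m := ‖(𝓕 ψ) 0‖ with hm
  have hmp : 0 < m := norm_pos_iff.2 h0
  obtain ⟨ε, hε, hball⟩ := Metric.continuousAt_iff.1 (hcont.continuousAt (x := 0)) (m/2) (by positivity)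
  set η := ε / 2 with hη
  have hηp : 0 < η := by positivity
  refine ⟨fun v => (2 / m)^2 * ‖(𝓕 ψ) (η * v)‖^2, 8 * Real.pi * η, by positivity, by fun_prop, fun v => by positivity, ?_, ?_,
    ⟨(2 / m)^2 * (SchwartzMap.seminorm ℝ 0 0 (𝓕 ψ))^2, fun v => mul_le_mul_of_nonneg_left (pow_le_pow_left₀ (norm_nonneg _) (SchwartzMap.norm_le_seminorm ℝ (𝓕 ψ) _) 2) (by positivity)⟩, ?_⟩
  · have : Integrable (fun v => ‖(𝓕 ψ) v‖^2) := by
      have := ((𝓕 ψ).memLp 2 volume).integrable_norm_pow (by norm_num)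
      simpa using this
    exact (this.comp_mul_left' hηp.ne').const_mul _
  · intro v hv
    have : dist (η * v) 0 < ε := by
      rw [Real.dist_eq, sub_zero, abs_mul, abs_of_pos hηp]
      nlinarith
    have h3 := hball this
    rw [Real.dist_eq, abs_lt] at h3
    have h4 : m / 2 ≤ ‖(𝓕 ψ) (η * v)‖ := by linarith [h3.1]
    have h5 := pow_le_pow_left₀ (by positivity) h4 2
    have h6 : (1:ℝ) = (2/m)^2 * (m/2)^2 := by field_simp
    rw [h6]; exact mul_le_mul_of_nonneg_left h5 (by positivity)
  · intro ω hω
    -- change variables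
    set x0 := ω / (2 * Real.pi * η) with hx0
    have hx : 4 ≤ |x0| := by
      rw [hx0, abs_div, abs_of_pos (by positivity : 0 < 2 * Real.pi * η), le_div_iff₀ (by positivity)]
      linarith
    have e0 : ∫ v, inner ℂ ((𝓕 (SchwartzMap.compSubConstCLM ℂ x0 ψ)) v) ((𝓕 ψ) v) = 0 := by
      rw [SchwartzMap.integral_inner_fourier_fourier]
      rw [← integral_zero ℝ ℂ]
      congr 1; ext x
      by_cases hxx : |x| < 2
      · have : ψ (x - x0) = 0 := by
          rw [hψa]
          have : b (x - x0) = 0 := by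
            apply b.zero_of_le_dist
            rw [Real.dist_eq, sub_zero]
            have := abs_sub_abs_le_abs_sub x0 x
            rw [abs_sub_comm x0 x] at this
            change (2:ℝ) ≤ _
            linarith
          rw [this]; simp
        simp [this]
      · have : ψ x = 0 := by
          rw [hψa]
          have : b x = 0 := by
            apply b.zero_of_le_dist
            rw [Real.dist_eq, sub_zero]
            change (2:ℝ) ≤ _
            linarith
          rw [this]; simp
        simp [this]
    have e1 : ∀ v, inner ℂ ((𝓕 (SchwartzMap.compSubConstCLM ℂ x0 ψ)) v) ((𝓕 ψ) v) = Complex.exp ((2 * Real.pi * x0 * v : ℝ) * Complex.I) * (‖(𝓕 ψ) v‖^2 : ℝ) := by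
      intro v
      have : (𝓕 (SchwartzMap.compSubConstCLM ℂ x0 ψ)) v = Complex.exp ((-(2 * Real.pi * x0 * v) : ℝ) * Complex.I) * (𝓕 ψ) v := by
        rw [SchwartzMap.fourier_coe, SchwartzMap.fourier_coe, Real.fourier_real_eq_integral_exp_smul, Real.fourier_real_eq_integral_exp_smul]
        rw [← integral_const_mul]
        rw [← integral_sub_right_eq_self (fun y => Complex.exp ((-(2 * Real.pi * x0 * v) : ℝ) * Complex.I) * Complex.exp (↑(-2 * Real.pi * y * v) * Complex.I) • ψ y) x0]
        congr 1; ext y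
        rw [SchwartzMap.compSubConstCLM_apply, smul_eq_mul, smul_eq_mul, ← mul_assoc, ← Complex.exp_add]
        congr 2; push_cast; ring
      rw [this, RCLike.inner_apply, map_mul, ← Complex.exp_conj, map_mul, Complex.conj_I, Complex.conj_ofReal]
      rw [mul_left_comm, Complex.mul_conj, Complex.normSq_eq_norm_sq]
      congr 2; push_cast; ring
    simp_rw [e1] at e0
    have e2 : ∫ v : ℝ, Complex.exp ((ω * v : ℝ) * Complex.I) * (((2 / m)^2 * ‖(𝓕 ψ) (η * v)‖^2 : ℝ) : ℂ)
        = (((2/m)^2 : ℝ) : ℂ) * ∫ v : ℝ, (fun v => Complex.exp ((2 * Real.pi * x0 * v : ℝ) * Complex.I) * (‖(𝓕 ψ) v‖^2 : ℝ)) (η * v) := by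
      rw [← integral_const_mul]
      congr 1; ext v
      have : 2 * Real.pi * x0 * (η * v) = ω * v := by rw [hx0]; field_simp
      simp only [this]; push_cast; ring
    have gen : ∀ g : ℝ → ℂ, (∫ v, g v = 0) → ∫ v, g (η * v) = 0 := by
      intro g hg; rw [Measure.integral_comp_mul_left, hg]; simp
    exact e2.trans (by rw [gen _ e0, mul_zero])

lemma ortho {Y Z : Type*} [MeasurableSpace Y] [MeasurableSpace Z] {μ : Measure Z} [SigmaFinite μ] {ν : Measure Y} [SFinite ν]
    (E : Fin 6 → Z → Y → ℂ) (B : Fin 6 → Z → ℂ) (W : Y → ℂ) (hE : ∀ i, Measurable (Function.uncurry (E i)))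
    (hE1 : ∀ i z y, ‖E i z y‖ ≤ 1) (hB : ∀ i, Integrable (B i) μ) (hW : Integrable W ν)
    (h0 : ∀ z : Fin 6 → Z, (∀ i, B i (z i) ≠ 0) → ∫ y, (∏ i, E i (z i) y) * W y ∂ν = 0) :
    ∫ y, (∏ i, ∫ z, E i z y * B i z ∂μ) * W y ∂ν = 0 := by
  have e1 : ∀ y, (∏ i, ∫ z, E i z y * B i z ∂μ) * W y = ∫ z : Fin 6 → Z, (∏ i, E i (z i) y) * (∏ i, B i (z i)) * W y ∂(Measure.pi fun _ => μ) := by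
    intro y
    have := integral_fintype_prod_eq_prod (ι := Fin 6) (𝕜 := ℂ) (E := fun _ => Z) (μ := fun _ => μ) (fun i z => E i z y * B i z)
    rw [integral_mul_const, ← this]
    congr 2; ext z; rw [Finset.prod_mul_distrib]
  simp_rw [e1]
  rw [integral_integral_swap]
  · rw [← integral_zero (Fin 6 → Z) ℂ]
    congr 1; ext z
    by_cases hz : ∀ i, B i (z i) ≠ 0
    · have := h0 z hz
      calc _ = ∫ y, (∏ i, B i (z i)) * ((∏ i, E i (z i) y) * W y) ∂ν := by congr 1; ext y; ring
        _ = 0 := by rw [integral_const_mul, this, mul_zero]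
    · push Not at hz
      obtain ⟨i, hi⟩ := hz
      have : ∏ i, B i (z i) = 0 := Finset.prod_eq_zero (Finset.mem_univ i) hi
      simp [this]
  · have hprod : Integrable (fun z : Fin 6 → Z => ∏ i, B i (z i)) (Measure.pi fun _ => μ) := Integrable.fintype_prod (f := B) hB
    have hp := hW.mul_prod hprod
    have hm : Measurable (fun q : Y × (Fin 6 → Z) => ∏ i, E i (q.2 i) q.1) := by
      refine Finset.measurable_prod _ fun i _ => ?_
      have : Measurable (fun q : Y × (Fin 6 → Z) => (q.2 i, q.1)) := by fun_prop
      exact (hE i).comp this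
    have hb := hp.bdd_mul (c := 1) hm.aestronglyMeasurable (ae_of_all _ fun q => by
      rw [norm_prod]; exact Finset.prod_le_one (fun i _ => norm_nonneg _) (fun i _ => hE1 i _ _))
    refine hb.congr (ae_of_all _ fun q => ?_)
    simp only [Function.uncurry]; ring

noncomputable def cj (i : Fin 6) (z : ℂ) : ℂ := if i < 3 then z else (starRingEnd ℂ) z

lemma cj_norm (i : Fin 6) (z : ℂ) : ‖cj i z‖ = ‖z‖ := by unfold cj; split_ifs <;> simp
lemma cj_sum (i : Fin 6) {ι : Type*} (s : Finset ι) (f : ι → ℂ) : cj i (∑ k ∈ s, f k) = ∑ k ∈ s, cj i (f k) := by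
  unfold cj; split_ifs <;> simp
lemma cj_prod (z : ℂ) : ∏ i, cj i z = ((‖z‖ ^ 6 : ℝ) : ℂ) := by
  have h := Complex.mul_conj z
  rw [Complex.normSq_eq_norm_sq] at h
  have : ∏ i, cj i z = (z * (starRingEnd ℂ) z) ^ 3 := by
    simp [Fin.prod_univ_six, cj]; ring
  rw [this, h]; push_cast; ring

lemma amgm6 (a : Fin 6 → ℝ) (ha : ∀ i, 0 ≤ a i) : ∏ i, a i ≤ ∑ i, (1/6) * a i ^ 6 := by
  have h := Real.geom_mean_le_arith_mean_weighted Finset.univ (fun _ : Fin 6 => (1/6:ℝ)) (fun i => a i ^ 6) (by intros; norm_num) (by simp) (fun i _ => by have := ha i; positivity)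
  refine le_trans (le_of_eq ?_) h
  apply Finset.prod_congr rfl
  intro i _
  rw [← Real.rpow_natCast, ← Real.rpow_mul (ha i)]; norm_num

lemma dec_step {Y : Type*} [MeasurableSpace Y] {ν : Measure Y} {K N : ℕ} (F : ℕ → Y → ℂ) (W : Y → ℝ) (hW0 : ∀ y, 0 ≤ W y)
    (hW : Integrable W ν) (hm : ∀ k, Measurable (F k)) (hb : ∀ k, ∃ M, ∀ y, ‖F k y‖ ≤ M)
    (A : Finset (Fin 6 → ℕ)) (hA : A ⊆ Fintype.piFinset (fun _ => Finset.range K))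
    (hN : ∀ i k, (A.filter (fun c => c i = k)).card ≤ N)
    (h0 : ∀ c ∈ Fintype.piFinset (fun _ : Fin 6 => Finset.range K), c ∉ A → ∫ y, (∏ i, cj i (F (c i) y)) * W y ∂ν = 0) :
    ∫ y, ‖∑ k ∈ Finset.range K, F k y‖ ^ 6 * W y ∂ν ≤ N * ∑ k ∈ Finset.range K, ∫ y, ‖F k y‖ ^ 6 * W y ∂ν := by
  have hcm : ∀ i, Measurable (cj i) := by
    intro i; unfold cj; split_ifs
    · exact measurable_id
    · exact Complex.continuous_conj.measurable
  choose M hM using hb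
  have hint : ∀ c : Fin 6 → ℕ, Integrable (fun y => (∏ i, cj i (F (c i) y)) * W y) ν := by
    intro c
    refine hW.ofReal.bdd_mul (c := ∏ i, M (c i)) ?_ (ae_of_all _ fun y => ?_)
    · exact (Finset.measurable_prod _ fun i _ => (hcm i).comp (hm (c i))).aestronglyMeasurable
    · rw [norm_prod]
      exact Finset.prod_le_prod (fun i _ => norm_nonneg _) (fun i _ => by rw [cj_norm]; exact hM _ _)
  have hint6 : ∀ k, Integrable (fun y => ‖F k y‖ ^ 6 * W y) ν := by
    intro k
    refine hW.bdd_mul (c := M k ^ 6) ((hm k).norm.pow_const 6).aestronglyMeasurable (ae_of_all _ fun y => ?_)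
    rw [norm_pow, norm_norm]
    exact pow_le_pow_left₀ (norm_nonneg _) (hM k y) 6
  set I : ℕ → ℝ := fun k => ∫ y, ‖F k y‖ ^ 6 * W y ∂ν with hI
  have hI0 : ∀ k, 0 ≤ I k := fun k => integral_nonneg fun y => mul_nonneg (by positivity) (hW0 y)
  have e1 : ((∫ y, ‖∑ k ∈ Finset.range K, F k y‖ ^ 6 * W y ∂ν : ℝ) : ℂ) = ∑ c ∈ A, ∫ y, (∏ i, cj i (F (c i) y)) * W y ∂ν := by
    rw [Finset.sum_subset hA h0, ← integral_finsetSum _ (fun c _ => hint c), ← integral_complex_ofReal]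
    congr 1; ext y
    push_cast
    rw [← Finset.sum_mul]
    congr 1
    rw [← Complex.ofReal_pow, ← cj_prod]
    simp_rw [cj_sum]
    rw [Finset.prod_univ_sum]
  have e2 : ∫ y, ‖∑ k ∈ Finset.range K, F k y‖ ^ 6 * W y ∂ν ≤ ∑ c ∈ A, ∑ i, (1/6) * I (c i) := by
    refine (le_abs_self _).trans ?_
    rw [← Real.norm_eq_abs, ← Complex.norm_real, e1]
    refine (norm_sum_le _ _).trans (Finset.sum_le_sum fun c hc => ?_)
    refine (norm_integral_le_integral_norm _).trans ?_
    simp only [hI]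
    simp_rw [← integral_const_mul]
    rw [← integral_finsetSum _ (fun i _ => (hint6 (c i)).const_mul _)]
    refine integral_mono (hint c).norm (integrable_finset_sum _ (fun i _ => (hint6 (c i)).const_mul _)) fun y => ?_
    simp only
    rw [norm_mul, norm_prod, Complex.norm_real, Real.norm_of_nonneg (hW0 y)]
    simp_rw [cj_norm, ← mul_assoc]
    rw [← Finset.sum_mul]
    exact mul_le_mul_of_nonneg_right (amgm6 _ fun i => norm_nonneg _) (hW0 y)
  refine e2.trans ?_
  rw [Finset.sum_comm]
  have e3 : ∀ i : Fin 6, ∑ c ∈ A, (1/6) * I (c i) ≤ (1/6) * (N * ∑ k ∈ Finset.range K, I k) := by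
    intro i
    rw [← Finset.mul_sum]
    refine mul_le_mul_of_nonneg_left ?_ (by norm_num)
    rw [← Finset.sum_fiberwise_of_maps_to (s := A) (t := Finset.range K) (g := fun c => c i)
      (fun c hc => Fintype.mem_piFinset.1 (hA hc) i), Finset.mul_sum]
    refine Finset.sum_le_sum fun k _ => ?_
    have : ∑ c ∈ A with c i = k, I (c i) = ∑ c ∈ A with c i = k, I k :=
      Finset.sum_congr rfl fun c hc => by rw [(Finset.mem_filter.1 hc).2]
    rw [this, Finset.sum_const, nsmul_eq_mul]
    exact mul_le_mul_of_nonneg_right (by exact_mod_cast hN i k) (hI0 k)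
  refine (Finset.sum_le_sum fun i _ => e3 i).trans (le_of_eq ?_)
  simp

noncomputable def ex (θ : ℝ) : ℂ := Complex.exp (θ * Complex.I)
lemma ex_norm (θ : ℝ) : ‖ex θ‖ = 1 := Complex.norm_exp_ofReal_mul_I θ
lemma ex_add (a b : ℝ) : ex (a + b) = ex a * ex b := by unfold ex; rw [← Complex.exp_add]; congr 1; push_cast; ring
lemma ex_cont : Continuous ex := by unfold ex; fun_prop
lemma ex_meas : Measurable ex := ex_cont.measurable

noncomputable def pr (x ξ : ℝ × ℝ) : ℝ := 2 * Real.pi * (x.1 * ξ.1 + x.2 * ξ.2)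
lemma pr_meas : Measurable (fun q : (ℝ × ℝ) × (ℝ × ℝ) => pr q.1 q.2) := by unfold pr; fun_prop
lemma pr_meas2 (x : ℝ × ℝ) : Measurable (pr x) := by unfold pr; fun_prop

lemma op_eq (m f : ℝ × ℝ → ℂ) (x : ℝ × ℝ) : op m f x = ∫ ξ, ex (pr x ξ) * (m ξ * ft f ξ) := by
  unfold op ftInv ex pr; congr 1; ext ξ; congr 2; push_cast; ring
lemma ftInv_ex (m : ℝ × ℝ → ℂ) (x : ℝ × ℝ) : ftInv m x = ∫ ξ, ex (pr x ξ) * m ξ := by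
  unfold ftInv ex pr; congr 1; ext ξ; congr 2; push_cast; ring
lemma ft_ex (m : ℝ × ℝ → ℂ) (x : ℝ × ℝ) : ft m x = ∫ ξ, ex (-pr x ξ) * m ξ := by
  unfold ft ex pr; congr 1; ext ξ; congr 2; push_cast; ring

lemma ft_bdd {f : ℝ × ℝ → ℂ} : ∃ M, 0 ≤ M ∧ ∀ ξ, ‖ft f ξ‖ ≤ M :=
  ⟨∫ x, ‖f x‖, integral_nonneg fun _ => norm_nonneg _, ft_le⟩

lemma Cls.mul_bdd {m q : ℝ × ℝ → ℂ} (hm : Cls m) (hq : Measurable q) {Q : ℝ} (hQ : ∀ ξ, ‖q ξ‖ ≤ Q) : Cls (fun ξ => m ξ * q ξ) := by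
  obtain ⟨M, hM⟩ := hm.b
  refine ⟨hm.m.mul hq, hm.i.mul_bdd hq.aestronglyMeasurable (ae_of_all _ hQ), M * Q, fun ξ => ?_⟩
  rw [norm_mul]
  exact mul_le_mul (hM ξ) (hQ ξ) (norm_nonneg _) ((norm_nonneg _).trans (hM ξ))

lemma Cls.mul_ft {m f : ℝ × ℝ → ℂ} (hm : Cls m) (hf : Cls f) : Cls (fun ξ => m ξ * ft f ξ) := by
  obtain ⟨Q, _, hQ⟩ := ft_bdd (f := f)
  exact hm.mul_bdd (ft_cont hf.i).measurable hQ

lemma op_marc {ι : Type*} [Fintype ι] (m : ι → ℝ × ℝ → ℂ) (hm : ∀ i, Cls (m i)) {a A : ℝ} (ha : 0 ≤ a) (hA : 0 < A)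
    (h2 : ∀ ξ, ∑ i, ‖m i ξ‖ ^ 2 ≤ a ^ 2)
    (hinf : ∀ i f M, Cls f → 0 ≤ M → (∀ x, ‖f x‖ ≤ M) → ∀ x, ‖op (m i) f x‖ ≤ A * M)
    {f : ℝ × ℝ → ℂ} (hf : Cls f) :
    ∑ i, ∫⁻ x, ‖op (m i) f x‖ₑ ^ 6 ≤ 96 * ENNReal.ofReal (a ^ 2) * ENNReal.ofReal (A ^ 4) * ∫⁻ x, ‖f x‖ₑ ^ 6 := by
  refine marc (fun i => op (m i)) _ A hA ?_ ?_ ?_ hinf f hf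
  · intro i f g hf hg x
    simp only [op_eq]
    have h1 : Integrable (fun ξ => ex (pr x ξ) * (m i ξ * ft f ξ)) := ((hm i).mul_ft hf).i.bdd_mul (c := 1) (ex_meas.comp (pr_meas2 x)).aestronglyMeasurable (ae_of_all _ fun ξ => (ex_norm _).le)
    have h2 : Integrable (fun ξ => ex (pr x ξ) * (m i ξ * ft g ξ)) := ((hm i).mul_ft hg).i.bdd_mul (c := 1) (ex_meas.comp (pr_meas2 x)).aestronglyMeasurable (ae_of_all _ fun ξ => (ex_norm _).le)
    rw [← integral_add h1 h2]
    congr 1; ext ξ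
    have : ft (f + g) ξ = ft f ξ + ft g ξ := by
      simp only [ft_ex]
      have i1 : Integrable (fun y => ex (-pr ξ y) * f y) := hf.i.bdd_mul (c := 1) (ex_meas.comp (pr_meas2 ξ).neg).aestronglyMeasurable (ae_of_all _ fun ξ => (ex_norm _).le)
      have i2 : Integrable (fun y => ex (-pr ξ y) * g y) := hg.i.bdd_mul (c := 1) (ex_meas.comp (pr_meas2 ξ).neg).aestronglyMeasurable (ae_of_all _ fun ξ => (ex_norm _).le)
      rw [← integral_add i1 i2]
      congr 1; ext y; simp [mul_add]
    rw [this]; ring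
  · intro i f hf
    exact (ftInv_cont ((hm i).mul_ft hf).i).measurable
  · intro f hf
    have e1 : ∀ i, ∫⁻ x, ‖op (m i) f x‖ₑ ^ 2 = ∫⁻ ξ, ‖m i ξ‖ₑ ^ 2 * ‖ft f ξ‖ₑ ^ 2 := by
      intro i
      have := planchInv ((hm i).mul_ft hf).i ((hm i).mul_ft hf).memLp2
      unfold op
      rw [this]
      congr 1; ext ξ; rw [enorm_mul, mul_pow]
    simp_rw [e1]
    have hmm : ∀ i ∈ Finset.univ, Measurable (fun ξ => ‖m i ξ‖ₑ ^ 2 * ‖ft f ξ‖ₑ ^ 2) := fun i _ =>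
      ((hm i).m.enorm.pow_const 2).mul ((ft_cont hf.i).measurable.enorm.pow_const 2)
    rw [← lintegral_finsetSum _ hmm]
    rw [← planch hf.i hf.memLp2, ← lintegral_const_mul _ ((ft_cont hf.i).measurable.enorm.pow_const 2)]
    refine lintegral_mono fun ξ => ?_
    rw [← Finset.sum_mul]
    gcongr
    refine le_trans (le_of_eq ?_) (ENNReal.ofReal_le_ofReal (h2 ξ))
    rw [ENNReal.ofReal_sum_of_nonneg (fun i _ => by positivity)]
    refine Finset.sum_congr rfl fun i _ => ?_
    rw [← ofReal_norm, ENNReal.ofReal_pow (norm_nonneg _)]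

lemma op_kernel {m f : ℝ × ℝ → ℂ} (hm : Cls m) (hf : Cls f) (hk : Integrable (ftInv m)) {M : ℝ}
    (hM : ∀ x, ‖f x‖ ≤ M) (x : ℝ × ℝ) : ‖op m f x‖ ≤ (∫ y, ‖ftInv m y‖) * M := by
  have e : op m f x = ∫ y, f y * ftInv m (x - y) := by
    rw [op_eq]
    simp_rw [ft_ex, ftInv_ex, ← integral_const_mul]
    rw [integral_integral_swap]
    · congr 1; ext y; congr 1; ext ξ
      have : pr (x - y) ξ = pr x ξ + -pr ξ y := by simp only [pr, Prod.fst_sub, Prod.snd_sub]; ring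
      rw [this, ex_add]; ring
    · have h1 := hm.i.mul_prod hf.i
      have hme : Measurable (fun q : (ℝ × ℝ) × (ℝ × ℝ) => ex (pr x q.1 + -pr q.1 q.2)) := by
        apply ex_meas.comp; unfold pr; fun_prop
      refine (h1.bdd_mul (c := 1) hme.aestronglyMeasurable (ae_of_all _ fun q => (ex_norm _).le)).congr (ae_of_all _ fun q => ?_)
      simp only [Function.uncurry, ex_add]; ring
  have hks : Integrable (fun y => ftInv m (x - y)) := hk.comp_sub_left x
  rw [e]
  calc ‖∫ y, f y * ftInv m (x - y)‖ ≤ ∫ y, ‖ftInv m (x - y)‖ * M := by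
        refine norm_integral_le_of_norm_le (hks.norm.mul_const M) (ae_of_all _ fun y => ?_)
        rw [norm_mul, mul_comm]
        exact mul_le_mul_of_nonneg_left (hM y) (norm_nonneg _)
    _ = _ := by rw [integral_mul_const, integral_sub_left_eq_self (fun y => ‖ftInv m y‖) volume x]

noncomputable def mul0 (α β : ℝ → ℝ) (lam : ℝ) (ξ : ℝ × ℝ) : ℂ := (α (ξ.1 / lam) : ℂ) * β (ξ.2 / lam)

lemma mul0_cls {α β : ℝ → ℝ} (ha : ContDiff ℝ (⊤ : ℕ∞) α) (hac : HasCompactSupport α) (hb : ContDiff ℝ (⊤ : ℕ∞) β) (hbc : HasCompactSupport β)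
    {lam : ℝ} (hl : 0 < lam) : Cls (mul0 α β lam) := by
  have ci := ha.continuous.integrable_of_hasCompactSupport (μ := volume) hac
  have cj := hb.continuous.integrable_of_hasCompactSupport (μ := volume) hbc
  obtain ⟨A, hA⟩ := hac.exists_bound_of_continuous ha.continuous
  obtain ⟨B, hB⟩ := hbc.exists_bound_of_continuous hb.continuous
  refine ⟨?_, ?_, A * B, fun ξ => ?_⟩
  · have := ha.continuous; have := hb.continuous
    unfold mul0; fun_prop
  · exact (ci.comp_div hl.ne').ofReal.mul_prod (cj.comp_div hl.ne').ofReal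
  · unfold mul0
    rw [norm_mul, Complex.norm_real, Complex.norm_real]
    exact mul_le_mul (hA _) (hB _) (norm_nonneg _) ((norm_nonneg _).trans (hA 0))

lemma mul0_inf {α β : ℝ → ℝ} (ha : ContDiff ℝ (⊤ : ℕ∞) α) (hac : HasCompactSupport α) (hb : ContDiff ℝ (⊤ : ℕ∞) β) (hbc : HasCompactSupport β) :
    ∃ A0 : ℝ, 0 < A0 ∧ ∀ lam : ℝ, 0 < lam → ∀ f M, Cls f → 0 ≤ M → (∀ x, ‖f x‖ ≤ M) → ∀ x, ‖op (mul0 α β lam) f x‖ ≤ A0 * M := by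
  obtain ⟨a, a1, a2, -, a4⟩ := cc_fourier α ha hac
  obtain ⟨b, b1, b2, -, b4⟩ := cc_fourier β hb hbc
  refine ⟨(∫ y, ‖a y‖) * (∫ y, ‖b y‖) + 1, by positivity, ?_⟩
  intro lam hl f M hf hM0 hM x
  have sc : ∀ (α : ℝ → ℝ) (a : ℝ → ℂ), (∀ x, a x = ∫ y, Complex.exp ((-(2 * Real.pi * (x * y)) : ℝ) * Complex.I) * α y) → ∀ s : ℝ,
      ∫ ξ, ex (2 * Real.pi * (s * ξ)) * (α (ξ / lam) : ℂ) = lam * a (-lam * s) := by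
    intro α a h s
    have := Measure.integral_comp_div (fun y : ℝ => ex (2 * Real.pi * (lam * s * y)) * (α y : ℂ)) lam
    rw [abs_of_pos hl] at this
    rw [h]
    have e2 : ∫ y, Complex.exp ((-(2 * Real.pi * (-lam * s * y)) : ℝ) * Complex.I) * α y = ∫ y : ℝ, ex (2 * Real.pi * (lam * s * y)) * (α y : ℂ) := by
      congr 1; ext y; unfold ex; congr 3; push_cast; ring
    rw [e2, ← Complex.real_smul, ← this]
    congr 1; ext ξ; congr 2; field_simp
  have e : ∀ x, ftInv (mul0 α β lam) x = (lam * a (-lam * x.1)) * (lam * b (-lam * x.2)) := by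
    intro x
    rw [ftInv_ex, ← sc α a a4, ← sc β b b4, ← integral_prod_mul]
    congr 1; ext ξ
    unfold mul0 pr
    rw [mul_add, ex_add]; ring
  have hl' : -lam ≠ 0 := by linarith
  have ia : Integrable (fun s => (lam : ℂ) * a (-lam * s)) := (a2.comp_mul_left' hl').const_mul _
  have ib : Integrable (fun s => (lam : ℂ) * b (-lam * s)) := (b2.comp_mul_left' hl').const_mul _
  have hint : Integrable (ftInv (mul0 α β lam)) := (ia.mul_prod ib).congr (ae_of_all _ fun x => (e x).symm)
  have nm : ∀ a : ℝ → ℂ, ∫ s, ‖(lam : ℂ) * a (-lam * s)‖ = ∫ s, ‖a s‖ := by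
    intro a
    have := Measure.integral_comp_mul_left (fun s => ‖a s‖) (-lam)
    simp_rw [norm_mul]
    rw [integral_const_mul, this, Complex.norm_real, Real.norm_of_nonneg hl.le, smul_eq_mul, ← mul_assoc]
    rw [abs_inv, abs_neg, abs_of_pos hl, mul_inv_cancel₀ hl.ne', one_mul]
  refine (op_kernel (mul0_cls ha hac hb hbc hl) hf hint hM x).trans ?_
  have : ∫ y, ‖ftInv (mul0 α β lam) y‖ = (∫ y, ‖a y‖) * (∫ y, ‖b y‖) := by
    simp_rw [e, norm_mul]
    have := integral_prod_mul (μ := (volume : Measure ℝ)) (ν := (volume : Measure ℝ)) (fun s => ‖(lam : ℂ) * a (-lam * s)‖) (fun s => ‖(lam : ℂ) * b (-lam * s)‖)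
    rw [nm, nm] at this
    rw [← this]
    simp_rw [norm_mul]; rfl
  rw [this]
  nlinarith

lemma op_zeta {m f : ℝ × ℝ → ℂ} (hm : Cls m) (hf : Cls f) {ζ : ℝ → ℝ} {a : ℝ → ℂ} (ha : Integrable a)
    (hz : ∀ x, (ζ x : ℂ) = ∫ y, Complex.exp ((2 * Real.pi * (x * y) : ℝ) * Complex.I) * a y) (s : ℝ × ℝ) {Q : ℝ}
    (hQ : ∀ x, ‖op m f x‖ ≤ Q) (x : ℝ × ℝ) :
    ‖op (fun ξ => m ξ * ζ (s.1 * ξ.1 + s.2 * ξ.2)) f x‖ ≤ (∫ y, ‖a y‖) * Q := by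
  have e : op (fun ξ => m ξ * ζ (s.1 * ξ.1 + s.2 * ξ.2)) f x = ∫ y : ℝ, a y * op m f (x + y • s) := by
    simp_rw [op_eq, hz]
    have : ∀ ξ, ex (pr x ξ) * ((m ξ * ∫ y, Complex.exp ((2 * Real.pi * ((s.1 * ξ.1 + s.2 * ξ.2) * y) : ℝ) * Complex.I) * a y) * ft f ξ)
        = ∫ y, ex (pr x ξ) * (m ξ * ft f ξ) * (Complex.exp ((2 * Real.pi * ((s.1 * ξ.1 + s.2 * ξ.2) * y) : ℝ) * Complex.I) * a y) := by
      intro ξ; rw [integral_const_mul]; ring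
    simp_rw [this]
    rw [integral_integral_swap]
    · congr 1; ext y; rw [← integral_const_mul]; congr 1; ext ξ
      have : pr (x + y • s) ξ = pr x ξ + 2 * Real.pi * ((s.1 * ξ.1 + s.2 * ξ.2) * y) := by
        simp only [pr, Prod.fst_add, Prod.snd_add, Prod.smul_fst, Prod.smul_snd, smul_eq_mul]; ring
      rw [this, ex_add]; simp only [ex]; ring
    · have h1 := (hm.mul_ft hf).i.mul_prod ha
      have hme : Measurable (fun q : (ℝ × ℝ) × ℝ => ex (pr x q.1 + 2 * Real.pi * ((s.1 * q.1.1 + s.2 * q.1.2) * q.2))) := by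
        apply ex_meas.comp; unfold pr; fun_prop
      refine (h1.bdd_mul (c := 1) hme.aestronglyMeasurable (ae_of_all _ fun q => (ex_norm _).le)).congr (ae_of_all _ fun q => ?_)
      simp only [Function.uncurry, ex_add]; simp only [ex]; ring
  rw [e]
  calc ‖∫ y : ℝ, a y * op m f (x + y • s)‖ ≤ ∫ y, ‖a y‖ * Q := by
        refine norm_integral_le_of_norm_le (ha.norm.mul_const Q) (ae_of_all _ fun y => ?_)
        rw [norm_mul]
        exact mul_le_mul_of_nonneg_left (hQ _) (norm_nonneg _)
    _ = _ := by rw [integral_mul_const]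

noncomputable def ph (Γ : ℝ → ℝ) (u : ℝ) (ξ : ℝ × ℝ) (t : ℝ) : ℝ := ξ.1 * t + ξ.2 * u * Γ t
noncomputable def GS (Γ : ℝ → ℝ) (S : Set ℝ) (a : ℝ × ℝ → ℝ → ℂ) (u : ℝ) (ξ : ℝ × ℝ) : ℂ :=
  ∫ t in S, ex (ph Γ u ξ t) * a ξ t

lemma ph_meas {Γ : ℝ → ℝ} (hΓ : Measurable Γ) (u : ℝ) : Measurable (Function.uncurry (ph Γ u)) := by
  unfold ph Function.uncurry; fun_prop

lemma GS_meas {Γ : ℝ → ℝ} (hΓ : Measurable Γ) {S : Set ℝ} {a : ℝ × ℝ → ℝ → ℂ} (ha : Measurable (Function.uncurry a)) (u : ℝ) :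
    Measurable (GS Γ S a u) := by
  unfold GS
  have : StronglyMeasurable (Function.uncurry fun (ξ : ℝ × ℝ) t => ex (ph Γ u ξ t) * a ξ t) :=
    ((ex_meas.comp (ph_meas hΓ u)).mul ha).stronglyMeasurable
  exact this.integral_prod_right.measurable

lemma GS_le {Γ : ℝ → ℝ} {S : Set ℝ} (hSf : volume S < ⊤) {a : ℝ × ℝ → ℝ → ℂ} {Ca : ℝ}
    (hb : ∀ ξ, ∀ t ∈ S, ‖a ξ t‖ ≤ Ca) (u : ℝ) (ξ : ℝ × ℝ) : ‖GS Γ S a u ξ‖ ≤ Ca * volume.real S := by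
  refine norm_setIntegral_le_of_norm_le_const hSf (fun t ht => ?_)
  rw [norm_mul, ex_norm, one_mul]; exact hb ξ t ht

lemma op_t {m f : ℝ × ℝ → ℂ} (hm : Cls m) (hf : Cls f) {Γ : ℝ → ℝ} (hΓ : Measurable Γ) {S : Set ℝ} (hS : MeasurableSet S) (hSf : volume S < ⊤)
    {a : ℝ × ℝ → ℝ → ℂ} (ha : Measurable (Function.uncurry a)) {Ca : ℝ} (hb : ∀ ξ, ∀ t ∈ S, ‖a ξ t‖ ≤ Ca) (u : ℝ) {Q : ℝ}
    (hQ : ∀ t ∈ S, ∀ x, ‖op (fun ξ => m ξ * a ξ t) f x‖ ≤ Q) (x : ℝ × ℝ) :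
    ‖op (fun ξ => m ξ * GS Γ S a u ξ) f x‖ ≤ Q * volume.real S := by
  have e : op (fun ξ => m ξ * GS Γ S a u ξ) f x = ∫ t in S, op (fun ξ => m ξ * a ξ t) f (x + (2 * Real.pi)⁻¹ • (t, u * Γ t)) := by
    simp_rw [op_eq, GS]
    have : ∀ ξ, ex (pr x ξ) * ((m ξ * ∫ t in S, ex (ph Γ u ξ t) * a ξ t) * ft f ξ)
        = ∫ t in S, ex (pr x ξ) * (m ξ * ft f ξ) * (ex (ph Γ u ξ t) * a ξ t) := by
      intro ξ; rw [integral_const_mul]; ring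
    simp_rw [this]
    rw [integral_integral_swap]
    · congr 1; ext t; congr 1; ext ξ
      have : pr (x + (2 * Real.pi)⁻¹ • (t, u * Γ t)) ξ = pr x ξ + ph Γ u ξ t := by
        simp only [pr, ph, Prod.fst_add, Prod.snd_add, Prod.smul_fst, Prod.smul_snd, smul_eq_mul]
        field_simp; ring
      rw [this, ex_add]; ring
    · have h1 : Integrable (fun q : (ℝ × ℝ) × ℝ => (m q.1 * ft f q.1) * (1 : ℂ)) (volume.prod (volume.restrict S)) :=
        (hm.mul_ft hf).i.mul_prod (g := fun _ => (1:ℂ)) (by rw [integrable_const_iff]; right; exact ⟨by simpa using hSf⟩)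
      have hme : Measurable (fun q : (ℝ × ℝ) × ℝ => ex (pr x q.1) * (ex (ph Γ u q.1 q.2) * a q.1 q.2)) := by
        refine (ex_meas.comp ?_).mul ((ex_meas.comp (ph_meas hΓ u)).mul ha)
        unfold pr; fun_prop
      have hS2 : ∀ᵐ q ∂((volume : Measure (ℝ × ℝ)).prod (volume.restrict S)), q.2 ∈ S := by
        have h1 : ∀ᵐ t ∂((volume : Measure ℝ).restrict S), t ∈ S := ae_restrict_mem hS
        exact Measure.quasiMeasurePreserving_snd.ae h1
      refine (h1.bdd_mul (c := Ca) hme.aestronglyMeasurable ?_).congr (ae_of_all _ fun q => ?_)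
      · filter_upwards [hS2] with q hq
        rw [norm_mul, norm_mul, ex_norm, ex_norm, one_mul, one_mul]; exact hb _ _ hq
      · simp only [Function.uncurry]; ring
  rw [e]
  exact norm_setIntegral_le_of_norm_le_const hSf (fun t ht => hQ t ht _)

noncomputable def EE (Γ : ℝ → ℝ) (z y : (ℝ × ℝ) × ℝ) : ℂ := ex (pr y.1 z.1 + y.2 * (z.1.2 * Γ z.2))
noncomputable def FF (Γ : ℝ → ℝ) (A : (ℝ × ℝ) × ℝ → ℂ) (S : Set ℝ) (y : (ℝ × ℝ) × ℝ) : ℂ :=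
  ∫ z, EE Γ z y * (Prod.snd ⁻¹' S).indicator A z
noncomputable def Wt (w : ℝ → ℝ) (ε n : ℝ) (y : (ℝ × ℝ) × ℝ) : ℝ := w (ε * y.1.1) * w (ε * y.1.2) * w (n * y.2)

lemma EE_norm (Γ : ℝ → ℝ) (z y : (ℝ × ℝ) × ℝ) : ‖EE Γ z y‖ = 1 := ex_norm _

lemma EE_meas {Γ : ℝ → ℝ} (hΓ : Measurable Γ) : Measurable (Function.uncurry (EE Γ)) := by
  unfold EE; refine ex_meas.comp ?_
  unfold pr; fun_prop

lemma FF_int {Γ : ℝ → ℝ} (hΓ : Measurable Γ) {A : (ℝ × ℝ) × ℝ → ℂ} (hA : Integrable A) {S : Set ℝ} (hS : MeasurableSet S) (y) :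
    Integrable (fun z => EE Γ z y * (Prod.snd ⁻¹' S).indicator A z) :=
  (hA.indicator (measurable_snd hS)).bdd_mul (c := 1) ((EE_meas hΓ).comp (measurable_id.prodMk measurable_const)).aestronglyMeasurable
    (ae_of_all _ fun z => (EE_norm _ _ _).le)

lemma FF_meas {Γ : ℝ → ℝ} (hΓ : Measurable Γ) {A : (ℝ × ℝ) × ℝ → ℂ} (hA : Measurable A) {S : Set ℝ} (hS : MeasurableSet S) :
    Measurable (FF Γ A S) := by
  unfold FF
  have : StronglyMeasurable (Function.uncurry fun (y z : (ℝ × ℝ) × ℝ) => EE Γ z y * (Prod.snd ⁻¹' S).indicator A z) := by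
    refine Measurable.stronglyMeasurable ?_
    exact ((EE_meas hΓ).comp measurable_swap).mul ((hA.indicator (measurable_snd hS)).comp measurable_snd)
  exact this.integral_prod_right.measurable

lemma FF_le {Γ : ℝ → ℝ} {A : (ℝ × ℝ) × ℝ → ℂ} (hA : Integrable A) {S : Set ℝ} (y) :
    ‖FF Γ A S y‖ ≤ ∫ z, ‖A z‖ := by
  refine norm_integral_le_of_norm_le hA.norm (ae_of_all _ fun z => ?_)
  rw [norm_mul, EE_norm, one_mul]; exact norm_indicator_le_norm_self _ _

lemma FF_add {Γ : ℝ → ℝ} (hΓ : Measurable Γ) {A : (ℝ × ℝ) × ℝ → ℂ} (hA : Integrable A) {a b c : ℝ} (h1 : a ≤ b) (h2 : b ≤ c) (y) :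
    FF Γ A (Ioc a c) y = FF Γ A (Ioc a b) y + FF Γ A (Ioc b c) y := by
  unfold FF
  rw [← integral_add (FF_int hΓ hA measurableSet_Ioc y) (FF_int hΓ hA measurableSet_Ioc y)]
  congr 1; ext z; rw [← mul_add]; congr 1
  rw [← Ioc_union_Ioc_eq_Ioc h1 h2, preimage_union, indicator_union_of_disjoint]
  apply Disjoint.preimage
  rw [Set.disjoint_left]; intro t h1 h2; exact absurd h1.2 (not_le.2 h2.1)

lemma FF_sum {Γ : ℝ → ℝ} (hΓ : Measurable Γ) {A : (ℝ × ℝ) × ℝ → ℂ} (hA : Integrable A) (g : ℕ → ℝ) (hg : Monotone g) (K : ℕ) (y) :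
    FF Γ A (Ioc (g 0) (g K)) y = ∑ k ∈ Finset.range K, FF Γ A (Ioc (g k) (g (k+1))) y := by
  induction K with
  | zero => simp [FF]
  | succ K ih => rw [Finset.sum_range_succ, ← ih, FF_add hΓ hA (hg (Nat.zero_le K)) (hg (Nat.le_succ K))]

lemma Wt_int {w : ℝ → ℝ} (hw : Integrable w) {ε n : ℝ} (hε : 0 < ε) (hn : 0 < n) : Integrable (Wt w ε n) := by
  have h1 : Integrable (fun x => w (ε * x)) := hw.comp_mul_left' hε.ne'
  have h2 : Integrable (fun x => w (n * x)) := hw.comp_mul_left' hn.ne'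
  exact (h1.mul_prod h1).mul_prod h2

lemma w_osc {w : ℝ → ℝ} {Ω : ℝ} (hw : ∀ ω, Ω ≤ |ω| → ∫ v, Complex.exp ((ω * v : ℝ) * Complex.I) * w v = 0) {ε θ : ℝ} (hε : 0 < ε)
    (h : Ω * ε ≤ |θ|) : ∫ v, ex (v * θ) * w (ε * v) = 0 := by
  have := Measure.integral_comp_mul_left (fun v : ℝ => ex (θ / ε * v) * (w v : ℂ)) ε
  have h2 : ∫ v, ex (θ / ε * v) * (w v : ℂ) = 0 := by
    unfold ex; apply hw
    rw [abs_div, abs_of_pos hε, le_div_iff₀ hε]; exact h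
  rw [h2, smul_zero] at this
  rw [← this]; congr 1; ext v; congr 2; field_simp

lemma Wt_osc {w : ℝ → ℝ} {Ω : ℝ} (hw : ∀ ω, Ω ≤ |ω| → ∫ v, Complex.exp ((ω * v : ℝ) * Complex.I) * w v = 0) {ε n : ℝ} (hε : 0 < ε)
    (hn : 0 < n) {a b c : ℝ} (h : Ω * ε ≤ |a| ∨ Ω * ε ≤ |b| ∨ Ω * n ≤ |c|) :
    ∫ y : (ℝ × ℝ) × ℝ, ex (y.1.1 * a + y.1.2 * b + y.2 * c) * Wt w ε n y = 0 := by
  have e : ∀ y : (ℝ × ℝ) × ℝ, ex (y.1.1 * a + y.1.2 * b + y.2 * c) * Wt w ε n y =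
      ((ex (y.1.1 * a) * w (ε * y.1.1)) * (ex (y.1.2 * b) * w (ε * y.1.2))) * (ex (y.2 * c) * w (n * y.2)) := by
    intro y; simp only [ex_add, Wt]; push_cast; ring
  simp_rw [e]
  rw [Measure.volume_eq_prod, integral_prod_mul (f := fun x : ℝ × ℝ => (ex (x.1 * a) * w (ε * x.1)) * (ex (x.2 * b) * w (ε * x.2)))
    (g := fun t : ℝ => ex (t * c) * w (n * t)), Measure.volume_eq_prod,
    integral_prod_mul (f := fun x : ℝ => (ex (x * a) * w (ε * x))) (g := fun x : ℝ => (ex (x * b) * w (ε * x)))]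
  rcases h with h | h | h
  · rw [w_osc hw hε h]; simp
  · rw [w_osc hw hε h]; simp
  · rw [w_osc hw hn h]; simp

lemma cj_ex (i : Fin 6) (θ : ℝ) : cj i (ex θ) = ex (sg i * θ) := by
  unfold cj sg
  split_ifs
  · simp
  · unfold ex; rw [← Complex.exp_conj]; congr 1; simp

lemma cj_mul (i : Fin 6) (a b : ℂ) : cj i (a * b) = cj i a * cj i b := by unfold cj; split_ifs <;> simp
lemma cj_int (i : Fin 6) {Z : Type*} [MeasurableSpace Z] {μ : Measure Z} (f : Z → ℂ) : cj i (∫ z, f z ∂μ) = ∫ z, cj i (f z) ∂μ := by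
  unfold cj; split_ifs
  · rfl
  · rw [integral_conj]
lemma cj_ne (i : Fin 6) {a : ℂ} (h : cj i a ≠ 0) : a ≠ 0 := by rintro rfl; apply h; unfold cj; simp
lemma cj_meas (i : Fin 6) : Measurable (cj i) := by
  unfold cj; split_ifs
  · exact measurable_id
  · exact Complex.continuous_conj.measurable

lemma ex_sum {ι : Type*} (s : Finset ι) (f : ι → ℝ) : ex (∑ i ∈ s, f i) = ∏ i ∈ s, ex (f i) := by
  unfold ex; rw [← Complex.exp_sum]; push_cast; rw [Finset.sum_mul]

/-- orthogonality -/
lemma FF_ortho {Γ : ℝ → ℝ} (hΓ : Measurable Γ) {A : (ℝ × ℝ) × ℝ → ℂ} (hA : Integrable A) {w : ℝ → ℝ} {Ω : ℝ} (hwi : Integrable w)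
    (hw : ∀ ω, Ω ≤ |ω| → ∫ v, Complex.exp ((ω * v : ℝ) * Complex.I) * w v = 0) {ε n : ℝ} (hε : 0 < ε) (hn : 0 < n)
    (S : Fin 6 → Set ℝ) (hS : ∀ i, MeasurableSet (S i))
    (h : ∀ z : Fin 6 → (ℝ × ℝ) × ℝ, (∀ i, A (z i) ≠ 0) → (∀ i, (z i).2 ∈ S i) →
      Ω * ε ≤ |∑ i, sg i * (2 * Real.pi * (z i).1.1)| ∨ Ω * ε ≤ |∑ i, sg i * (2 * Real.pi * (z i).1.2)| ∨ Ω * n ≤ |∑ i, sg i * ((z i).1.2 * Γ (z i).2)|) :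
    ∫ y, (∏ i, cj i (FF Γ A (S i) y)) * Wt w ε n y = 0 := by
  have e : ∀ y, (∏ i, cj i (FF Γ A (S i) y)) = ∏ i, ∫ z, cj i (EE Γ z y) * cj i ((Prod.snd ⁻¹' (S i)).indicator A z) := by
    intro y; refine Finset.prod_congr rfl fun i _ => ?_
    unfold FF; rw [cj_int]; simp_rw [cj_mul]
  simp_rw [e]
  refine ortho (fun i z y => cj i (EE Γ z y)) (fun i z => cj i ((Prod.snd ⁻¹' (S i)).indicator A z)) (fun y => (Wt w ε n y : ℂ)) ?_ ?_ ?_ ?_ ?_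
  · intro i; exact (cj_meas i).comp (EE_meas hΓ)
  · intro i z y; rw [cj_norm, EE_norm]
  · intro i
    have h1 := hA.indicator (measurable_snd (hS i))
    refine (h1.norm.mono' ?_ (ae_of_all _ fun z => ?_))
    · exact ((cj_meas i).comp_aemeasurable h1.1.aemeasurable).aestronglyMeasurable
    · rw [cj_norm]
  · exact (Wt_int hwi hε hn).ofReal
  · intro z hz
    have hz2 : ∀ i, (z i).2 ∈ S i ∧ A (z i) ≠ 0 := by
      intro i
      have := cj_ne i (hz i)
      have h2 := Set.mem_of_indicator_ne_zero this
      refine ⟨h2, ?_⟩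
      rwa [Set.indicator_of_mem h2] at this
    rw [← Wt_osc hw hε hn (h z (fun i => (hz2 i).2) (fun i => (hz2 i).1))]
    congr 1; ext y; congr 1
    simp only [EE, cj_ex]
    rw [← ex_sum]
    congr 1
    simp only [Finset.mul_sum, ← Finset.sum_add_distrib]
    refine Finset.sum_congr rfl fun i _ => ?_
    unfold pr; ring

structure Dec (Γ Γ1 : ℝ → ℝ) (A : (ℝ × ℝ) × ℝ → ℂ) (M : ℕ) (n lam r0 u0 CB ε : ℝ) : Prop where
  i : Integrable A
  m : Measurable A
  hn : 1 ≤ n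
  hl : n ^ 2 ≤ lam
  hr0 : 1 / 4 ≤ |r0|
  hr0' : |r0| ≤ 3
  hu : 1 ≤ u0
  hCB : 0 ≤ CB
  hε : 0 < ε
  hε1 : ε ≤ 1
  s1 : ∀ z, A z ≠ 0 → |z.1.2 / lam - r0| ≤ 1 / (M:ℝ) ^ 2
  s2 : ∀ z, A z ≠ 0 → |z.1.1 + u0 * z.1.2 * Γ1 z.2| ≤ CB * lam / n

lemma sg_bd (x : Fin 6 → ℝ) {b : ℝ} (h : ∀ i, |x i| ≤ b) : |∑ i, sg i * x i| ≤ 6 * b := by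
  refine (Finset.abs_sum_le_sum_abs _ _).trans ?_
  refine (Finset.sum_le_card_nsmul _ _ b fun i _ => ?_).trans (by simp)
  rw [abs_mul]
  have : |sg i| = 1 := by unfold sg; split_ifs <;> simp
  rw [this, one_mul]; exact h i

lemma dec_one {c C p0 e : ℝ} {Γ Γ1 Γ2 Γ3 : ℝ → ℝ} (h : Curve c C p0 e Γ Γ1 Γ2 Γ3) {A : (ℝ × ℝ) × ℝ → ℂ} {M : ℕ}
    {n lam r0 u0 CB ε : ℝ} (hd : Dec Γ Γ1 A M n lam r0 u0 CB ε) (hM : 1 ≤ M)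
    {w : ℝ → ℝ} {Ω : ℝ} (hΩ : 0 < Ω) (hwi : Integrable w) (hw0 : ∀ v, 0 ≤ w v)
    (hw : ∀ ω, Ω ≤ |ω| → ∫ v, Complex.exp ((ω * v : ℝ) * Complex.I) * w v = 0)
    {C0 : ℝ} {C1 : ℕ} (h1 : C ≤ C0) (h2 : 2 * C ^ 2 / c ^ 2 ≤ C0) (hC0 : 32 * C * (1 + C ^ 2 / c ^ 2) * (Ω + 6 * CB + 30) ≤ C0)
    (hcount : ∀ {S H : ℕ → ℝ} {G : ℕ → ℕ → ℝ},
    CntHyp (c / C ^ 2) C0 M S H G → ∀ {P : Finset (ℕ × ℕ)}, PairOK C0 M S H P → P.card ≤ C1 * M)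
    {p a : ℝ} (ha : 0 < a) (ha2 : a ≤ 3/2) (hp : p0 ≤ p) (hpa : p + a ≤ p0 + 3/2) (hna : 1 / n ≤ a ^ 2 / (M:ℝ) ^ 2) :
    ∫ y, ‖FF Γ A (Ioc p (p + a)) y‖ ^ 6 * Wt w ε n y ≤
      (C1 * M * (M ^ 2) ^ 3 : ℕ) * ∑ k ∈ Finset.range (M ^ 2), ∫ y, ‖FF Γ A (Ioc (yy p a M k) (yy p a M (k+1))) y‖ ^ 6 * Wt w ε n y := by
  classical
  have hn := hd.hn
  have hn0 : 0 < n := by linarith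
  have hl := hd.hl
  have hl0 : 0 < lam := by nlinarith
  have hCB := hd.hCB
  obtain ⟨G, hG⟩ := h.cnt ha hp hpa hM h1 h2
  have he : ∀ y, FF Γ A (Ioc p (p + a)) y = ∑ k ∈ Finset.range (M ^ 2), FF Γ A (Ioc (yy p a M k) (yy p a M (k+1))) y := by
    intro y
    rw [← FF_sum h.m0 hd.i (fun k => yy p a M k) (fun b c hbc => yy_mono ha hbc), yy_zero, yy_last hM]
  simp_rw [he]
  set A' : Finset (Fin 6 → ℕ) := (Fintype.piFinset (fun _ : Fin 6 => Finset.range (M^2))).filter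
    (TupOK C0 M (SS e Γ1 p a M) (HH e Γ Γ1 Γ2 p a M)) with hA'
  refine dec_step (fun k => FF Γ A (Ioc (yy p a M k) (yy p a M (k+1)))) (Wt w ε n) ?_ (Wt_int hwi hd.hε hn0)
    (fun k => FF_meas h.m0 hd.m measurableSet_Ioc) (fun k => ⟨_, fun y => FF_le hd.i y⟩) A' (Finset.filter_subset _ _) ?_ ?_
  · intro y; unfold Wt; have := hw0 (ε * y.1.1); have := hw0 (ε * y.1.2); have := hw0 (n * y.2); positivity
  · intro i k
    exact count_tuples (fun hP => hcount hG hP) A' (Finset.filter_subset _ _) (fun c hc => (Finset.mem_filter.1 hc).2) i k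
  · intro k hk hkA
    refine FF_ortho h.m0 hd.i hwi hw hd.hε hn0 _ (fun i => measurableSet_Ioc) ?_
    intro z hz hzS
    by_contra hcon
    push Not at hcon
    obtain ⟨g1, g2, g3⟩ := hcon
    have hε1 : Ω * ε ≤ Ω := by nlinarith [hd.hε1]
    have hpi := Real.pi_gt_three
    have t1 : ∀ x : Fin 6 → ℝ, |∑ i, sg i * (2 * Real.pi * x i)| < Ω * ε → |∑ i, sg i * x i| ≤ Ω := by
      intro x hx
      have : ∑ i, sg i * (2 * Real.pi * x i) = 2 * Real.pi * ∑ i, sg i * x i := by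
        rw [Finset.mul_sum]; refine Finset.sum_congr rfl fun i _ => by ring
      rw [this, abs_mul, abs_of_pos (by positivity)] at hx
      nlinarith [abs_nonneg (∑ i, sg i * x i)]
    have q1 := t1 _ g1
    have q2 := t1 _ g2
    have hln : Ω / lam ≤ Ω * (1 / n) := by
      rw [mul_one_div]; gcongr; nlinarith
    have sc : ∀ x : Fin 6 → ℝ, ∀ b, |∑ i, sg i * x i| ≤ b → |∑ i, sg i * (x i / lam)| ≤ b / lam := by
      intro x b hb
      have : ∑ i, sg i * (x i / lam) = (∑ i, sg i * x i) / lam := by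
        rw [Finset.sum_div]; refine Finset.sum_congr rfl fun i _ => by ring
      rw [this, abs_div, abs_of_pos hl0]; gcongr
    have hn1 : 0 < 1 / n := by positivity
    have hk' : ∀ i, k i < M ^ 2 := fun i => by simpa using Fintype.mem_piFinset.1 hk i
    refine hkA (Finset.mem_filter.2 ⟨hk, h.tup (D := Ω + 6 * CB) (N := 1 / n) (r0 := r0) ha ha2 hp hpa hM (by positivity) hna hd.hr0 hd.hr0'
      hk' (r := fun i => (z i).1.2 / lam) (t := fun i => (z i).2) (fun i => Ioc_subset_Icc_self (hzS i)) (fun i => hd.s1 _ (hz i)) ?_ ?_ ?_ hC0⟩)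
    · refine (sc _ _ q2).trans (hln.trans ?_)
      gcongr; linarith
    · have hX := sg_bd (fun i => (z i).1.1 + u0 * (z i).1.2 * Γ1 (z i).2) (fun i => hd.s2 _ (hz i))
      have hS : ∑ i, sg i * ((z i).1.1 + u0 * (z i).1.2 * Γ1 (z i).2) = (∑ i, sg i * (z i).1.1) + u0 * ∑ i, sg i * ((z i).1.2 * Γ1 (z i).2) := by
        rw [Finset.mul_sum, ← Finset.sum_add_distrib]; refine Finset.sum_congr rfl fun i _ => by ring
      rw [hS] at hX
      have : |∑ i, sg i * ((z i).1.2 * Γ1 (z i).2)| ≤ Ω + 6 * (CB * lam / n) := by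
        have hu := hd.hu
        have : |u0 * ∑ i, sg i * ((z i).1.2 * Γ1 (z i).2)| ≤ Ω + 6 * (CB * lam / n) := by
          rw [abs_le] at hX q1 ⊢; constructor <;> linarith [hX.1, hX.2, q1.1, q1.2]
        rw [abs_mul, abs_of_pos (by linarith)] at this
        nlinarith [abs_nonneg (∑ i, sg i * ((z i).1.2 * Γ1 (z i).2))]
      have := sc _ _ this
      have e1 : ∀ i, (z i).1.2 / lam * Γ1 (z i).2 = (z i).1.2 * Γ1 (z i).2 / lam := fun i => by ring
      simp only [e1]
      refine this.trans ?_
      have e2 : (Ω + 6 * (CB * lam / n)) / lam = Ω / lam + 6 * CB * (1 / n) := by field_simp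
      rw [e2]; linarith
    · have := sc _ _ g3.le
      have e1 : ∀ i, (z i).1.2 / lam * Γ (z i).2 = (z i).1.2 * Γ (z i).2 / lam := fun i => by ring
      simp only [e1]
      refine this.trans ?_
      have : Ω * n / lam ≤ Ω * (1 / n) := by
        rw [mul_one_div, div_le_div_iff₀ hl0 hn0]; nlinarith
      refine this.trans ?_
      gcongr; linarith

lemma sum_range_mul' (f : ℕ → ℝ) (a b : ℕ) : ∑ k ∈ Finset.range (a * b), f k = ∑ k ∈ Finset.range a, ∑ d ∈ Finset.range b, f (k * b + d) := by
  induction a with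
  | zero => simp
  | succ a ih => rw [Finset.sum_range_succ, ← ih, Nat.succ_mul, Finset.sum_range_add]

lemma dec_all {c C p0 e : ℝ} {Γ Γ1 Γ2 Γ3 : ℝ → ℝ} (h : Curve c C p0 e Γ Γ1 Γ2 Γ3) {A : (ℝ × ℝ) × ℝ → ℂ} {M : ℕ}
    {n lam r0 u0 CB ε : ℝ} (hd : Dec Γ Γ1 A M n lam r0 u0 CB ε) (hM : 1 ≤ M)
    {w : ℝ → ℝ} {Ω : ℝ} (hΩ : 0 < Ω) (hwi : Integrable w) (hw0 : ∀ v, 0 ≤ w v)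
    (hw : ∀ ω, Ω ≤ |ω| → ∫ v, Complex.exp ((ω * v : ℝ) * Complex.I) * w v = 0)
    {C0 : ℝ} {C1 : ℕ} (h1 : C ≤ C0) (h2 : 2 * C ^ 2 / c ^ 2 ≤ C0) (hC0 : 32 * C * (1 + C ^ 2 / c ^ 2) * (Ω + 6 * CB + 30) ≤ C0)
    (hcount : ∀ {S H : ℕ → ℝ} {G : ℕ → ℕ → ℝ},
    CntHyp (c / C ^ 2) C0 M S H G → ∀ {P : Finset (ℕ × ℕ)}, PairOK C0 M S H P → P.card ≤ C1 * M)
    (m : ℕ) (hnm : ((M:ℝ) ^ 2) ^ (2 * m) ≤ n) :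
    ∫ y, ‖FF Γ A (Ioc p0 (p0 + 3/2)) y‖ ^ 6 * Wt w ε n y ≤
      ((C1 * M * (M ^ 2) ^ 3 : ℕ) : ℝ) ^ m * ∑ k ∈ Finset.range ((M ^ 2) ^ m),
        ∫ y, ‖FF Γ A (Ioc (p0 + 3/2 * (k / ((M:ℝ) ^ 2) ^ m)) (p0 + 3/2 * ((k+1) / ((M:ℝ) ^ 2) ^ m))) y‖ ^ 6 * Wt w ε n y := by
  have hMr : (1:ℝ) ≤ (M:ℝ)^2 := by
    have : (1:ℝ) ≤ M := by exact_mod_cast hM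
    nlinarith
  induction m with
  | zero => simp
  | succ m ih =>
    have hnm' : ((M:ℝ) ^ 2) ^ (2 * m) ≤ n := (pow_le_pow_right₀ hMr (by omega)).trans hnm
    refine (ih hnm').trans ?_
    set K : ℝ := (M:ℝ) ^ 2 with hK
    have hKm : 0 < K ^ m := by positivity
    set Q : ℝ := ((C1 * M * (M ^ 2) ^ 3 : ℕ) : ℝ) with hQ
    have hQ0 : 0 ≤ Q := Nat.cast_nonneg _
    rw [pow_succ Q m, mul_assoc (Q ^ m) Q]
    refine mul_le_mul_of_nonneg_left ?_ (pow_nonneg hQ0 _)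
    have e1 : ∑ k ∈ Finset.range ((M ^ 2) ^ (m + 1)), ∫ y, ‖FF Γ A (Ioc (p0 + 3/2 * (k / K ^ (m+1))) (p0 + 3/2 * ((k+1) / K ^ (m+1)))) y‖ ^ 6 * Wt w ε n y
       = ∑ k ∈ Finset.range ((M ^ 2) ^ m), ∑ d ∈ Finset.range (M ^ 2), ∫ y, ‖FF Γ A (Ioc (p0 + 3/2 * ((k * (M^2) + d : ℕ) / K ^ (m+1))) (p0 + 3/2 * (((k * (M^2) + d : ℕ)+1) / K ^ (m+1)))) y‖ ^ 6 * Wt w ε n y := by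
      rw [pow_succ, sum_range_mul']
    rw [e1, Finset.mul_sum]
    refine Finset.sum_le_sum fun k hk => ?_
    have hk2 : (k:ℝ) + 1 ≤ K ^ m := by
      have := Finset.mem_range.1 hk
      rw [hK]; exact_mod_cast this
    have := dec_one h hd hM hΩ hwi hw0 hw h1 h2 hC0 hcount (p := p0 + 3/2 * (k / K ^ m)) (a := 3/2 / K ^ m) (by positivity)
      (by rw [div_le_iff₀ hKm]; nlinarith [one_le_pow₀ hMr (n := m)]) (le_add_of_nonneg_right (by positivity))
      (by have : (k:ℝ) / K ^ m + 1 / K ^ m ≤ 1 := by rw [← add_div, div_le_one hKm]; exact hk2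
          have e : (3/2:ℝ) / K ^ m = 3/2 * (1 / K ^ m) := by ring
          rw [e]; linarith)
      (by have hn0 : 0 < n := by linarith [hd.hn]
          have : K ^ (2 * (m+1)) = (K ^ m) ^ 2 * K ^ 2 := by ring
          rw [this] at hnm
          rw [div_le_div_iff₀ hn0 (by positivity), div_pow, ← hK, div_mul_eq_mul_div, le_div_iff₀ (by positivity)]
          nlinarith [sq_nonneg (K ^ m), mul_le_mul_of_nonneg_left hMr (by positivity : (0:ℝ) ≤ (K^m)^2)])
    have e2 : p0 + 3/2 * (k / K ^ m) + 3/2 / K ^ m = p0 + 3/2 * ((k+1) / K ^ m) := by ring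
    rw [e2] at this
    refine this.trans (le_of_eq ?_)
    congr 1
    refine Finset.sum_congr rfl fun d _ => ?_
    have e3 : ∀ d : ℕ, yy (p0 + 3/2 * (k / K ^ m)) (3/2 / K ^ m) M d = p0 + 3/2 * ((k * (M^2) + d : ℕ) / K ^ (m+1)) := by
      intro d; unfold yy; rw [← hK, pow_succ K m]; push_cast; rw [← hK]; field_simp; ring
    rw [e3, e3]; push_cast; rw [add_assoc]

noncomputable def AA (Γ : ℝ → ℝ) (m f : ℝ × ℝ → ℂ) (a : ℝ × ℝ → ℝ → ℂ) (u0 : ℝ) (J : Set ℝ) : (ℝ × ℝ) × ℝ → ℂ :=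
  (Prod.snd ⁻¹' J).indicator (fun z => ex (ph Γ u0 z.1 z.2) * a z.1 z.2 * (m z.1 * ft f z.1))

section
variable {Γ : ℝ → ℝ} (hΓ : Measurable Γ) {m f : ℝ × ℝ → ℂ} (hm : Cls m) (hf : Cls f) {a : ℝ × ℝ → ℝ → ℂ} (ha : Measurable (Function.uncurry a))
  {J : Set ℝ} (hJ : MeasurableSet J) (hJf : volume J < ⊤) {Ca : ℝ} (hb : ∀ ξ, ∀ t ∈ J, ‖a ξ t‖ ≤ Ca) (u0 : ℝ)

lemma AA_meas (hΓ : Measurable Γ) (hm : Cls m) (hf : Cls f) (ha : Measurable (Function.uncurry a)) (hJ : MeasurableSet J) (u0 : ℝ) :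
    Measurable (AA Γ m f a u0 J) := by
  refine Measurable.indicator ?_ (measurable_snd hJ)
  exact ((ex_meas.comp (ph_meas hΓ u0)).mul ha).mul ((hm.mul_ft hf).m.comp measurable_fst)

lemma AA_int (hΓ : Measurable Γ) (hm : Cls m) (hf : Cls f) (ha : Measurable (Function.uncurry a)) (hJ : MeasurableSet J) (hJf : volume J < ⊤)
    (hb : ∀ ξ, ∀ t ∈ J, ‖a ξ t‖ ≤ Ca) (u0 : ℝ) : Integrable (AA Γ m f a u0 J) := by
  have h1 : Integrable (fun z : (ℝ × ℝ) × ℝ => (m z.1 * ft f z.1) * J.indicator (fun _ => (Ca : ℂ)) z.2) := 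
    (hm.mul_ft hf).i.mul_prod (g := J.indicator (fun _ => (Ca : ℂ))) ((integrable_indicator_iff hJ).2 (integrableOn_const (hs := hJf.ne)))
  refine h1.mono (AA_meas hΓ hm hf ha hJ u0).aestronglyMeasurable (ae_of_all _ fun z => ?_)
  unfold AA
  by_cases hz : z.2 ∈ J
  · rw [Set.indicator_of_mem (by exact hz), Set.indicator_of_mem hz, norm_mul, norm_mul, ex_norm, one_mul, norm_mul _ (Ca : ℂ), mul_comm]
    refine mul_le_mul_of_nonneg_left ?_ (norm_nonneg _)
    rw [Complex.norm_real]; exact (hb _ _ hz).trans (le_abs_self _)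
  · rw [Set.indicator_of_notMem (by exact hz), norm_zero]; exact norm_nonneg _

lemma FF_op (hΓ : Measurable Γ) (hm : Cls m) (hf : Cls f) (ha : Measurable (Function.uncurry a)) (hJ : MeasurableSet J) (hJf : volume J < ⊤)
    (hb : ∀ ξ, ∀ t ∈ J, ‖a ξ t‖ ≤ Ca) (u0 : ℝ) {S : Set ℝ} (hS : MeasurableSet S) (hSJ : S ⊆ J) (y : (ℝ × ℝ) × ℝ) :
    FF Γ (AA Γ m f a u0 J) S y = op (fun ξ => m ξ * GS Γ S a (u0 + y.2) ξ) f y.1 := by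
  unfold FF
  rw [Measure.volume_eq_prod, integral_prod _ (FF_int hΓ (AA_int hΓ hm hf ha hJ hJf hb u0) hS y), op_eq]
  congr 1; ext ξ
  rw [GS, ← integral_indicator hS]
  rw [show ex (pr y.1 ξ) * (m ξ * (∫ t, S.indicator (fun t => ex (ph Γ (u0 + y.2) ξ t) * a ξ t) t) * ft f ξ) =
    (ex (pr y.1 ξ) * (m ξ * ft f ξ)) * (∫ t, S.indicator (fun t => ex (ph Γ (u0 + y.2) ξ t) * a ξ t) t) by ring, ← integral_const_mul]
  congr 1; ext t
  by_cases ht : t ∈ S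
  · rw [Set.indicator_of_mem (by exact ht), Set.indicator_of_mem ht]
    unfold AA
    rw [Set.indicator_of_mem (by exact hSJ ht)]
    have : ph Γ (u0 + y.2) ξ t = ph Γ u0 ξ t + y.2 * (ξ.2 * Γ t) := by unfold ph; ring
    simp only [EE, ex_add, this]; ring
  · rw [Set.indicator_of_notMem (by exact ht), Set.indicator_of_notMem ht]; simp
end

noncomputable def aF (χ ζ Γ1 : ℝ → ℝ) (u0 B : ℝ) (ξ : ℝ × ℝ) (t : ℝ) : ℂ := (χ t : ℂ) * ζ ((ξ.1 + u0 * ξ.2 * Γ1 t) / B)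

lemma aF_meas {χ ζ Γ1 : ℝ → ℝ} (h1 : Measurable χ) (h2 : Measurable ζ) (h3 : Measurable Γ1) (u0 B : ℝ) : Measurable (Function.uncurry (aF χ ζ Γ1 u0 B)) := by
  unfold aF Function.uncurry
  have : Measurable fun z : (ℝ × ℝ) × ℝ => χ z.2 := h1.comp measurable_snd
  have : Measurable fun z : (ℝ × ℝ) × ℝ => ζ ((z.1.1 + u0 * z.1.2 * Γ1 z.2) / B) := h2.comp (by fun_prop)
  fun_prop

/-- cutoff -/
structure Cut (ζ : ℝ → ℝ) : Prop where
  s : ContDiff ℝ (⊤ : ℕ∞) ζ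
  c : HasCompactSupport ζ
  n : ∀ x, 0 ≤ ζ x
  l : ∀ x, ζ x ≤ 1
  o : ∀ x, |x| ≤ 1/2 → ζ x = 1
  z : ∀ x, 1 ≤ |x| → ζ x = 0

lemma exists_cut : ∃ ζ, Cut ζ := by
  let b : ContDiffBump (0:ℝ) := ⟨1/2, 1, by norm_num, by norm_num⟩
  refine ⟨b, b.contDiff, b.hasCompactSupport, fun x => b.nonneg, fun x => b.le_one, fun x hx => ?_, fun x hx => ?_⟩
  · exact b.one_of_mem_closedBall (by simpa [b] using hx)
  · exact b.zero_of_le_dist (by simpa [b] using hx)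

/-- amplitude -/
structure Amp (C p0 : ℝ) (χ χ1 : ℝ → ℝ) : Prop where
  m : Measurable χ
  d : ∀ t ∈ Icc p0 (p0 + 3/2), HasDerivAt χ (χ1 t) t
  b : ∀ t ∈ Icc p0 (p0 + 3/2), |χ t| ≤ C
  b1 : ∀ t ∈ Icc p0 (p0 + 3/2), |χ1 t| ≤ C

lemma aF_le {C p0 : ℝ} {χ χ1 ζ : ℝ → ℝ} (hχ : Amp C p0 χ χ1) (hζ : Cut ζ) (Γ1 : ℝ → ℝ) (u0 B : ℝ) (ξ : ℝ × ℝ) {t : ℝ}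
    (ht : t ∈ Icc p0 (p0 + 3/2)) : ‖aF χ ζ Γ1 u0 B ξ t‖ ≤ C := by
  unfold aF
  rw [norm_mul, Complex.norm_real, Complex.norm_real, Real.norm_eq_abs, Real.norm_eq_abs, abs_of_nonneg (hζ.n _)]
  nlinarith [hχ.b t ht, hζ.l ((ξ.1 + u0 * ξ.2 * Γ1 t) / B), hζ.n ((ξ.1 + u0 * ξ.2 * Γ1 t) / B), abs_nonneg (χ t)]

/-- measure of the set where X is small -/
lemma small_vol {c C p0 e : ℝ} {Γ Γ1 Γ2 Γ3 : ℝ → ℝ} (h : Curve c C p0 e Γ Γ1 Γ2 Γ3) {u0 B ρ : ℝ} (hu : 1 ≤ u0) (hρ : 0 < ρ) {ξ : ℝ × ℝ} (hξ : ρ ≤ |ξ.2|)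
    (hB : 0 ≤ B) : volume.real {t | t ∈ Icc p0 (p0 + 3/2) ∧ |ξ.1 + u0 * ξ.2 * Γ1 t| ≤ B} ≤ 2 * B / (c * ρ) := by
  have hc := h.hc
  rw [Measure.real]
  refine ENNReal.toReal_le_of_le_ofReal (by positivity) ?_
  refine (Real.volume_le_diam _).trans ?_
  refine Metric.ediam_le fun x hx y hy => ?_
  rw [edist_dist]
  refine ENNReal.ofReal_le_ofReal ?_
  rw [Real.dist_eq, le_div_iff₀ (by positivity)]
  wlog hxy : x ≤ y generalizing x y
  · rw [abs_sub_comm]; exact this y hy x hx (le_of_not_ge hxy)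
  obtain ⟨η, hη, e1⟩ := mvt_eq h.d1 hx.1.1 hy.1.2 hxy
  have hη' : η ∈ Icc p0 (p0 + 3/2) := ⟨hx.1.1.trans hη.1, hη.2.trans hy.1.2⟩
  have h2 := h.lo' hη'
  have h3 : |u0 * ξ.2 * (Γ1 y - Γ1 x)| ≤ 2 * B := by
    have : u0 * ξ.2 * (Γ1 y - Γ1 x) = (ξ.1 + u0 * ξ.2 * Γ1 y) - (ξ.1 + u0 * ξ.2 * Γ1 x) := by ring
    rw [this]; refine (abs_sub _ _).trans ?_
    linarith [hx.2, hy.2]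
  rw [e1, abs_mul, abs_mul, abs_mul, abs_of_pos (by linarith : 0 < u0), abs_sub_comm y x] at h3
  refine le_trans ?_ h3
  calc |x - y| * (c * ρ) = 1 * ρ * (c * |x - y|) := by ring
    _ ≤ _ := by gcongr

structure Ker (α β ζ : ℝ → ℝ) (Q : ℝ) : Prop where
  hQ : 1 ≤ Q
  sa : ContDiff ℝ (⊤ : ℕ∞) α
  ca : HasCompactSupport α
  sb : ContDiff ℝ (⊤ : ℕ∞) β
  cb : HasCompactSupport β
  bd : ∀ lam ξ, ‖mul0 α β lam ξ‖ ≤ Q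
  inf : ∀ lam : ℝ, 0 < lam → ∀ f M, Cls f → 0 ≤ M → (∀ x, ‖f x‖ ≤ M) → ∀ x, ‖op (mul0 α β lam) f x‖ ≤ Q * M
  cut : Cut ζ
  z : ∃ a : ℝ → ℂ, Integrable a ∧ (∀ x, (ζ x : ℂ) = ∫ y, Complex.exp ((2 * Real.pi * (x * y) : ℝ) * Complex.I) * a y) ∧ ∫ y, ‖a y‖ ≤ Q
  lo : ∀ x, β x ≠ 0 → 1 / 8 ≤ |x|
  up : ∀ x, β x ≠ 0 → |x| ≤ 4

lemma exists_ker {α β ζ : ℝ → ℝ} (ha : ContDiff ℝ (⊤ : ℕ∞) α) (hac : HasCompactSupport α) (hb : ContDiff ℝ (⊤ : ℕ∞) β) (hbc : HasCompactSupport β)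
    (hζ : Cut ζ) (hlo : ∀ x, β x ≠ 0 → 1 / 8 ≤ |x|) (hup : ∀ x, β x ≠ 0 → |x| ≤ 4) : ∃ Q, Ker α β ζ Q := by
  obtain ⟨A, hA⟩ := hac.exists_bound_of_continuous ha.continuous
  obtain ⟨B, hB⟩ := hbc.exists_bound_of_continuous hb.continuous
  obtain ⟨A0, hA0, hinf⟩ := mul0_inf ha hac hb hbc
  obtain ⟨a, a1, a2, a3, a4⟩ := cc_fourier ζ hζ.s hζ.c
  refine ⟨1 + A * B + A0 + ∫ y, ‖a y‖, ?_⟩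
  have hA' : 0 ≤ A := (norm_nonneg _).trans (hA 0)
  have hB' : 0 ≤ B := (norm_nonneg _).trans (hB 0)
  have hZ : 0 ≤ ∫ y, ‖a y‖ := integral_nonneg fun y => norm_nonneg _
  have hAB := mul_nonneg hA' hB'
  refine ⟨by linarith, ha, hac, hb, hbc, fun lam ξ => ?_, ?_, hζ, ⟨a, a2, a3, by linarith⟩, hlo, hup⟩
  · unfold mul0
    rw [norm_mul, Complex.norm_real, Complex.norm_real]
    have := mul_le_mul (hA (ξ.1/lam)) (hB (ξ.2/lam)) (norm_nonneg _) hA'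
    linarith
  · intro lam hl f M hf hM hx x
    refine (hinf lam hl f M hf hM hx x).trans (mul_le_mul_of_nonneg_right (by linarith) hM)

lemma Ker.lo' {α β ζ : ℝ → ℝ} {Q : ℝ} (hk : Ker α β ζ Q) {lam : ℝ} (hl : 0 < lam) {ξ : ℝ × ℝ} (h : mul0 α β lam ξ ≠ 0) : lam / 8 ≤ |ξ.2| := by
  have : β (ξ.2 / lam) ≠ 0 := by intro h2; apply h; unfold mul0; rw [h2]; simp
  have := hk.lo _ this
  rw [abs_div, abs_of_pos hl, le_div_iff₀ hl] at this; linarith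

lemma Ker.up' {α β ζ : ℝ → ℝ} {Q : ℝ} (hk : Ker α β ζ Q) {lam : ℝ} (hl : 0 < lam) {ξ : ℝ × ℝ} (h : mul0 α β lam ξ ≠ 0) : |ξ.2| ≤ 4 * lam := by
  have : β (ξ.2 / lam) ≠ 0 := by intro h2; apply h; unfold mul0; rw [h2]; simp
  have := hk.up _ this
  rw [abs_div, abs_of_pos hl, div_le_iff₀ hl] at this; linarith

lemma op_smul (s : ℂ) (m f : ℝ × ℝ → ℂ) (x : ℝ × ℝ) : op (fun ξ => m ξ * s) f x = s * op m f x := by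
  simp only [op_eq]; rw [← integral_const_mul]; congr 1; ext ξ; ring

section
variable {c C p0 e : ℝ} {Γ Γ1 Γ2 Γ3 : ℝ → ℝ} {α β ζ χ χ1 : ℝ → ℝ} {Q : ℝ}

lemma F_inf0 (hk : Ker α β ζ Q) (hχ : Amp C p0 χ χ1) {lam u0 B : ℝ} (hl : 0 < lam)
    {f : ℝ × ℝ → ℂ} (hf : Cls f) {M : ℝ} (hM0 : 0 ≤ M) (hM : ∀ x, ‖f x‖ ≤ M) {t : ℝ} (ht : t ∈ Icc p0 (p0 + 3/2)) (x : ℝ × ℝ) :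
    ‖op (fun ξ => mul0 α β lam ξ * aF χ ζ Γ1 u0 B ξ t) f x‖ ≤ C * (Q * (Q * M)) := by
  obtain ⟨a, a1, a2, a3⟩ := hk.z
  have hQ := hk.hQ
  have h1 := op_zeta (mul0_cls hk.sa hk.ca hk.sb hk.cb hl) hf a1 a2 (1 / B, u0 * Γ1 t / B) (fun x => hk.inf lam hl f M hf hM0 hM x) x
  have h2 : (fun ξ => mul0 α β lam ξ * aF χ ζ Γ1 u0 B ξ t) = fun ξ : ℝ × ℝ => (mul0 α β lam ξ * ζ (1 / B * ξ.1 + u0 * Γ1 t / B * ξ.2)) * (χ t : ℂ) := by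
    ext ξ; unfold aF
    rw [show (ξ.1 + u0 * ξ.2 * Γ1 t) / B = 1 / B * ξ.1 + u0 * Γ1 t / B * ξ.2 by ring]; ring
  rw [h2, op_smul, norm_mul, Complex.norm_real]
  refine mul_le_mul (hχ.b t ht) (h1.trans ?_) (norm_nonneg _) ((abs_nonneg _).trans (hχ.b t ht))
  gcongr

lemma F_marc (h : Curve c C p0 e Γ Γ1 Γ2 Γ3) (hk : Ker α β ζ Q) (hχ : Amp C p0 χ χ1) {lam u0 B : ℝ} (hl : 0 < lam) (hu : 1 ≤ u0) (hB : 0 < B) (u : ℝ)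
    {q : ℕ} (hq : 1 ≤ q) {f : ℝ × ℝ → ℂ} (hf : Cls f) :
    ∑ k ∈ Finset.range q, ∫⁻ x, ‖op (fun ξ => mul0 α β lam ξ * GS Γ (Ioc (p0 + 3/2 * (k / (q:ℝ))) (p0 + 3/2 * ((k+1) / (q:ℝ)))) (aF χ ζ Γ1 u0 B) u ξ) f x‖ₑ ^ 6
      ≤ 96 * ENNReal.ofReal ((Q * C * (16 * B / (c * lam))) ^ 2) * ENNReal.ofReal ((C * Q * Q * (3/2 / q)) ^ 4) * ∫⁻ x, ‖f x‖ₑ ^ 6 := by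
  have hc := h.hc
  have hC := h.hC
  have hQ := hk.hQ
  have hq0 : (0:ℝ) < q := by exact_mod_cast hq
  set g : ℕ → ℝ := fun k => p0 + 3/2 * (k / (q:ℝ)) with hg
  have hgm : Monotone g := by
    intro a b hab
    have : (a:ℝ) ≤ b := by exact_mod_cast hab
    simp only [hg]; gcongr
  have hg0 : g 0 = p0 := by simp [hg]
  have hgq : g q = p0 + 3/2 := by simp only [hg]; field_simp
  have hsub : ∀ k < q, Ioc (g k) (g (k+1)) ⊆ Icc p0 (p0 + 3/2) := fun k hk t ht => 
    ⟨(hg0 ▸ hgm (Nat.zero_le k)).trans ht.1.le, ht.2.trans (hgq ▸ hgm hk)⟩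
  have hgk : ∀ k : ℕ, p0 + 3/2 * ((k+1) / (q:ℝ)) = g (k+1) := by intro k; simp [hg]
  have hgk' : ∀ k : ℕ, p0 + 3/2 * (k / (q:ℝ)) = g k := fun k => rfl
  simp only [hgk, hgk']
  rw [Finset.sum_range]
  have hm0 := mul0_cls hk.sa hk.ca hk.sb hk.cb hl
  have haf := aF_meas hχ.m hk.cut.s.continuous.measurable h.m1 u0 B
  have hvol : ∀ k, volume.real (Ioc (g k) (g (k+1))) = 3/2 / q := by
    intro k; rw [Real.volume_real_Ioc_of_le (hgm (Nat.le_succ k))]; simp only [hg]; push_cast; field_simp; ring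
  have hvf : ∀ k, volume (Ioc (g k) (g (k+1))) < ⊤ := fun k => by simp
  have hGSb : ∀ k : Fin q, ∀ ξ, ‖GS Γ (Ioc (g k) (g (k+1))) (aF χ ζ Γ1 u0 B) u ξ‖ ≤ C * volume.real (Ioc (g k) (g (k+1))) := fun k ξ =>
    GS_le (hvf k) (fun ξ t ht => aF_le hχ hk.cut Γ1 u0 B ξ (hsub k k.2 ht)) u ξ
  refine op_marc _ (fun k => hm0.mul_bdd (GS_meas h.m0 haf u) (hGSb k)) (by positivity) (by positivity) ?_ ?_ hf
  · intro ξ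
    by_cases h0 : mul0 α β lam ξ = 0
    · simp only [h0, zero_mul, norm_zero]; simp; positivity
    have hlo := hk.lo' hl h0
    have hIm : Measurable (fun t => aF χ ζ Γ1 u0 B ξ t) := haf.comp (measurable_const.prodMk measurable_id)
    have hint : ∀ a b, p0 ≤ a → a ≤ b → b ≤ p0 + 3/2 → IntervalIntegrable (fun t => ‖aF χ ζ Γ1 u0 B ξ t‖) volume a b := by
      intro a b h1 h2 h3
      rw [intervalIntegrable_iff_integrableOn_Ioc_of_le h2]
      refine Measure.integrableOn_of_bounded (M := C) (by simp) hIm.norm.aestronglyMeasurable ?_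
      filter_upwards [ae_restrict_mem measurableSet_Ioc] with t ht
      rw [norm_norm]; exact aF_le hχ hk.cut Γ1 u0 B ξ ⟨h1.trans ht.1.le, ht.2.trans h3⟩
    have s1 : ∑ k : Fin q, ‖mul0 α β lam ξ * GS Γ (Ioc (g k) (g (k+1))) (aF χ ζ Γ1 u0 B) u ξ‖ ≤ Q * C * (16 * B / (c * lam)) := by
      calc ∑ k : Fin q, ‖mul0 α β lam ξ * GS Γ (Ioc (g k) (g (k+1))) (aF χ ζ Γ1 u0 B) u ξ‖ 
          ≤ ∑ k : Fin q, Q * ∫ t in (g k)..(g (k+1)), ‖aF χ ζ Γ1 u0 B ξ t‖ := by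
            refine Finset.sum_le_sum fun k _ => ?_
            rw [norm_mul]
            refine mul_le_mul (hk.bd _ _) ?_ (norm_nonneg _) (by linarith)
            rw [intervalIntegral.integral_of_le (hgm (Nat.le_succ _))]
            refine (norm_integral_le_integral_norm _).trans (le_of_eq ?_)
            congr 1; ext t; rw [norm_mul, ex_norm, one_mul]
        _ = Q * ∫ t in p0..(p0 + 3/2), ‖aF χ ζ Γ1 u0 B ξ t‖ := by
            rw [← Finset.mul_sum, ← Finset.sum_range (fun k => ∫ t in (g k)..(g (k+1)), ‖aF χ ζ Γ1 u0 B ξ t‖),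
              intervalIntegral.sum_integral_adjacent_intervals, hg0, hgq]
            intro k hk
            exact hint _ _ (hg0 ▸ hgm (Nat.zero_le k)) (hgm (Nat.le_succ _)) (hgq ▸ hgm hk)
        _ ≤ Q * (C * (2 * B / (c * (lam / 8)))) := by
            gcongr
            rw [intervalIntegral.integral_of_le (by linarith)]
            set T := {t | t ∈ Icc p0 (p0 + 3/2) ∧ |ξ.1 + u0 * ξ.2 * Γ1 t| ≤ B} with hT
            have hTm : MeasurableSet T := by
              have h3 : Measurable fun t => |ξ.1 + u0 * ξ.2 * Γ1 t| := by have := h.m1; fun_prop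
              have h4 : T = Icc p0 (p0 + 3/2) ∩ {t | |ξ.1 + u0 * ξ.2 * Γ1 t| ≤ B} := by ext t; simp [hT]
              rw [h4]; exact measurableSet_Icc.inter (measurableSet_le h3 measurable_const)
            have hTf : volume T < ⊤ := lt_of_le_of_lt (measure_mono (fun t ht => ht.1)) (measure_Icc_lt_top (a := p0) (b := p0 + 3/2))
            calc ∫ t in Ioc p0 (p0 + 3/2), ‖aF χ ζ Γ1 u0 B ξ t‖ ≤ ∫ t in Ioc p0 (p0 + 3/2), T.indicator (fun _ => C) t := by
                  refine setIntegral_mono_on ((intervalIntegrable_iff_integrableOn_Ioc_of_le (by linarith)).1 (hint _ _ le_rfl (by linarith) le_rfl)) ?_ measurableSet_Ioc ?_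
                  · exact (((integrable_indicator_iff hTm).2 (integrableOn_const (hs := hTf.ne)))).integrableOn
                  · intro t ht
                    by_cases htT : t ∈ T
                    · rw [Set.indicator_of_mem htT]; exact aF_le hχ hk.cut Γ1 u0 B ξ htT.1
                    · rw [Set.indicator_of_notMem htT]
                      have : B < |ξ.1 + u0 * ξ.2 * Γ1 t| := by
                        by_contra hh; exact htT ⟨Ioc_subset_Icc_self ht, not_lt.1 hh⟩
                      have : ζ ((ξ.1 + u0 * ξ.2 * Γ1 t) / B) = 0 := hk.cut.z _ (by rw [abs_div, abs_of_pos hB, le_div_iff₀ hB]; linarith)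
                      unfold aF; rw [this]; simp
              _ ≤ ∫ t, T.indicator (fun _ => C) t := by
                  refine setIntegral_le_integral ((integrable_indicator_iff hTm).2 (integrableOn_const (hs := hTf.ne))) (ae_of_all _ fun t => ?_)
                  exact Set.indicator_nonneg (fun _ _ => by linarith) _
              _ = C * volume.real T := by rw [integral_indicator hTm, setIntegral_const, smul_eq_mul, mul_comm]
              _ ≤ _ := by gcongr; exact small_vol h hu (by positivity) hlo hB.le
        _ = _ := by field_simp; ring
    refine le_trans ?_ (pow_le_pow_left₀ (Finset.sum_nonneg fun _ _ => norm_nonneg _) s1 2)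
    exact Finset.sum_sq_le_sq_sum_of_nonneg (fun _ _ => norm_nonneg _)
  · intro k f M hf hM0 hM x
    have := op_t hm0 hf h.m0 measurableSet_Ioc (hvf k) haf (fun ξ t ht => aF_le hχ hk.cut Γ1 u0 B ξ (hsub k k.2 ht)) u
      (Q := C * (Q * (Q * M))) (fun t ht x => F_inf0 hk hχ hl hf hM0 hM (hsub k k.2 ht) x) x
    rw [hvol] at this
    refine this.trans (le_of_eq (by ring))
end

structure Wgt (w : ℝ → ℝ) (Ω Cw : ℝ) : Prop where
  hΩ : 0 < Ω
  c : Continuous w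
  n : ∀ v, 0 ≤ w v
  i : Integrable w
  l : ∀ v, |v| ≤ 1 → 1 ≤ w v
  u : ∀ v, w v ≤ Cw
  o : ∀ ω, Ω ≤ |ω| → ∫ v, Complex.exp ((ω * v : ℝ) * Complex.I) * w v = 0

lemma Wt_nn {w : ℝ → ℝ} {Ω Cw : ℝ} (hw : Wgt w Ω Cw) (ε n : ℝ) (y) : 0 ≤ Wt w ε n y := by
  unfold Wt; have := hw.n (ε * y.1.1); have := hw.n (ε * y.1.2); have := hw.n (n * y.2); positivity

lemma Wt_meas {w : ℝ → ℝ} {Ω Cw : ℝ} (hw : Wgt w Ω Cw) (ε n : ℝ) : Measurable (Wt w ε n) := by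
  have := hw.c; unfold Wt; fun_prop

lemma ofReal_six {F : (ℝ × ℝ) × ℝ → ℂ} (hF : Measurable F) {b : ℝ} (hb : ∀ y, ‖F y‖ ≤ b) {w : ℝ → ℝ} {Ω Cw : ℝ} (hw : Wgt w Ω Cw) {ε n : ℝ} (hε : 0 < ε) (hn : 0 < n) :
    ENNReal.ofReal (∫ y, ‖F y‖ ^ 6 * Wt w ε n y) = ∫⁻ y, ‖F y‖ₑ ^ 6 * ENNReal.ofReal (Wt w ε n y) := by
  rw [ofReal_integral_eq_lintegral_ofReal]
  · refine lintegral_congr fun y => ?_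
    rw [ENNReal.ofReal_mul (by positivity), ENNReal.ofReal_pow (norm_nonneg _), ofReal_norm]
  · refine (Wt_int hw.i hε hn).bdd_mul (c := b ^ 6) (hF.norm.pow_const 6).aestronglyMeasurable (ae_of_all _ fun y => ?_)
    rw [norm_pow, norm_norm]
    exact pow_le_pow_left₀ (norm_nonneg _) (hb y) 6
  · exact ae_of_all _ fun y => mul_nonneg (by positivity) (Wt_nn hw _ _ _)

lemma exhaust {g : (ℝ × ℝ) × ℝ → ℝ≥0∞} (J : Set ℝ) {X : ℝ≥0∞}
    (h : ∀ ε : ℝ, 0 < ε → ε ≤ 1 → ∫⁻ y in (Icc (-(1/ε)) (1/ε) ×ˢ Icc (-(1/ε)) (1/ε)) ×ˢ J, g y ≤ X) :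
    ∫⁻ y in univ ×ˢ J, g y ≤ X := by
  have e : (univ ×ˢ J : Set ((ℝ × ℝ) × ℝ)) = ⋃ k : ℕ, (Icc (-(k+1:ℝ)) (k+1) ×ˢ Icc (-(k+1:ℝ)) (k+1)) ×ˢ J := by
    ext y
    simp only [mem_prod, mem_univ, true_and, mem_iUnion, mem_Icc]
    constructor
    · intro hy
      obtain ⟨k, hk⟩ := exists_nat_ge (|y.1.1| + |y.1.2|)
      have h1 := abs_nonneg y.1.1
      have h2 := abs_nonneg y.1.2
      refine ⟨k, ⟨?_, ?_⟩, hy⟩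
      · exact abs_le.1 (by linarith)
      · exact abs_le.1 (by linarith)
    · rintro ⟨k, -, hy⟩; exact hy
  rw [e, setLIntegral_iUnion_of_directed]
  · refine iSup_le fun k => ?_
    have := h (1 / (k+1:ℝ)) (by positivity) (by rw [div_le_one (by positivity)]; linarith [Nat.cast_nonneg (α := ℝ) k])
    simpa using this
  · refine Monotone.directed_le fun a b hab => ?_
    have : (a:ℝ) ≤ b := by exact_mod_cast hab
    refine prod_mono (prod_mono ?_ ?_) le_rfl <;> exact Icc_subset_Icc (by linarith) (by linarith)

section
variable {c C p0 e : ℝ} {Γ Γ1 Γ2 Γ3 : ℝ → ℝ} {α β ζ χ χ1 : ℝ → ℝ} {Q : ℝ}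

lemma F_main (h : Curve c C p0 e Γ Γ1 Γ2 Γ3) (hk : Ker α β ζ Q) (hχ : Amp C p0 χ χ1) {w : ℝ → ℝ} {Ω Cw : ℝ} (hw : Wgt w Ω Cw)
    {M : ℕ} (hM : 1 ≤ M) {n lam r0 u0 CB : ℝ} (hn : 1 ≤ n) (hl : n ^ 2 ≤ lam) (hr0 : 1 / 4 ≤ |r0|) (hr0' : |r0| ≤ 3) (hu : 1 ≤ u0) (hCB : 0 < CB)
    (hβ : ∀ x, β x ≠ 0 → |x - r0| ≤ 1 / (M:ℝ) ^ 2)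
    {C0 : ℝ} {C1 : ℕ} (h1 : C ≤ C0) (h2 : 2 * C ^ 2 / c ^ 2 ≤ C0) (hC0 : 32 * C * (1 + C ^ 2 / c ^ 2) * (Ω + 6 * CB + 30) ≤ C0)
    (hcount : ∀ {S H : ℕ → ℝ} {G : ℕ → ℕ → ℝ},
    CntHyp (c / C ^ 2) C0 M S H G → ∀ {P : Finset (ℕ × ℕ)}, PairOK C0 M S H P → P.card ≤ C1 * M)
    (m : ℕ) (hnm : ((M:ℝ) ^ 2) ^ (2 * m) ≤ n) {f : ℝ × ℝ → ℂ} (hf : Cls f) :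
    ∫⁻ y in univ ×ˢ Icc 0 (1 / n), ‖op (fun ξ => mul0 α β lam ξ * GS Γ (Ioc p0 (p0 + 3/2)) (aF χ ζ Γ1 u0 (CB * lam / n)) (u0 + y.2) ξ) f y.1‖ₑ ^ 6 ≤
      ENNReal.ofReal (((C1 * M * (M ^ 2) ^ 3 : ℕ) : ℝ) ^ m * (Cw ^ 2 * ((1 / n) * ∫ v, w v)) * (96 * (Q * C * (16 * CB / (c * n))) ^ 2 * (C * Q * Q * (3/2 / ((M:ℝ) ^ 2) ^ m)) ^ 4))
        * ∫⁻ x, ‖f x‖ₑ ^ 6 := by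
  have hc := h.hc
  have hC := h.hC
  have hQ := hk.hQ
  have hn0 : 0 < n := by linarith
  have hl0 : 0 < lam := by nlinarith
  set B := CB * lam / n with hB
  have hB0 : 0 < B := by positivity
  set I0 := Ioc p0 (p0 + 3/2) with hI0
  have hI0m : MeasurableSet I0 := measurableSet_Ioc
  have hI0f : volume I0 < ⊤ := by simp [hI0]
  set a := aF χ ζ Γ1 u0 B with ha
  have ham : Measurable (Function.uncurry a) := aF_meas hχ.m hk.cut.s.continuous.measurable h.m1 u0 B
  have hab : ∀ ξ, ∀ t ∈ I0, ‖a ξ t‖ ≤ C := fun ξ t ht => aF_le hχ hk.cut Γ1 u0 B ξ (Ioc_subset_Icc_self ht)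
  have hm0 := mul0_cls hk.sa hk.ca hk.sb hk.cb hl0
  set A := AA Γ (mul0 α β lam) f a u0 I0 with hA
  have hAm : Measurable A := AA_meas h.m0 hm0 hf ham hI0m u0
  have hAi : Integrable A := AA_int h.m0 hm0 hf ham hI0m hI0f hab u0
  have eop : ∀ S, MeasurableSet S → S ⊆ I0 → ∀ y, FF Γ A S y = op (fun ξ => mul0 α β lam ξ * GS Γ S a (u0 + y.2) ξ) f y.1 :=
    fun S hS hSI y => FF_op h.m0 hm0 hf ham hI0m hI0f hab u0 hS hSI y
  simp_rw [← eop I0 hI0m subset_rfl]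
  refine exhaust _ fun ε hε hε1 => ?_
  have hd : Dec Γ Γ1 A M n lam r0 u0 CB ε := by
    refine ⟨hAi, hAm, hn, hl, hr0, hr0', hu, hCB.le, hε, hε1, fun z hz => ?_, fun z hz => ?_⟩
    · refine hβ _ fun h0 => hz ?_
      simp only [hA, AA, Set.indicator, mul0, h0]; simp
    · by_contra hcon
      push Not at hcon
      refine hz ?_
      have : ζ ((z.1.1 + u0 * z.1.2 * Γ1 z.2) / B) = 0 := hk.cut.z _ (by rw [abs_div, abs_of_pos hB0, le_div_iff₀ hB0]; linarith)
      simp only [hA, AA, Set.indicator, ha, aF, this]; simp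
  have hdec := dec_all h hd hM hw.hΩ hw.i hw.n hw.o h1 h2 hC0 hcount m hnm
  set q : ℕ := (M ^ 2) ^ m with hq
  have hqr : ((M:ℝ) ^ 2) ^ m = q := by rw [hq]; push_cast; rfl
  have hq1 : 1 ≤ q := Nat.one_le_pow _ _ (by positivity)
  have hq0 : (0:ℝ) < q := by exact_mod_cast hq1
  rw [hqr] at hdec ⊢
  set g : ℕ → ℝ := fun k => p0 + 3/2 * (k / (q:ℝ)) with hg
  have hgk : ∀ k : ℕ, p0 + 3/2 * ((k+1) / (q:ℝ)) = g (k+1) := by intro k; simp [hg]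
  have hgk' : ∀ k : ℕ, p0 + 3/2 * (k / (q:ℝ)) = g k := fun k => rfl
  have hmarc := fun v : ℝ => F_marc h hk hχ hl0 hu hB0 (u0 + v) hq1 hf
  simp only [hgk, hgk'] at hdec hmarc
  set X := 96 * ENNReal.ofReal ((Q * C * (16 * B / (c * lam))) ^ 2) * ENNReal.ofReal ((C * Q * Q * (3/2 / q)) ^ 4) * ∫⁻ x, ‖f x‖ₑ ^ 6 with hX
  have hgm : Monotone g := by
    intro a b hab
    have : (a:ℝ) ≤ b := by exact_mod_cast hab
    simp only [hg]; gcongr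
  have hg0 : g 0 = p0 := by simp [hg]
  have hgq : g q = p0 + 3/2 := by simp only [hg]; field_simp
  have hsub : ∀ k < q, Ioc (g k) (g (k+1)) ⊆ I0 := fun k hk t ht => 
    ⟨(hg0 ▸ hgm (Nat.zero_le k)).trans_lt ht.1, ht.2.trans (hgq ▸ hgm hk)⟩
  have hFm : ∀ S, MeasurableSet S → Measurable (FF Γ A S) := fun S hS => FF_meas h.m0 hAm hS
  have hCw : 0 ≤ Cw := (hw.n 0).trans (hw.u 0)
  set N6 : ℝ := ((C1 * M * (M ^ 2) ^ 3 : ℕ) : ℝ) with hN6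
  have hN0 : 0 ≤ N6 := Nat.cast_nonneg _
  have lower : ∫⁻ y in (Icc (-(1/ε)) (1/ε) ×ˢ Icc (-(1/ε)) (1/ε)) ×ˢ Icc 0 (1 / n), ‖FF Γ A I0 y‖ₑ ^ 6 ≤ ∫⁻ y, ‖FF Γ A I0 y‖ₑ ^ 6 * ENNReal.ofReal (Wt w ε n y) := by
    rw [← lintegral_indicator ((measurableSet_Icc.prod measurableSet_Icc).prod measurableSet_Icc)]
    refine lintegral_mono fun y => ?_
    rw [Set.indicator_apply]
    split_ifs with hy
    swap
    · exact zero_le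
    obtain ⟨⟨y1, y2⟩, y3⟩ := hy
    have k1 : ∀ s ∈ Icc (-(1/ε)) (1/ε), 1 ≤ w (ε * s) := by
      intro s hs
      apply hw.l
      have := abs_le.2 hs
      rw [abs_mul, abs_of_pos hε]
      rwa [le_div_iff₀ hε, mul_comm] at this
    have k2 : 1 ≤ w (n * y.2) := by
      apply hw.l
      rw [abs_mul, abs_of_pos hn0, abs_of_nonneg y3.1, mul_comm, ← le_div_iff₀ hn0]; exact y3.2
    have : 1 ≤ Wt w ε n y := by
      unfold Wt
      have := k1 _ y1
      have := k1 _ y2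
      calc (1:ℝ) = 1 * 1 * 1 := by norm_num
        _ ≤ _ := by gcongr
    calc ‖FF Γ A I0 y‖ₑ ^ 6 = ‖FF Γ A I0 y‖ₑ ^ 6 * 1 := by rw [mul_one]
      _ ≤ _ := by gcongr; rw [ENNReal.one_le_ofReal]; exact this
  have upper : ∑ k ∈ Finset.range q, ∫⁻ y, ‖FF Γ A (Ioc (g k) (g (k+1))) y‖ₑ ^ 6 * ENNReal.ofReal (Wt w ε n y) ≤ X * ENNReal.ofReal (Cw ^ 2 * ((1/n) * ∫ v, w v)) := by
    have hwm : Measurable (fun v => ENNReal.ofReal (Cw ^ 2 * w (n * v))) := by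
      have := hw.c; fun_prop
    calc ∑ k ∈ Finset.range q, ∫⁻ y, ‖FF Γ A (Ioc (g k) (g (k+1))) y‖ₑ ^ 6 * ENNReal.ofReal (Wt w ε n y) 
        ≤ ∑ k ∈ Finset.range q, ∫⁻ v, ∫⁻ x, ‖FF Γ A (Ioc (g k) (g (k+1))) (x, v)‖ₑ ^ 6 * ENNReal.ofReal (Cw ^ 2 * w (n * v)) := by
          refine Finset.sum_le_sum fun k _ => ?_
          rw [Measure.volume_eq_prod, lintegral_prod_symm]
          · refine lintegral_mono fun v => lintegral_mono fun x => ?_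
            gcongr
            unfold Wt
            simp only []
            rw [sq]
            have := hw.n; have := hw.u
            have hh := hw.n (n * v)
            refine mul_le_mul_of_nonneg_right (mul_le_mul (hw.u _) (hw.u _) (hw.n _) hCw) hh
          · exact (((hFm _ measurableSet_Ioc).enorm.pow_const 6).mul (Wt_meas hw ε n).ennreal_ofReal).aemeasurable
      _ = ∑ k ∈ Finset.range q, ∫⁻ v, (∫⁻ x, ‖FF Γ A (Ioc (g k) (g (k+1))) (x, v)‖ₑ ^ 6) * ENNReal.ofReal (Cw ^ 2 * w (n * v)) := by
          refine Finset.sum_congr rfl fun k _ => lintegral_congr fun v => ?_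
          rw [lintegral_mul_const]
          exact ((hFm _ measurableSet_Ioc).comp (measurable_id.prodMk measurable_const)).enorm.pow_const 6
      _ = ∫⁻ v, ∑ k ∈ Finset.range q, (∫⁻ x, ‖FF Γ A (Ioc (g k) (g (k+1))) (x, v)‖ₑ ^ 6) * ENNReal.ofReal (Cw ^ 2 * w (n * v)) := by
          rw [lintegral_finsetSum]
          intro k _
          refine Measurable.mul ?_ hwm
          exact Measurable.lintegral_prod_left' ((hFm _ measurableSet_Ioc).enorm.pow_const 6)
      _ ≤ ∫⁻ v, X * ENNReal.ofReal (Cw ^ 2 * w (n * v)) := by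
          refine lintegral_mono fun v => ?_
          simp only []
          rw [← Finset.sum_mul]
          gcongr
          refine le_trans (le_of_eq ?_) (hmarc v)
          refine Finset.sum_congr rfl fun k hk => lintegral_congr fun x => ?_
          rw [eop _ measurableSet_Ioc (hsub k (Finset.mem_range.1 hk))]
      _ = X * ENNReal.ofReal (Cw ^ 2 * ((1/n) * ∫ v, w v)) := by
          rw [lintegral_const_mul _ hwm, ← ofReal_integral_eq_lintegral_ofReal]
          · congr 2
            rw [integral_const_mul, Measure.integral_comp_mul_left, abs_of_pos (by positivity), smul_eq_mul, one_div]
          · exact (hw.i.comp_mul_left' hn0.ne').const_mul _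
          · exact ae_of_all _ fun v => mul_nonneg (by positivity) (hw.n _)
  refine lower.trans ?_
  rw [← ofReal_six (hFm _ hI0m) (fun y => FF_le hAi y) hw hε hn0]
  refine (ENNReal.ofReal_le_ofReal hdec).trans ?_
  rw [ENNReal.ofReal_mul (by positivity), ENNReal.ofReal_sum_of_nonneg]
  · simp_rw [ofReal_six (hFm _ measurableSet_Ioc) (fun y => FF_le hAi y) hw hε hn0]
    refine (mul_le_mul_right upper _).trans (le_of_eq ?_)
    have hW1 : 0 ≤ ∫ v, w v := integral_nonneg hw.n
    have eB : 16 * B / (c * lam) = 16 * CB / (c * n) := by rw [hB]; field_simp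
    have key : ∀ a b x y : ℝ, 0 ≤ a → 0 ≤ b → 0 ≤ x → 0 ≤ y → ENNReal.ofReal (a * b * (96 * x * y)) = ENNReal.ofReal a * ENNReal.ofReal b * (96 * ENNReal.ofReal x * ENNReal.ofReal y) := by
      intro a b x y ha hb hx hy
      rw [ENNReal.ofReal_mul (by positivity), ENNReal.ofReal_mul ha, ENNReal.ofReal_mul (by positivity), ENNReal.ofReal_mul (by positivity)]
      simp
    rw [hX, eB, key _ _ _ _ (by positivity) (by positivity) (by positivity) (by positivity)]
    ring
  · intro k _
    exact integral_nonneg fun y => mul_nonneg (by positivity) (Wt_nn hw _ _ _)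
end

noncomputable def aE (χ ζ Γ1 : ℝ → ℝ) (u0 B : ℝ) (ξ : ℝ × ℝ) (t : ℝ) : ℂ := (χ t : ℂ) * (1 - ζ ((ξ.1 + u0 * ξ.2 * Γ1 t) / B) : ℝ)

lemma ibp_bound {a b K1 : ℝ} (hab : a ≤ b) {P Y χ κ : ℝ → ℝ} {A : ℝ → ℂ} {χ1 κ1 V V1 : ℝ → ℝ}
    (hAm : Measurable A) (hAi : IntervalIntegrable A volume a b)
    (hA : ∀ t ∈ Icc a b, A t = ex (P t) * ((χ t * (Y t * κ t) : ℝ) : ℂ))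
    (hAc : ∀ t ∈ Icc a b, ContinuousAt A t)
    (hP : ∀ t ∈ Icc a b, HasDerivAt P (Y t) t) (hχ : ∀ t ∈ Icc a b, HasDerivAt χ (χ1 t) t) (hκ : ∀ t ∈ Icc a b, HasDerivAt κ (κ1 t) t)
    (hV : ∀ t ∈ Icc a b, HasDerivAt V (V1 t) t) (hb : ∀ t ∈ Icc a b, |χ t * κ t| ≤ K1) (hb1 : ∀ t ∈ Icc a b, |χ1 t * κ t + χ t * κ1 t| ≤ V1 t) :
    ‖∫ t in a..b, A t‖ ≤ 2 * K1 + (V b - V a) := by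
  set H : ℝ → ℂ := fun t => Complex.I * (∫ s in a..t, A s) - ex (P t) * ((χ t * κ t : ℝ) : ℂ) with hH
  set H' : ℝ → ℂ := fun t => - (ex (P t) * ((χ1 t * κ t + χ t * κ1 t : ℝ) : ℂ)) with hH'
  have hd : ∀ t ∈ Icc a b, HasDerivAt H (H' t) t := by
    intro t ht
    have i1 : IntervalIntegrable A volume a t := hAi.mono_set (by rw [uIcc_of_le hab, uIcc_of_le ht.1]; exact Icc_subset_Icc_right ht.2)
    have d1 := (intervalIntegral.integral_hasDerivAt_right i1 hAm.stronglyMeasurable.stronglyMeasurableAtFilter (hAc t ht)).const_mul Complex.I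
    have d2 : HasDerivAt (fun t => ex (P t)) (ex (P t) * (Y t * Complex.I)) t := by
      unfold ex; exact ((hP t ht).ofReal_comp.mul_const Complex.I).cexp
    have d3 := ((hχ t ht).mul (hκ t ht)).ofReal_comp
    refine (d1.sub (d2.mul d3)).congr_deriv ?_
    rw [hA t ht, hH']; push_cast; simp only [Pi.mul_apply]; push_cast; ring
  have h1 : ‖H b‖ ≤ K1 + (V b - V a) := by
    refine image_norm_le_of_norm_deriv_right_le_deriv_boundary' (f := H) (f' := H') (B := fun t => K1 + (V t - V a)) (B' := V1)
      (fun t ht => (hd t ht).continuousAt.continuousWithinAt) (fun t ht => (hd t (Ico_subset_Icc_self ht)).hasDerivWithinAt) ?_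
      (fun t ht => (((hV t ht).sub_const _).const_add _).continuousAt.continuousWithinAt) 
      (fun t ht => (((hV t (Ico_subset_Icc_self ht)).sub_const _).const_add _).hasDerivWithinAt) ?_ (right_mem_Icc.2 hab)
    · simp only [hH, intervalIntegral.integral_same, mul_zero, zero_sub, norm_neg, norm_mul, ex_norm, one_mul, Complex.norm_real, sub_self, add_zero]
      rw [← norm_mul]; exact hb a (left_mem_Icc.2 hab)
    · intro t ht
      simp only [hH', norm_neg]
      rw [norm_mul, ex_norm, one_mul, Complex.norm_real]
      exact hb1 t (Ico_subset_Icc_self ht)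
  have h2 : Complex.I * (∫ s in a..b, A s) = H b + ex (P b) * ((χ b * κ b : ℝ) : ℂ) := by simp [hH]
  have h3 : ‖∫ s in a..b, A s‖ = ‖Complex.I * (∫ s in a..b, A s)‖ := by simp
  rw [h3, h2]
  refine (norm_add_le _ _).trans ?_
  have : ‖ex (P b) * ((χ b * κ b : ℝ) : ℂ)‖ ≤ K1 := by
    rw [norm_mul, ex_norm, one_mul, Complex.norm_real]; exact hb b (right_mem_Icc.2 hab)
  linarith

section
variable {c C p0 e : ℝ} {Γ Γ1 Γ2 Γ3 : ℝ → ℝ} {α β ζ χ χ1 : ℝ → ℝ} {Q : ℝ}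

lemma aE_meas {χ ζ Γ1 : ℝ → ℝ} (h1 : Measurable χ) (h2 : Measurable ζ) (h3 : Measurable Γ1) (u0 B : ℝ) : Measurable (Function.uncurry (aE χ ζ Γ1 u0 B)) := by
  unfold aE Function.uncurry
  have : Measurable fun z : (ℝ × ℝ) × ℝ => χ z.2 := h1.comp measurable_snd
  have : Measurable fun z : (ℝ × ℝ) × ℝ => ζ ((z.1.1 + u0 * z.1.2 * Γ1 z.2) / B) := h2.comp (by fun_prop)
  fun_prop

lemma aE_le (hχ : Amp C p0 χ χ1) (hζ : Cut ζ) (Γ1 : ℝ → ℝ) (u0 B : ℝ) (ξ : ℝ × ℝ) {t : ℝ}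
    (ht : t ∈ Icc p0 (p0 + 3/2)) : ‖aE χ ζ Γ1 u0 B ξ t‖ ≤ C := by
  unfold aE
  rw [norm_mul, Complex.norm_real, Complex.norm_real, Real.norm_eq_abs, Real.norm_eq_abs, abs_of_nonneg (by linarith [hζ.l ((ξ.1 + u0 * ξ.2 * Γ1 t) / B)] : 0 ≤ 1 - ζ ((ξ.1 + u0 * ξ.2 * Γ1 t) / B))]
  nlinarith [hχ.b t ht, hζ.l ((ξ.1 + u0 * ξ.2 * Γ1 t) / B), hζ.n ((ξ.1 + u0 * ξ.2 * Γ1 t) / B), abs_nonneg (χ t)]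

lemma E_bound (h : Curve c C p0 e Γ Γ1 Γ2 Γ3) (hζ : Cut ζ) (hχ : Amp C p0 χ χ1) {D : ℝ} (hD : ∀ x, |deriv ζ x| ≤ D)
    {u0 u B : ℝ} (hu0 : 1 ≤ u0) (hu : 0 ≤ u) (hu2 : u ≤ 2 * u0) (hB : 0 < B) {ξ : ℝ × ℝ} (hξ : |u - u0| * |ξ.2| * C ≤ B / 4) :
    ‖GS Γ (Ioc p0 (p0 + 3/2)) (aE χ ζ Γ1 u0 B) u ξ‖ ≤ C * (200 + 32 * D) / B := by
  have hC := h.hC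
  have hD0 : 0 ≤ D := (abs_nonneg _).trans (hD 0)
  have hle : p0 ≤ p0 + 3/2 := by linarith
  set X : ℝ → ℝ := fun t => ξ.1 + u0 * ξ.2 * Γ1 t with hX
  set Y : ℝ → ℝ := fun t => ξ.1 + ξ.2 * u * Γ1 t with hY
  set κ : ℝ → ℝ := fun t => (1 - ζ (X t / B)) / Y t with hκ
  set κ1 : ℝ → ℝ := fun t => (-(deriv ζ (X t / B) * (u0 * ξ.2 * Γ2 t / B)) * Y t - (1 - ζ (X t / B)) * (ξ.2 * u * Γ2 t)) / Y t ^ 2 with hκ1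
  have hXd : ∀ t ∈ Icc p0 (p0 + 3/2), HasDerivAt X (u0 * ξ.2 * Γ2 t) t := fun t ht => ((h.d1 t ht).const_mul _).const_add _
  have hYd : ∀ t ∈ Icc p0 (p0 + 3/2), HasDerivAt Y (ξ.2 * u * Γ2 t) t := fun t ht => ((h.d1 t ht).const_mul _).const_add _
  have hPd : ∀ t ∈ Icc p0 (p0 + 3/2), HasDerivAt (ph Γ u ξ) (Y t) t := by
    intro t ht
    have := ((hasDerivAt_id t).const_mul ξ.1).add ((h.d0 t ht).const_mul (ξ.2 * u))
    refine this.congr_deriv ?_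
    simp [hY]
  have hζd : ∀ x, HasDerivAt ζ (deriv ζ x) x := fun x => (hζ.s.differentiable (by simp) x).hasDerivAt
  have hXY : ∀ t ∈ Icc p0 (p0 + 3/2), |X t| - B / 4 ≤ |Y t| := by
    intro t ht
    have e1 : X t - Y t = -((u - u0) * ξ.2 * Γ1 t) := by simp only [hX, hY]; ring
    have e2 : |X t - Y t| ≤ B / 4 := by
      rw [e1, abs_neg, abs_mul, abs_mul]
      refine le_trans ?_ hξ
      gcongr; exact h.b1 t ht
    have := abs_sub_abs_le_abs_sub (X t) (Y t)
    linarith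
  have hz1 : ∀ t, |X t| ≤ B / 2 → ζ (X t / B) = 1 := by
    intro t ht; apply hζ.o; rw [abs_div, abs_of_pos hB, div_le_iff₀ hB]; linarith
  have hzd : ∀ t, |X t| < B / 2 → deriv ζ (X t / B) = 0 := by
    intro t ht
    have : |X t / B| < 1/2 := by rw [abs_div, abs_of_pos hB, div_lt_iff₀ hB]; linarith
    have h2 : ζ =ᶠ[nhds (X t / B)] fun _ => 1 := by
      filter_upwards [continuous_abs.continuousAt.eventually_lt continuousAt_const this] with x hx
      exact hζ.o x hx.le
    rw [h2.deriv_eq]; simp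
  have hzd2 : ∀ t, B < |X t| → deriv ζ (X t / B) = 0 := by
    intro t ht
    have : 1 < |X t / B| := by rw [abs_div, abs_of_pos hB, lt_div_iff₀ hB]; linarith
    have h2 : ζ =ᶠ[nhds (X t / B)] fun _ => 0 := by
      filter_upwards [continuousAt_const.eventually_lt continuous_abs.continuousAt this] with x hx
      exact hζ.z x hx.le
    rw [h2.deriv_eq]; simp
  have hκd : ∀ t ∈ Icc p0 (p0 + 3/2), HasDerivAt κ (κ1 t) t := by
    intro t ht
    rcases lt_or_ge (|X t|) (B / 2) with hlt | hge
    · have e1 : κ1 t = 0 := by simp only [hκ1, hz1 t hlt.le, hzd t hlt]; simp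
      rw [e1]
      refine (hasDerivAt_const t (0:ℝ)).congr_of_eventuallyEq ?_
      filter_upwards [(hXd t ht).continuousAt.abs.eventually_lt continuousAt_const hlt] with s hs
      simp [hκ, hz1 s hs.le]
    · have hYne : Y t ≠ 0 := by
        have := hXY t ht
        intro h0; rw [h0, abs_zero] at this; linarith
      have d1 := (((hζd (X t / B)).comp t ((hXd t ht).div_const B)).const_sub 1).div (hYd t ht) hYne
      exact d1
  have hκb : ∀ t ∈ Icc p0 (p0 + 3/2), |κ t| ≤ 4 / B := by
    intro t ht
    rcases lt_or_ge (|X t|) (B / 2) with hlt | hge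
    · simp only [hκ, hz1 t hlt.le]; simp; positivity
    · have h1 := hXY t ht
      simp only [hκ]
      rw [abs_div, abs_of_nonneg (by linarith [hζ.l (X t / B)])]
      have : B / 4 ≤ |Y t| := by linarith
      rw [div_le_div_iff₀ (by linarith) hB]
      have h2 := hζ.n (X t / B)
      have h3 := hζ.l (X t / B)
      nlinarith
  have hκ1b : ∀ t ∈ Icc p0 (p0 + 3/2), |κ1 t| ≤ (8 * D + 40) * (|u0 * ξ.2 * Γ2 t| / (B ^ 2 + X t ^ 2)) := by
    intro t ht
    rcases lt_or_ge (|X t|) (B / 2) with hlt | hge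
    · have e1 : κ1 t = 0 := by simp only [hκ1, hz1 t hlt.le, hzd t hlt]; simp
      rw [e1, abs_zero]; positivity
    · have h1 := hXY t ht
      set W := |u0 * ξ.2 * Γ2 t| with hW
      have hW0 : 0 ≤ W := abs_nonneg _
      have hY0 : 0 < |Y t| := by linarith
      have hX2 : X t ^ 2 = |X t| ^ 2 := (sq_abs _).symm
      have hden : 0 < B ^ 2 + X t ^ 2 := by positivity
      have t1 : |deriv ζ (X t / B)| * (W / B) / |Y t| ≤ 8 * D * (W / (B ^ 2 + X t ^ 2)) := by
        rcases le_or_gt (|X t|) B with hXB | hXB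
        · have : 1 / (B * |Y t|) ≤ 8 / (B ^ 2 + X t ^ 2) := by
            rw [div_le_div_iff₀ (by positivity) hden, hX2]
            nlinarith [abs_nonneg (X t)]
          calc |deriv ζ (X t / B)| * (W / B) / |Y t| = |deriv ζ (X t / B)| * W * (1 / (B * |Y t|)) := by field_simp
            _ ≤ D * W * (8 / (B ^ 2 + X t ^ 2)) := by gcongr; exact hD _
            _ = _ := by ring
        · rw [hzd2 t hXB]; simp; positivity
      have t2 : (1 - ζ (X t / B)) * (2 * W) / |Y t| ^ 2 ≤ 40 * (W / (B ^ 2 + X t ^ 2)) := by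
        have h5 : |X t| / 2 ≤ |Y t| := by linarith
        have h7 : (|X t| / 2) ^ 2 ≤ |Y t| ^ 2 := by gcongr
        have h6 : 1 / |Y t| ^ 2 ≤ 20 / (B ^ 2 + X t ^ 2) := by
          rw [div_le_div_iff₀ (by positivity) hden, hX2]
          nlinarith
        calc (1 - ζ (X t / B)) * (2 * W) / |Y t| ^ 2 = (1 - ζ (X t / B)) * ((2 * W) * (1 / |Y t| ^ 2)) := by ring
          _ ≤ 1 * ((2 * W) * (20 / (B ^ 2 + X t ^ 2))) := by
            gcongr
            linarith [hζ.n (X t / B)]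
          _ = _ := by ring
      have hYW : |ξ.2 * u * Γ2 t| ≤ 2 * W := by
        rw [hW, abs_mul, abs_mul, abs_mul, abs_mul, abs_of_nonneg hu, abs_of_nonneg (by linarith : 0 ≤ u0)]
        calc |ξ.2| * u * |Γ2 t| ≤ |ξ.2| * (2 * u0) * |Γ2 t| := by gcongr
          _ = _ := by ring
      have hl := hζ.l (X t / B)
      calc |κ1 t| = |-(deriv ζ (X t / B) * (u0 * ξ.2 * Γ2 t / B)) * Y t - (1 - ζ (X t / B)) * (ξ.2 * u * Γ2 t)| / |Y t| ^ 2 := by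
            simp only [hκ1]; rw [abs_div, abs_pow]
        _ ≤ (|deriv ζ (X t / B)| * (W / B) * |Y t| + (1 - ζ (X t / B)) * (2 * W)) / |Y t| ^ 2 := by
            gcongr
            refine (abs_sub _ _).trans ?_
            rw [abs_mul, abs_neg, abs_mul, abs_div, abs_of_pos hB, abs_mul (1 - _), abs_of_nonneg (by linarith : 0 ≤ 1 - ζ (X t / B))]
            gcongr
        _ = |deriv ζ (X t / B)| * (W / B) / |Y t| + (1 - ζ (X t / B)) * (2 * W) / |Y t| ^ 2 := by field_simp
        _ ≤ _ := by linarith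
  -- sign
  obtain ⟨σ, hσ, hσX⟩ : ∃ σ : ℝ, |σ| = 1 ∧ ∀ t ∈ Icc p0 (p0 + 3/2), |u0 * ξ.2 * Γ2 t| = σ * (u0 * ξ.2 * Γ2 t) := by
    have hG : ∀ t ∈ Icc p0 (p0 + 3/2), |Γ2 t| = e * Γ2 t := by
      intro t ht
      have := abs_of_pos (h.hc.trans_le (h.lo t ht))
      rwa [abs_mul, h.eabs, one_mul] at this
    rcases le_total 0 ξ.2 with h0 | h0
    · refine ⟨e, h.eabs, fun t ht => ?_⟩
      rw [abs_mul, hG t ht, abs_of_nonneg (by positivity)]; ring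
    · refine ⟨-e, by rw [abs_neg, h.eabs], fun t ht => ?_⟩
      rw [abs_mul, hG t ht, abs_mul, abs_of_nonpos h0, abs_of_nonneg (by linarith : 0 ≤ u0)]; ring
  set V : ℝ → ℝ := fun t => 4 * C / B * t + C * (8 * D + 40) * (σ / B * Real.arctan (X t / B)) with hV
  have hVd : ∀ t ∈ Icc p0 (p0 + 3/2), HasDerivAt V (4 * C / B * 1 + C * (8 * D + 40) * (σ / B * (1 / (1 + (X t / B) ^ 2) * (u0 * ξ.2 * Γ2 t / B)))) t := fun t ht =>
    ((hasDerivAt_id t).const_mul _).add ((((hXd t ht).div_const B).arctan.const_mul _).const_mul _)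
  have haem := (aE_meas hχ.m hζ.s.continuous.measurable h.m1 u0 B).comp (measurable_const (a := ξ) |>.prodMk measurable_id)
  have hAm : Measurable (fun t => ex (ph Γ u ξ t) * aE χ ζ Γ1 u0 B ξ t) := (ex_meas.comp ((ph_meas h.m0 u).comp (measurable_const (a := ξ) |>.prodMk measurable_id))).mul haem
  have main := ibp_bound (K1 := 4 * C / B) hle (χ := χ) (Y := Y) (P := ph Γ u ξ) (κ := κ) (V := V) hAm ?_ ?_ ?_ hPd hχ.d hκd hVd ?_ ?_
  · rw [GS, ← intervalIntegral.integral_of_le hle]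
    refine main.trans ?_
    have hat : ∀ x, |Real.arctan x| ≤ 2 := fun x => abs_le.2 ⟨by linarith [Real.neg_pi_div_two_lt_arctan x, Real.pi_le_four], by linarith [Real.arctan_lt_pi_div_two x, Real.pi_le_four]⟩
    have hσ2 : σ * Real.arctan (X (p0 + 3/2) / B) - σ * Real.arctan (X p0 / B) ≤ 4 := by
      have e1 := le_abs_self (σ * Real.arctan (X (p0 + 3/2) / B))
      have e2 := neg_abs_le (σ * Real.arctan (X p0 / B))
      rw [abs_mul, hσ, one_mul] at e1 e2
      have := hat (X (p0 + 3/2) / B)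
      have := hat (X p0 / B)
      linarith
    calc 2 * (4 * C / B) + (V (p0 + 3/2) - V p0) = (C * 14 + C * (8 * D + 40) * (σ * Real.arctan (X (p0 + 3/2) / B) - σ * Real.arctan (X p0 / B))) / B := by
          simp only [hV]; field_simp; ring
      _ ≤ (C * 14 + C * (8 * D + 40) * 4) / B := by gcongr
      _ ≤ _ := by gcongr; nlinarith
  · rw [intervalIntegrable_iff_integrableOn_Ioc_of_le hle]
    refine Measure.integrableOn_of_bounded (M := C) (by simp) hAm.aestronglyMeasurable ?_
    filter_upwards [ae_restrict_mem measurableSet_Ioc] with t ht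
    rw [norm_mul, ex_norm, one_mul]; exact aE_le hχ hζ Γ1 u0 B ξ (Ioc_subset_Icc_self ht)
  · intro t ht
    have : Y t * κ t = 1 - ζ (X t / B) := by
      by_cases h0 : Y t = 0
      · have h1 := hXY t ht
        rw [h0, abs_zero] at h1
        rw [h0, zero_mul, hz1 t (by linarith), sub_self]
      · simp only [hκ]; field_simp
    rw [this]; unfold aE; push_cast; rfl
  · intro t ht
    have c1 := (hPd t ht).continuousAt
    have c2 := (hχ.d t ht).continuousAt
    have c3 : ContinuousAt (fun t => ζ (X t / B)) t := hζ.s.continuous.continuousAt.comp ((hXd t ht).continuousAt.div_const B)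
    have c4 : ContinuousAt (fun t => ex (ph Γ u ξ t)) t := ex_cont.continuousAt.comp c1
    unfold aE
    exact c4.mul ((Complex.continuous_ofReal.continuousAt.comp c2).mul (Complex.continuous_ofReal.continuousAt.comp (continuousAt_const.sub c3)))
  · intro t ht
    rw [abs_mul]
    calc |χ t| * |κ t| ≤ C * (4 / B) := mul_le_mul (hχ.b t ht) (hκb t ht) (abs_nonneg _) (by linarith)
      _ = _ := by ring
  · intro t ht
    refine (abs_add_le _ _).trans ?_
    rw [abs_mul, abs_mul]
    have e1 : σ / B * (1 / (1 + (X t / B) ^ 2) * (u0 * ξ.2 * Γ2 t / B)) = |u0 * ξ.2 * Γ2 t| / (B ^ 2 + X t ^ 2) := by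
      rw [hσX t ht]; field_simp
    rw [e1]
    have e2 := mul_le_mul (hχ.b1 t ht) (hκb t ht) (abs_nonneg _) (by linarith)
    have e3 := mul_le_mul (hχ.b t ht) (hκ1b t ht) (abs_nonneg _) (by linarith)
    calc _ ≤ _ := add_le_add e2 e3
      _ = _ := by ring

lemma E_marc (h : Curve c C p0 e Γ Γ1 Γ2 Γ3) (hk : Ker α β ζ Q) (hχ : Amp C p0 χ χ1) {D : ℝ} (hD : ∀ x, |deriv ζ x| ≤ D)
    {lam u0 u n : ℝ} (hn : 1 ≤ n) (hl : 0 < lam) (hu0 : 1 ≤ u0) (hu : u ∈ Icc u0 (u0 + 1 / n)) {f : ℝ × ℝ → ℂ} (hf : Cls f) :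
    ∫⁻ x, ‖op (fun ξ => mul0 α β lam ξ * GS Γ (Ioc p0 (p0 + 3/2)) (aE χ ζ Γ1 u0 (16 * C * lam / n)) u ξ) f x‖ₑ ^ 6
      ≤ 96 * ENNReal.ofReal ((Q * (200 + 32 * D) * (n / lam)) ^ 2) * ENNReal.ofReal ((C * Q * (1 + Q) * 2) ^ 4) * ∫⁻ x, ‖f x‖ₑ ^ 6 := by
  have hC := h.hC
  have hQ := hk.hQ
  have hD0 : 0 ≤ D := (abs_nonneg _).trans (hD 0)
  have hn0 : 0 < n := by linarith
  set B := 16 * C * lam / n with hBd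
  have hB : 0 < B := by positivity
  have hm0 := mul0_cls hk.sa hk.ca hk.sb hk.cb hl
  have hae := aE_meas hχ.m hk.cut.s.continuous.measurable h.m1 u0 B
  have hvf : volume (Ioc p0 (p0 + 3/2)) < ⊤ := by simp
  have hGSb := GS_le (Γ := Γ) hvf (fun ξ t ht => aE_le hχ hk.cut Γ1 u0 B ξ (Ioc_subset_Icc_self ht)) u
  have key := op_marc (ι := Unit) (fun _ ξ => mul0 α β lam ξ * GS Γ (Ioc p0 (p0 + 3/2)) (aE χ ζ Γ1 u0 B) u ξ) (fun _ => hm0.mul_bdd (GS_meas h.m0 hae u) hGSb)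
    (a := Q * (200 + 32 * D) * (n / lam)) (A := C * Q * (1 + Q) * 2) (by positivity) (by positivity) ?_ ?_ hf
  · simpa using key
  · intro ξ
    simp only [Finset.univ_unique, Finset.sum_singleton]
    gcongr
    by_cases h0 : mul0 α β lam ξ = 0
    · simp only [h0, zero_mul, norm_zero]; positivity
    have hup := hk.up' hl h0
    have h1n : 1 / n ≤ 1 := by rw [div_le_one hn0]; exact hn
    have := E_bound h hk.cut hχ hD (u0 := u0) (u := u) hu0 (by linarith [hu.1]) (by linarith [hu.2]) hB (ξ := ξ) (by
      have : |u - u0| ≤ 1 / n := by rw [abs_of_nonneg (by linarith [hu.1])]; linarith [hu.2]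
      calc |u - u0| * |ξ.2| * C ≤ 1 / n * (4 * lam) * C := by gcongr
        _ = B / 4 := by rw [hBd]; ring)
    rw [norm_mul]
    calc _ ≤ Q * (C * (200 + 32 * D) / B) := mul_le_mul (hk.bd _ _) this (norm_nonneg _) (by linarith)
      _ = Q * (200 + 32 * D) * (n / lam) / 16 := by rw [hBd]; field_simp
      _ ≤ _ := by
        have : 0 ≤ Q * (200 + 32 * D) * (n / lam) := by positivity
        linarith
  · intro _ f M hf hM0 hM x
    have := op_t hm0 hf h.m0 measurableSet_Ioc hvf hae (fun ξ t ht => aE_le hχ hk.cut Γ1 u0 B ξ (Ioc_subset_Icc_self ht)) u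
      (Q := C * (Q * ((1 + Q) * M))) (fun t ht x => ?_) x
    · refine this.trans ?_
      rw [Real.volume_real_Ioc_of_le (by linarith)]
      have : 0 ≤ C * Q * (1 + Q) * M := by positivity
      nlinarith
    · have e1 : op (fun ξ => mul0 α β lam ξ * aE χ ζ Γ1 u0 B ξ t) f x = (χ t : ℂ) * op (mul0 α β lam) f x - op (fun ξ => mul0 α β lam ξ * aF χ ζ Γ1 u0 B ξ t) f x := by
        rw [← op_smul]
        simp only [op_eq]
        rw [← integral_sub]
        · congr 1; ext ξ; unfold aE aF; push_cast; ring
        · have hc : Cls (fun ξ => mul0 α β lam ξ * (χ t : ℂ)) := hm0.mul_bdd measurable_const (fun _ => le_rfl)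
          exact ((hc.mul_ft hf).i.bdd_mul (c := 1) (ex_meas.comp (pr_meas2 x)).aestronglyMeasurable (ae_of_all _ fun ξ => (ex_norm _).le))
        · have hc : Cls (fun ξ => mul0 α β lam ξ * aF χ ζ Γ1 u0 B ξ t) := hm0.mul_bdd ((aF_meas hχ.m hk.cut.s.continuous.measurable h.m1 u0 B).comp (measurable_id.prodMk measurable_const)) (fun ξ => aF_le hχ hk.cut Γ1 u0 B ξ (Ioc_subset_Icc_self ht))
          exact ((hc.mul_ft hf).i.bdd_mul (c := 1) (ex_meas.comp (pr_meas2 x)).aestronglyMeasurable (ae_of_all _ fun ξ => (ex_norm _).le))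
      rw [e1]
      refine (norm_sub_le _ _).trans ?_
      have e2 := F_inf0 (Γ1 := Γ1) (u0 := u0) (B := B) hk hχ hl hf hM0 hM (Ioc_subset_Icc_self ht) x
      have e3 : ‖(χ t : ℂ) * op (mul0 α β lam) f x‖ ≤ C * (Q * M) := by
        rw [norm_mul, Complex.norm_real]
        exact mul_le_mul (hχ.b t (Ioc_subset_Icc_self ht)) (hk.inf lam hl f M hf hM0 hM x) (norm_nonneg _) (by linarith)
      calc _ ≤ _ := add_le_add e3 e2
        _ = _ := by ring
end

noncomputable def TT (α β : ℝ → ℝ) (lam : ℝ) (Γ : ℝ → ℝ) (S : Set ℝ) (χ : ℝ → ℝ) (f : ℝ × ℝ → ℂ) (y : (ℝ × ℝ) × ℝ) : ℂ :=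
  op (fun ξ => mul0 α β lam ξ * GS Γ S (fun _ t => (χ t : ℂ)) y.2 ξ) f y.1

lemma six_add (a b : ℂ) : ‖a + b‖ₑ ^ 6 ≤ 32 * (‖a‖ₑ ^ 6 + ‖b‖ₑ ^ 6) := by
  refine (pow_le_pow_left' (enorm_add_le a b) 6).trans ?_
  have := ENNReal.rpow_add_le_mul_rpow_add_rpow ‖a‖ₑ ‖b‖ₑ (p := 6) (by norm_num)
  norm_num at this
  exact_mod_cast this

section
variable {c C p0 e : ℝ} {Γ Γ1 Γ2 Γ3 : ℝ → ℝ} {α β ζ χ χ1 : ℝ → ℝ} {Q : ℝ}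

lemma GS_int (h : Curve c C p0 e Γ Γ1 Γ2 Γ3) {a : ℝ × ℝ → ℝ → ℂ} (ha : Measurable (Function.uncurry a)) (hb : ∀ ξ, ∀ t ∈ Icc p0 (p0 + 3/2), ‖a ξ t‖ ≤ C) (u ξ) :
    IntegrableOn (fun t => ex (ph Γ u ξ t) * a ξ t) (Ioc p0 (p0 + 3/2)) := by
  refine Measure.integrableOn_of_bounded (M := C) (by simp) ?_ ?_
  · exact ((ex_meas.comp ((ph_meas h.m0 u).comp (measurable_const (a := ξ) |>.prodMk measurable_id))).mul (ha.comp (measurable_const (a := ξ) |>.prodMk measurable_id))).aestronglyMeasurable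
  filter_upwards [ae_restrict_mem measurableSet_Ioc] with t ht
  rw [norm_mul, ex_norm, one_mul]; exact hb ξ t (Ioc_subset_Icc_self ht)

lemma op_add_mul {m1 m2 f : ℝ × ℝ → ℂ} (h1 : Cls m1) (h2 : Cls m2) (hf : Cls f) (x) : op (fun ξ => m1 ξ + m2 ξ) f x = op m1 f x + op m2 f x := by
  simp only [op_eq]
  rw [← integral_add]
  · congr 1; ext ξ; ring
  · exact ((h1.mul_ft hf).i.bdd_mul (c := 1) (ex_meas.comp (pr_meas2 x)).aestronglyMeasurable (ae_of_all _ fun ξ => (ex_norm _).le))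
  · exact ((h2.mul_ft hf).i.bdd_mul (c := 1) (ex_meas.comp (pr_meas2 x)).aestronglyMeasurable (ae_of_all _ fun ξ => (ex_norm _).le))

lemma chi_meas (hχ : Amp C p0 χ χ1) : Measurable (Function.uncurry (fun (_ : ℝ × ℝ) t => (χ t : ℂ))) := by
  have : Measurable fun z : (ℝ × ℝ) × ℝ => χ z.2 := hχ.m.comp measurable_snd
  exact Complex.measurable_ofReal.comp this

lemma chi_bd (hχ : Amp C p0 χ χ1) (ξ : ℝ × ℝ) (t) (ht : t ∈ Icc p0 (p0 + 3/2)) : ‖(fun (_ : ℝ × ℝ) t => (χ t : ℂ)) ξ t‖ ≤ C := by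
  simp only [Complex.norm_real]; exact hχ.b t ht

lemma TT_meas (h : Curve c C p0 e Γ Γ1 Γ2 Γ3) (hk : Ker α β ζ Q) (hχ : Amp C p0 χ χ1) {lam : ℝ} (hl : 0 < lam) {f : ℝ × ℝ → ℂ} (hf : Cls f) :
    Measurable (TT α β lam Γ (Ioc p0 (p0 + 3/2)) χ f) := by
  have e1 : TT α β lam Γ (Ioc p0 (p0 + 3/2)) χ f = FF Γ (AA Γ (mul0 α β lam) f (fun _ t => (χ t : ℂ)) 0 (Ioc p0 (p0 + 3/2))) (Ioc p0 (p0 + 3/2)) := by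
    ext y
    rw [FF_op h.m0 (mul0_cls hk.sa hk.ca hk.sb hk.cb hl) hf (chi_meas hχ) measurableSet_Ioc (by simp) (fun ξ t ht => chi_bd hχ ξ t (Ioc_subset_Icc_self ht)) 0 measurableSet_Ioc subset_rfl, zero_add]
    rfl
  rw [e1]
  exact FF_meas h.m0 (AA_meas h.m0 (mul0_cls hk.sa hk.ca hk.sb hk.cb hl) hf (chi_meas hχ) measurableSet_Ioc 0) measurableSet_Ioc

lemma TT_interval (h : Curve c C p0 e Γ Γ1 Γ2 Γ3) (hk : Ker α β ζ Q) (hχ : Amp C p0 χ χ1) {D : ℝ} (hD : ∀ x, |deriv ζ x| ≤ D)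
    {lam u0 n : ℝ} (hn : 1 ≤ n) (hl : 0 < lam) (hu : 1 ≤ u0) {f : ℝ × ℝ → ℂ} (hf : Cls f) {X : ℝ≥0∞}
    (hF : ∫⁻ y in univ ×ˢ Icc 0 (1 / n), ‖op (fun ξ => mul0 α β lam ξ * GS Γ (Ioc p0 (p0 + 3/2)) (aF χ ζ Γ1 u0 (16 * C * lam / n)) (u0 + y.2) ξ) f y.1‖ₑ ^ 6 ≤ X) :
    ∫⁻ v in Icc 0 (1 / n), ∫⁻ x, ‖TT α β lam Γ (Ioc p0 (p0 + 3/2)) χ f (x, u0 + v)‖ₑ ^ 6 ≤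
      32 * (X + ENNReal.ofReal (1 / n) * (96 * ENNReal.ofReal ((Q * (200 + 32 * D) * (n / lam)) ^ 2) * ENNReal.ofReal ((C * Q * (1 + Q) * 2) ^ 4) * ∫⁻ x, ‖f x‖ₑ ^ 6)) := by
  set B := 16 * C * lam / n with hB
  set I0 := Ioc p0 (p0 + 3/2) with hI0
  have hm0 := mul0_cls hk.sa hk.ca hk.sb hk.cb hl
  have haf := aF_meas hχ.m hk.cut.s.continuous.measurable h.m1 u0 B
  have hae := aE_meas hχ.m hk.cut.s.continuous.measurable h.m1 u0 B
  have hvf : volume I0 < ⊤ := by simp [hI0]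
  have haFb : ∀ ξ, ∀ t ∈ Icc p0 (p0 + 3/2), ‖aF χ ζ Γ1 u0 B ξ t‖ ≤ C := fun ξ t ht => aF_le hχ hk.cut Γ1 u0 B ξ ht
  have haEb : ∀ ξ, ∀ t ∈ Icc p0 (p0 + 3/2), ‖aE χ ζ Γ1 u0 B ξ t‖ ≤ C := fun ξ t ht => aE_le hχ hk.cut Γ1 u0 B ξ ht
  have hFm : Measurable fun y : (ℝ × ℝ) × ℝ => op (fun ξ => mul0 α β lam ξ * GS Γ I0 (aF χ ζ Γ1 u0 B) (u0 + y.2) ξ) f y.1 := by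
    have := FF_meas (S := I0) h.m0 (AA_meas h.m0 hm0 hf haf (measurableSet_Ioc (a := p0) (b := p0 + 3/2)) u0) measurableSet_Ioc
    convert this using 2 with y
    rw [FF_op h.m0 hm0 hf haf measurableSet_Ioc hvf (fun ξ t ht => haFb ξ t (Ioc_subset_Icc_self ht)) u0 measurableSet_Ioc subset_rfl]
  have hdecomp : ∀ v x, TT α β lam Γ I0 χ f (x, u0 + v) = op (fun ξ => mul0 α β lam ξ * GS Γ I0 (aF χ ζ Γ1 u0 B) (u0 + v) ξ) f x +
      op (fun ξ => mul0 α β lam ξ * GS Γ I0 (aE χ ζ Γ1 u0 B) (u0 + v) ξ) f x := by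
    intro v x
    rw [← op_add_mul (hm0.mul_bdd (GS_meas h.m0 haf _) (GS_le hvf (fun ξ t ht => haFb ξ t (Ioc_subset_Icc_self ht)) _)) (hm0.mul_bdd (GS_meas h.m0 hae _) (GS_le hvf (fun ξ t ht => haEb ξ t (Ioc_subset_Icc_self ht)) _)) hf]
    unfold TT
    congr 1; ext ξ
    rw [← mul_add]; congr 1
    unfold GS
    rw [← integral_add (GS_int h haf haFb _ _) (GS_int h hae haEb _ _)]
    congr 1; ext t; unfold aF aE; push_cast; ring
  have step : ∀ v ∈ Icc 0 (1/n), ∫⁻ x, ‖TT α β lam Γ I0 χ f (x, u0 + v)‖ₑ ^ 6 ≤ 32 * ((∫⁻ x, ‖op (fun ξ => mul0 α β lam ξ * GS Γ I0 (aF χ ζ Γ1 u0 B) (u0 + v) ξ) f x‖ₑ ^ 6) +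
      (96 * ENNReal.ofReal ((Q * (200 + 32 * D) * (n / lam)) ^ 2) * ENNReal.ofReal ((C * Q * (1 + Q) * 2) ^ 4) * ∫⁻ x, ‖f x‖ₑ ^ 6)) := by
    intro v hv
    have hm1 : Measurable fun x => ‖op (fun ξ => mul0 α β lam ξ * GS Γ I0 (aF χ ζ Γ1 u0 B) (u0 + v) ξ) f x‖ₑ ^ 6 := 
      ((hFm.comp (measurable_id.prodMk (measurable_const (a := v)))).enorm.pow_const 6)
    calc _ ≤ ∫⁻ x, 32 * (‖op (fun ξ => mul0 α β lam ξ * GS Γ I0 (aF χ ζ Γ1 u0 B) (u0 + v) ξ) f x‖ₑ ^ 6 + ‖op (fun ξ => mul0 α β lam ξ * GS Γ I0 (aE χ ζ Γ1 u0 B) (u0 + v) ξ) f x‖ₑ ^ 6) := by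
          refine lintegral_mono fun x => ?_
          rw [hdecomp]; exact six_add _ _
      _ = 32 * ((∫⁻ x, ‖op (fun ξ => mul0 α β lam ξ * GS Γ I0 (aF χ ζ Γ1 u0 B) (u0 + v) ξ) f x‖ₑ ^ 6) + ∫⁻ x, ‖op (fun ξ => mul0 α β lam ξ * GS Γ I0 (aE χ ζ Γ1 u0 B) (u0 + v) ξ) f x‖ₑ ^ 6) := by
          rw [lintegral_const_mul' _ _ (by simp), lintegral_add_left hm1]
      _ ≤ _ := by
          gcongr
          exact E_marc h hk hχ hD hn hl hu ⟨by linarith [hv.1], by linarith [hv.2]⟩ hf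
  refine (setLIntegral_mono' measurableSet_Icc step).trans ?_
  rw [lintegral_const_mul' _ _ (by simp), lintegral_add_right _ measurable_const, setLIntegral_const, Real.volume_Icc, sub_zero, mul_comm (96 * _ * _ * _)]
  gcongr
  refine le_trans (le_of_eq ?_) hF
  have hv : (volume : Measure ((ℝ × ℝ) × ℝ)).restrict (univ ×ˢ Icc 0 (1/n)) = (volume : Measure (ℝ × ℝ)).prod ((volume : Measure ℝ).restrict (Icc 0 (1/n))) := by
    rw [Measure.volume_eq_prod (ℝ × ℝ) ℝ, ← Measure.prod_restrict, Measure.restrict_univ]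
  rw [hv, lintegral_prod_symm _ (hFm.enorm.pow_const 6).aemeasurable]

lemma split_intervals {g : ℝ → ℝ≥0∞} {n : ℕ} (hn : 1 ≤ n) {Y : ℝ≥0∞}
    (h : ∀ i < n, ∫⁻ v in Icc (0:ℝ) (1 / n), g ((1 + i / n) + v) ≤ Y) : ∫⁻ v in Icc (1:ℝ) 2, g v ≤ n * Y := by
  have hn0 : (0:ℝ) < n := by exact_mod_cast hn
  have hsub : Icc (1:ℝ) 2 ⊆ ⋃ i : Fin n, Icc (1 + (i:ℝ) / n) (1 + (i:ℝ) / n + 1 / n) := by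
    intro v hv
    rw [mem_iUnion]
    rcases eq_or_lt_of_le hv.2 with h2 | h2
    · refine ⟨⟨n - 1, by omega⟩, ?_⟩
      rw [h2]
      simp only [Nat.cast_sub hn, Nat.cast_one]
      constructor
      · rw [_root_.sub_div, div_self hn0.ne']; have : 0 < 1 / (n:ℝ) := by positivity
        linarith
      · rw [_root_.sub_div, div_self hn0.ne']; linarith
    · have hv0 : 0 ≤ (v - 1) * n := mul_nonneg (by linarith [hv.1]) hn0.le
      refine ⟨⟨⌊(v - 1) * n⌋₊, ?_⟩, ?_⟩
      · rw [Nat.floor_lt hv0]; nlinarith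
      · have h3 := Nat.floor_le hv0
        have h4 := Nat.lt_floor_add_one ((v - 1) * n)
        constructor
        · simp only
          rw [← le_sub_iff_add_le', div_le_iff₀ hn0]; exact h3
        · simp only
          rw [add_assoc, ← sub_le_iff_le_add', ← add_div, le_div_iff₀ hn0]; exact h4.le
  calc _ ≤ ∫⁻ v in ⋃ i : Fin n, Icc (1 + (i:ℝ) / n) (1 + (i:ℝ) / n + 1 / n), g v := lintegral_mono_set hsub
    _ ≤ ∑' i : Fin n, ∫⁻ v in Icc (1 + (i:ℝ) / n) (1 + (i:ℝ) / n + 1 / n), g v := lintegral_iUnion_le _ _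
    _ = ∑ i : Fin n, ∫⁻ v in Icc (1 + (i:ℝ) / n) (1 + (i:ℝ) / n + 1 / n), g v := tsum_fintype _
    _ ≤ ∑ i : Fin n, Y := by
        refine Finset.sum_le_sum fun i _ => ?_
        refine le_trans (le_of_eq ?_) (h i i.2)
        have := (measurePreserving_add_left volume (1 + (i:ℝ) / n)).setLIntegral_comp_preimage_emb (MeasurableEquiv.addLeft (1 + (i:ℝ) / n)).measurableEmbedding g (Icc (1 + (i:ℝ) / n) (1 + (i:ℝ) / n + 1 / n))
        rw [← this]
        congr 2
        ext v; simp
    _ = n * Y := by simp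

lemma ofReal_aux (n : ℕ) {F z x y : ℝ} (hF : 0 ≤ F) (hz : 0 ≤ z) (hx : 0 ≤ x) (hy : 0 ≤ y) (I : ℝ≥0∞) :
    (n:ℝ≥0∞) * (32 * (ENNReal.ofReal F * I + ENNReal.ofReal z * (96 * ENNReal.ofReal x * ENNReal.ofReal y * I))) = ENNReal.ofReal (n * (32 * (F + z * (96 * x * y)))) * I := by
  rw [ENNReal.ofReal_mul (by positivity), ENNReal.ofReal_mul (by positivity), ENNReal.ofReal_add hF (by positivity), ENNReal.ofReal_mul hz, ENNReal.ofReal_mul (by positivity), ENNReal.ofReal_mul (by positivity), ENNReal.ofReal_natCast]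
  rw [show ENNReal.ofReal 96 = 96 by simp, show ENNReal.ofReal 32 = 32 by simp]
  ring

noncomputable def PC (c C Q Cw W D : ℝ) (b : ℕ) : ℝ :=
  32 * (Cw ^ 2 * W * (96 * (Q * C * (256 * C / c)) ^ 2 * (C * Q * Q * (3/2)) ^ 4) * 2 ^ (17 * b) + 96 * (Q * (200 + 32 * D)) ^ 2 * (C * Q * (1 + Q) * 2) ^ 4)

theorem piece (h : Curve c C p0 e Γ Γ1 Γ2 Γ3) (hk : Ker α β ζ Q) (hχ : Amp C p0 χ χ1) {D : ℝ} (hD : ∀ x, |deriv ζ x| ≤ D) {w : ℝ → ℝ} {Ω Cw : ℝ} (hw : Wgt w Ω Cw)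
    {b : ℕ} (hb : 1 ≤ b) {r0 : ℝ} (hr0 : 1 / 4 ≤ |r0|) (hr0' : |r0| ≤ 3)
    (hβ : ∀ x, β x ≠ 0 → |x - r0| ≤ 1 / (((2 ^ b) ^ 2 : ℕ):ℝ) ^ 2)
    {C0 : ℝ} {C1 : ℕ} (h1 : C ≤ C0) (h2 : 2 * C ^ 2 / c ^ 2 ≤ C0) (hC0 : 32 * C * (1 + C ^ 2 / c ^ 2) * (Ω + 6 * (16 * C) + 30) ≤ C0)
    (hcount : ∀ {M : ℕ}, 1 ≤ M → ∀ {S H : ℕ → ℝ} {G : ℕ → ℕ → ℝ},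
    CntHyp (c / C ^ 2) C0 M S H G → ∀ {P : Finset (ℕ × ℕ)}, PairOK C0 M S H P → P.card ≤ C1 * M)
    (hC1 : C1 ≤ 2 ^ b) (j : ℕ) {f : ℝ × ℝ → ℂ} (hf : Cls f) :
    ∫⁻ v in Icc (1:ℝ) 2, ∫⁻ x, ‖TT α β (2 ^ j) Γ (Ioc p0 (p0 + 3/2)) χ f (x, v)‖ₑ ^ 6 ≤
      ENNReal.ofReal (PC c C Q Cw (∫ v, w v) D b * (2:ℝ) ^ (-(51 / 50 * (j:ℝ)))) * ∫⁻ x, ‖f x‖ₑ ^ 6 := by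
  have hc := h.hc
  have hC := h.hC
  have hQ := hk.hQ
  have hD0 : 0 ≤ D := (abs_nonneg _).trans (hD 0)
  have hW : 0 ≤ ∫ v, w v := integral_nonneg hw.n
  set W := ∫ v, w v with hWd
  set m : ℕ := 3 * j / (50 * b) with hm
  have hm1 : 50 * (b * m) ≤ 3 * j := by
    have := Nat.div_mul_le_self (3 * j) (50 * b); rw [← hm] at this; linarith
  have hm2 : 3 * j < 50 * (b * m) + 50 * b := by
    have := Nat.lt_div_mul_add (a := 3 * j) (b := 50 * b) (by omega); rw [← hm] at this; linarith
  set n : ℕ := 2 ^ (8 * (b * m)) with hn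
  have hn1 : 1 ≤ n := Nat.one_le_two_pow
  have hnr : (n:ℝ) = 2 ^ (8 * (b * m)) := by rw [hn]; push_cast; rfl
  have hn0 : (0:ℝ) < n := by positivity
  set M : ℕ := (2 ^ b) ^ 2 with hM
  have hM1 : 1 ≤ M := Nat.one_le_pow _ _ (by positivity)
  have hMr : (M:ℝ) = 2 ^ (2 * b) := by rw [hM]; push_cast; rw [← pow_mul]; congr 1; ring
  have hlam : (n:ℝ) ^ 2 ≤ 2 ^ j := by
    rw [hnr, ← pow_mul]; exact pow_le_pow_right₀ (by norm_num) (by omega)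
  have hnm : ((M:ℝ) ^ 2) ^ (2 * m) ≤ n := by
    rw [hMr, hnr, ← pow_mul, ← pow_mul]; apply le_of_eq; congr 1; ring
  set Fc := ((C1 * M * (M ^ 2) ^ 3 : ℕ) : ℝ) ^ m * (Cw ^ 2 * ((1 / (n:ℝ)) * W)) * (96 * (Q * C * (16 * (16 * C) / (c * n))) ^ 2 * (C * Q * Q * (3/2 / ((M:ℝ) ^ 2) ^ m)) ^ 4) with hFc
  have hFc0 : 0 ≤ Fc := by positivity
  have hu : ∀ i : ℕ, 1 ≤ 1 + (i:ℝ) / n := by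
    intro i
    have : 0 ≤ (i:ℝ) / n := by positivity
    linarith
  have key := split_intervals (g := fun v => ∫⁻ x, ‖TT α β (2 ^ j) Γ (Ioc p0 (p0 + 3/2)) χ f (x, v)‖ₑ ^ 6) hn1 (fun i hi => 
    TT_interval h hk hχ hD (lam := 2 ^ j) (u0 := 1 + (i:ℝ) / n) (n := n) (by exact_mod_cast hn1) (by positivity) (hu i) hf
      (F_main h hk hχ hw hM1 (by exact_mod_cast hn1) hlam hr0 hr0' (hu i) (by positivity) hβ h1 h2 hC0 (hcount hM1) m hnm hf))
  refine key.trans ?_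
  have e1 : (n:ℝ≥0∞) * (32 * (ENNReal.ofReal Fc * (∫⁻ x, ‖f x‖ₑ ^ 6) + ENNReal.ofReal (1 / n) * (96 * ENNReal.ofReal ((Q * (200 + 32 * D) * ((n:ℝ) / 2 ^ j)) ^ 2) * ENNReal.ofReal ((C * Q * (1 + Q) * 2) ^ 4) * ∫⁻ x, ‖f x‖ₑ ^ 6)))
      = ENNReal.ofReal (n * (32 * (Fc + 1 / n * (96 * ((Q * (200 + 32 * D) * ((n:ℝ) / 2 ^ j)) ^ 2) * (C * Q * (1 + Q) * 2) ^ 4)))) * ∫⁻ x, ‖f x‖ₑ ^ 6 := by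
    exact ofReal_aux n hFc0 (by positivity) (by positivity) (by positivity) _
  rw [e1]
  gcongr ENNReal.ofReal ?_ * _
  -- real inequality
  have hE : ((n:ℝ) / 2 ^ j) ^ 2 ≤ (2:ℝ) ^ (-(51 / 50 * (j:ℝ))) := by
    rw [hnr, div_pow, ← pow_mul, ← pow_mul, ← Real.rpow_natCast 2, ← Real.rpow_natCast 2, ← Real.rpow_sub (by norm_num)]
    refine Real.rpow_le_rpow_of_exponent_le (by norm_num) ?_
    have : (50:ℝ) * (b * m) ≤ 3 * j := by exact_mod_cast hm1
    push_cast
    have : (0:ℝ) ≤ j := Nat.cast_nonneg _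
    linarith
  have hN6 : ((C1 * M * (M ^ 2) ^ 3 : ℕ) : ℝ) ≤ 2 ^ (15 * b) := by
    push_cast
    have : (C1:ℝ) ≤ 2 ^ b := by exact_mod_cast hC1
    calc (C1:ℝ) * M * ((M:ℝ) ^ 2) ^ 3 ≤ 2 ^ b * M * ((M:ℝ) ^ 2) ^ 3 := by gcongr
      _ = _ := by rw [hMr]; ring
  have hF : (n:ℝ) * Fc ≤ (Cw ^ 2 * W * (96 * (Q * C * (256 * C / c)) ^ 2 * (C * Q * Q * (3/2)) ^ 4) * 2 ^ (17 * b)) * (2:ℝ) ^ (-(51 / 50 * (j:ℝ))) := by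
    have e2 : (n:ℝ) * Fc = (Cw ^ 2 * W * (96 * (Q * C * (256 * C / c)) ^ 2 * (C * Q * Q * (3/2)) ^ 4)) * (((C1 * M * (M ^ 2) ^ 3 : ℕ) : ℝ) ^ m / ((n:ℝ) ^ 2 * (((M:ℝ) ^ 2) ^ m) ^ 4)) := by
      rw [hFc]
      have : ((M:ℝ) ^ 2) ^ m ≠ 0 := by positivity
      generalize ((M:ℝ) ^ 2) ^ m = z at *
      generalize ((C1 * M * (M ^ 2) ^ 3 : ℕ) : ℝ) ^ m = z2 at *
      field_simp; norm_num
    have e3 : ((C1 * M * (M ^ 2) ^ 3 : ℕ) : ℝ) ^ m / ((n:ℝ) ^ 2 * (((M:ℝ) ^ 2) ^ m) ^ 4) ≤ 2 ^ (17 * b) * (2:ℝ) ^ (-(51 / 50 * (j:ℝ))) := by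
      calc _ ≤ ((2:ℝ) ^ (15 * b)) ^ m / ((n:ℝ) ^ 2 * (((M:ℝ) ^ 2) ^ m) ^ 4) := by gcongr
        _ = (2:ℝ) ^ (15 * b * m) / 2 ^ (32 * (b * m)) := by
          rw [hMr, hnr]; simp only [← pow_mul, ← pow_add]; congr 2; ring
        _ ≤ _ := by
          rw [← Real.rpow_natCast 2, ← Real.rpow_natCast 2, ← Real.rpow_natCast 2, ← Real.rpow_sub (by norm_num), ← Real.rpow_add (by norm_num)]
          refine Real.rpow_le_rpow_of_exponent_le (by norm_num) ?_
          have : (3:ℝ) * j < 50 * (b * m) + 50 * b := by exact_mod_cast hm2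
          push_cast
          linarith
    rw [e2, mul_assoc _ _ ((2:ℝ) ^ (-(51 / 50 * (j:ℝ))))]
    gcongr
  calc _ = 32 * ((n:ℝ) * Fc + 96 * (Q * (200 + 32 * D)) ^ 2 * (C * Q * (1 + Q) * 2) ^ 4 * ((n:ℝ) / 2 ^ j) ^ 2) := by
        have : (n:ℝ) * (1 / n) = 1 := by field_simp
        generalize (n:ℝ) / 2 ^ j = r
        linear_combination (32 * (96 * ((Q * (200 + 32 * D) * r) ^ 2) * (C * Q * (1 + Q) * 2) ^ 4)) * this
    _ ≤ 32 * ((Cw ^ 2 * W * (96 * (Q * C * (256 * C / c)) ^ 2 * (C * Q * Q * (3/2)) ^ 4) * 2 ^ (17 * b)) * (2:ℝ) ^ (-(51 / 50 * (j:ℝ))) + 96 * (Q * (200 + 32 * D)) ^ 2 * (C * Q * (1 + Q) * 2) ^ 4 * (2:ℝ) ^ (-(51 / 50 * (j:ℝ)))) := by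
        gcongr
    _ = _ := by unfold PC; ring
end

section
variable {c C p0 e : ℝ} {Γ Γ1 Γ2 Γ3 : ℝ → ℝ} {α β ζ χ χ1 : ℝ → ℝ} {Q : ℝ}

lemma cm_meas (hχm : Measurable χ) : Measurable (Function.uncurry (fun (_ : ℝ × ℝ) t => (χ t : ℂ))) := by
  have : Measurable fun z : (ℝ × ℝ) × ℝ => χ z.2 := hχm.comp measurable_snd
  exact Complex.measurable_ofReal.comp this

lemma ex_hasDeriv (a b u : ℝ) : HasDerivAt (fun u : ℝ => ex (a + b * u)) (Complex.I * b * ex (a + b * u)) u := by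
  unfold ex
  have h1 : HasDerivAt (fun u : ℝ => (((a + b * u : ℝ) : ℂ)) * Complex.I) ((b : ℝ) * Complex.I) u := by
    have : HasDerivAt (fun u : ℝ => a + b * u) b u := by
      simpa using ((hasDerivAt_id u).const_mul b).const_add a
    exact this.ofReal_comp.mul_const _
  refine h1.cexp.congr_deriv ?_; ring

lemma GS_deriv (h : Curve c C p0 e Γ Γ1 Γ2 Γ3) (hχm : Measurable χ) {Ca : ℝ} (hχb : ∀ t ∈ Icc p0 (p0 + 3/2), |χ t| ≤ Ca) (u : ℝ) (ξ : ℝ × ℝ) :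
    HasDerivAt (fun u => GS Γ (Ioc p0 (p0 + 3/2)) (fun _ t => (χ t : ℂ)) u ξ)
      (Complex.I * ξ.2 * GS Γ (Ioc p0 (p0 + 3/2)) (fun _ t => ((Γ t * χ t : ℝ) : ℂ)) u ξ) u := by
  have hm : ∀ u, Measurable fun t => ex (ph Γ u ξ t) * (χ t : ℂ) := fun u =>
    (ex_meas.comp ((ph_meas h.m0 u).comp (measurable_const (a := ξ) |>.prodMk measurable_id))).mul (Complex.measurable_ofReal.comp hχm)
  have hmΓ : Measurable fun t => ((Γ t : ℝ) : ℂ) := Complex.measurable_ofReal.comp h.m0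
  have hC := h.hC
  have hmem : ∀ᵐ t ∂(volume.restrict (Ioc p0 (p0 + 3/2))), t ∈ Icc p0 (p0 + 3/2) := by
    filter_upwards [ae_restrict_mem measurableSet_Ioc] with t ht using Ioc_subset_Icc_self ht
  have key := hasDerivAt_integral_of_dominated_loc_of_deriv_le (μ := volume.restrict (Ioc p0 (p0 + 3/2))) (s := univ) (x₀ := u)
    (F := fun u t => ex (ph Γ u ξ t) * (χ t : ℂ)) (F' := fun u t => Complex.I * ξ.2 * Γ t * (ex (ph Γ u ξ t) * (χ t : ℂ))) (bound := fun _ => |ξ.2| * C * Ca) univ_mem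
    (Eventually.of_forall fun u => (hm u).aestronglyMeasurable) ?_ ?_ ?_ ?_ ?_
  · unfold GS
    refine key.2.congr_deriv ?_
    rw [← integral_const_mul]
    congr 1; ext t; push_cast; ring
  · refine Measure.integrableOn_of_bounded (M := Ca) (by simp) (hm u).aestronglyMeasurable ?_
    filter_upwards [hmem] with t ht
    rw [norm_mul, ex_norm, one_mul, Complex.norm_real]; exact hχb t ht
  · exact ((measurable_const.mul hmΓ).mul (hm u)).aestronglyMeasurable
  · filter_upwards [hmem] with t ht u _
    simp only [norm_mul, ex_norm, one_mul, Complex.norm_real, Complex.norm_I, Real.norm_eq_abs]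
    have := h.b0 t ht
    have := hχb t ht
    have := abs_nonneg (χ t)
    gcongr
  · exact integrable_const _
  · refine ae_of_all _ fun t u _ => ?_
    have h1 := (ex_hasDeriv (ξ.1 * t) (ξ.2 * Γ t) u).mul_const (χ t : ℂ)
    have h2 : ∀ u, ph Γ u ξ t = ξ.1 * t + ξ.2 * Γ t * u := fun u => by unfold ph; ring
    simp only [h2]
    refine h1.congr_deriv ?_; push_cast; ring

lemma TT_deriv (h : Curve c C p0 e Γ Γ1 Γ2 Γ3) (hk : Ker α β ζ Q) {Q' : ℝ} (hk' : Ker α (fun x => x * β x) ζ Q') (hχm : Measurable χ) {Ca : ℝ} (hχb : ∀ t ∈ Icc p0 (p0 + 3/2), |χ t| ≤ Ca)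
    {lam : ℝ} (hl : 0 < lam) {f : ℝ × ℝ → ℂ} (hf : Cls f) (x : ℝ × ℝ) (u : ℝ) :
    HasDerivAt (fun u => TT α β lam Γ (Ioc p0 (p0 + 3/2)) χ f (x, u))
      (Complex.I * lam * TT α (fun x => x * β x) lam Γ (Ioc p0 (p0 + 3/2)) (fun t => Γ t * χ t) f (x, u)) u := by
  have hm0 := mul0_cls hk.sa hk.ca hk.sb hk.cb hl
  have hm1 := mul0_cls hk'.sa hk'.ca hk'.sb hk'.cb hl
  have hCa : 0 ≤ Ca := (abs_nonneg _).trans (hχb p0 ⟨le_rfl, by linarith⟩)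
  have hvf : volume (Ioc p0 (p0 + 3/2)) < ⊤ := by simp
  have hΓχb : ∀ t ∈ Icc p0 (p0 + 3/2), |Γ t * χ t| ≤ C * Ca := fun t ht => by
    rw [abs_mul]; exact mul_le_mul (h.b0 t ht) (hχb t ht) (abs_nonneg _) (by linarith [h.hC])
  set G0 := fun u ξ => GS Γ (Ioc p0 (p0 + 3/2)) (fun _ t => (χ t : ℂ)) u ξ with hG0
  set G1 := fun u ξ => GS Γ (Ioc p0 (p0 + 3/2)) (fun _ t => ((Γ t * χ t : ℝ) : ℂ)) u ξ with hG1
  have mG0 : ∀ u, Measurable (G0 u) := fun u => GS_meas h.m0 (cm_meas hχm) u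
  have mG1 : ∀ u, Measurable (G1 u) := fun u => GS_meas h.m0 (cm_meas (h.m0.mul hχm)) u
  have bG0 : ∀ u ξ, ‖G0 u ξ‖ ≤ Ca * volume.real (Ioc p0 (p0 + 3/2)) := fun u ξ => GS_le hvf (fun ξ t ht => by
    rw [Complex.norm_real]; exact hχb t (Ioc_subset_Icc_self ht)) u ξ
  have bG1 : ∀ u ξ, ‖G1 u ξ‖ ≤ C * Ca * volume.real (Ioc p0 (p0 + 3/2)) := fun u ξ => GS_le hvf (fun ξ t ht => by
    rw [Complex.norm_real]; exact hΓχb t (Ioc_subset_Icc_self ht)) u ξ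
  have I0 : ∀ u, Cls fun ξ => mul0 α β lam ξ * G0 u ξ * ft f ξ := fun u => (hm0.mul_bdd (mG0 u) (bG0 u)).mul_ft hf
  have I1 : ∀ u, Cls fun ξ => mul0 α (fun x => x * β x) lam ξ * G1 u ξ * ft f ξ := fun u => (hm1.mul_bdd (mG1 u) (bG1 u)).mul_ft hf
  have me : Measurable fun ξ => ex (pr x ξ) := ex_meas.comp (pr_meas2 x)
  have hmul : ∀ ξ : ℝ × ℝ, (ξ.2 : ℂ) * mul0 α β lam ξ = lam * mul0 α (fun x => x * β x) lam ξ := fun ξ => by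
    unfold mul0
    have : (lam : ℂ) ≠ 0 := by exact_mod_cast hl.ne'
    push_cast; field_simp
  have key := hasDerivAt_integral_of_dominated_loc_of_deriv_le (μ := (volume : Measure (ℝ × ℝ))) (s := univ) (x₀ := u)
    (F := fun u ξ => ex (pr x ξ) * (mul0 α β lam ξ * G0 u ξ * ft f ξ)) (F' := fun u ξ => Complex.I * lam * (ex (pr x ξ) * (mul0 α (fun x => x * β x) lam ξ * G1 u ξ * ft f ξ)))
    (bound := fun ξ => lam * (‖mul0 α (fun x => x * β x) lam ξ * ft f ξ‖ * (C * Ca * volume.real (Ioc p0 (p0 + 3/2))))) univ_mem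
    (Eventually.of_forall fun u => (me.mul (I0 u).m).aestronglyMeasurable) ?_ ?_ ?_ ?_ ?_
  · have := key.2
    unfold TT
    simp only [op_eq]
    refine this.congr_deriv ?_
    rw [← integral_const_mul]
  · exact (I0 u).i.bdd_mul (c := 1) me.aestronglyMeasurable (ae_of_all _ fun ξ => (ex_norm _).le)
  · exact (measurable_const.mul (me.mul (I1 u).m)).aestronglyMeasurable
  · refine ae_of_all _ fun ξ u _ => ?_
    simp only [norm_mul, ex_norm, one_mul, Complex.norm_real, Complex.norm_I, Real.norm_eq_abs, abs_of_pos hl]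
    have := bG1 u ξ
    calc _ = lam * (‖mul0 α (fun x => x * β x) lam ξ‖ * ‖ft f ξ‖ * ‖G1 u ξ‖) := by ring
      _ ≤ _ := by gcongr
  · exact ((hm1.mul_ft hf).i.norm.mul_const _).const_mul _
  · refine ae_of_all _ fun ξ u _ => ?_
    have := (((GS_deriv h hχm hχb u ξ).const_mul (mul0 α β lam ξ)).mul_const (ft f ξ)).const_mul (ex (pr x ξ))
    refine this.congr_deriv ?_
    have e1 := hmul ξ
    simp only [hG1]
    linear_combination Complex.I * ex (pr x ξ) * GS Γ (Ioc p0 (p0 + 3/2)) (fun _ t => ((Γ t * χ t : ℝ) : ℂ)) u ξ * ft f ξ * e1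
end

lemma jensen6 {g : ℝ → ℂ} (hg : Measurable g) {J : Set ℝ} {L : ℝ} (hL : 0 < L) (hJ : volume J = ENNReal.ofReal (1 / L)) :
    (ENNReal.ofReal L * ∫⁻ v in J, ‖g v‖ₑ) ^ 6 ≤ ENNReal.ofReal L * ∫⁻ v in J, ‖g v‖ₑ ^ 6 := by
  have hL0 : ENNReal.ofReal L ≠ 0 := by simpa using hL
  have hLt : ENNReal.ofReal L ≠ ⊤ := by simp
  have hpm : (ENNReal.ofReal L • volume.restrict J) univ = 1 := by
    rw [Measure.smul_apply, Measure.restrict_apply_univ, hJ, smul_eq_mul, ← ENNReal.ofReal_mul hL.le, mul_one_div_cancel hL.ne', ENNReal.ofReal_one]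
  have := eLpNorm_le_eLpNorm_mul_rpow_measure_univ (μ := ENNReal.ofReal L • volume.restrict J) (p := 1) (q := 6) (f := g) (by norm_num) hg.aestronglyMeasurable
  rw [hpm, ENNReal.one_rpow, mul_one, eLpNorm_one_eq_lintegral_enorm, eLpNorm_eq_lintegral_rpow_enorm_toReal (by norm_num) (by norm_num), lintegral_smul_measure, lintegral_smul_measure, smul_eq_mul, smul_eq_mul] at this
  have h2 := pow_le_pow_left' this 6
  rw [← ENNReal.rpow_natCast (_ ^ _), ← ENNReal.rpow_mul] at h2
  norm_num at h2
  exact_mod_cast h2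

lemma sob1 {F G : ℝ → ℂ} {L : ℝ} (hL : 1 ≤ L) (hF : ∀ u, HasDerivAt F (Complex.I * L * G u) u) (hG : Continuous G) {u : ℝ} (hu : u ∈ Icc (1:ℝ) 2) :
    ‖F u‖ₑ ^ 6 ≤ 32 * ENNReal.ofReal L * ((∫⁻ v in Icc (1:ℝ) 2, ‖F v‖ₑ ^ 6) + ∫⁻ v in Icc (1:ℝ) 2, ‖G v‖ₑ ^ 6) := by
  have hL0 : 0 < L := by linarith
  have hLi : 1 / L ≤ 1 := by rw [div_le_one hL0]; exact hL
  have hLi0 : 0 < 1 / L := by positivity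
  have hFc : Continuous F := continuous_iff_continuousAt.2 fun u => (hF u).continuousAt
  obtain ⟨a, ha1, ha2, ha3, ha4⟩ : ∃ a, 1 ≤ a ∧ a + 1 / L ≤ 2 ∧ a ≤ u ∧ u ≤ a + 1 / L := by
    by_cases h : u + 1 / L ≤ 2
    · exact ⟨u, hu.1, h, le_rfl, by linarith⟩
    · push Not at h
      exact ⟨2 - 1 / L, by linarith, by linarith, by linarith, by linarith [hu.2]⟩
  set J := Icc a (a + 1 / L) with hJ
  have hJs : J ⊆ Icc 1 2 := Icc_subset_Icc ha1 ha2
  have hvJ : volume J = ENNReal.ofReal (1 / L) := by rw [hJ, Real.volume_Icc]; congr 1; ring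
  have h1 : ∀ v ∈ J, ‖F u‖ₑ ^ 6 ≤ 32 * (‖F v‖ₑ ^ 6 + ENNReal.ofReal L * ∫⁻ v in J, ‖G v‖ₑ ^ 6) := by
    intro v hv
    have e1 : F u = F v + ∫ s in v..u, Complex.I * L * G s := by
      rw [intervalIntegral.integral_eq_sub_of_hasDerivAt (fun s _ => hF s) ((continuous_const.mul hG).intervalIntegrable _ _)]; ring
    have e2 : ‖∫ s in v..u, Complex.I * L * G s‖ₑ ≤ ENNReal.ofReal L * ∫⁻ v in J, ‖G v‖ₑ := by
      have : ‖∫ s in v..u, Complex.I * L * G s‖ₑ = ‖∫ s in Set.uIoc v u, Complex.I * L * G s‖ₑ := by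
        rw [← ofReal_norm, ← ofReal_norm, intervalIntegral.norm_integral_eq_norm_integral_uIoc]
      rw [this]
      refine (enorm_integral_le_lintegral_enorm _).trans ?_
      simp only [enorm_mul]
      rw [show ‖Complex.I‖ₑ * ‖(L:ℂ)‖ₑ = ENNReal.ofReal L by rw [← ofReal_norm, ← ofReal_norm, Complex.norm_I, Complex.norm_real, Real.norm_of_nonneg hL0.le]; simp]
      rw [lintegral_const_mul' _ _ (by simp)]
      gcongr
      intro s hs
      have := uIoc_subset_uIcc hs
      have h3 : uIcc v u ⊆ J := by
        rw [hJ]; exact uIcc_subset_Icc hv ⟨ha3, ha4⟩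
      exact h3 this
    rw [e1]
    refine (six_add _ _).trans ?_
    gcongr
    exact (pow_le_pow_left' e2 6).trans (jensen6 hG.measurable hL0 hvJ)
  have h2 := setLIntegral_mono' (μ := volume) (measurableSet_Icc (a := a) (b := a + 1 / L)) h1
  rw [setLIntegral_const, lintegral_const_mul' _ _ (by simp), lintegral_add_right _ measurable_const, setLIntegral_const, ← hJ, hvJ] at h2
  have h3 : ENNReal.ofReal L * ENNReal.ofReal (1 / L) = 1 := by
    rw [← ENNReal.ofReal_mul hL0.le, mul_one_div_cancel hL0.ne', ENNReal.ofReal_one]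
  calc ‖F u‖ₑ ^ 6 = ENNReal.ofReal L * (‖F u‖ₑ ^ 6 * ENNReal.ofReal (1 / L)) := by
        rw [mul_comm (‖F u‖ₑ ^ 6), ← mul_assoc, h3, one_mul]
    _ ≤ ENNReal.ofReal L * (32 * ((∫⁻ v in J, ‖F v‖ₑ ^ 6) + ENNReal.ofReal L * (∫⁻ v in J, ‖G v‖ₑ ^ 6) * ENNReal.ofReal (1 / L))) := by gcongr
    _ = 32 * ENNReal.ofReal L * ((∫⁻ v in J, ‖F v‖ₑ ^ 6) + (∫⁻ v in J, ‖G v‖ₑ ^ 6) * (ENNReal.ofReal L * ENNReal.ofReal (1 / L))) := by ring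
    _ ≤ _ := by
      rw [h3, mul_one]
      gcongr

section
variable {c C p0 e : ℝ} {Γ Γ1 Γ2 Γ3 : ℝ → ℝ} {α β ζ χ χ1 χ2 : ℝ → ℝ} {Q Q' : ℝ}

lemma PC_nn {c C Q Cw W D : ℝ} {b : ℕ} (hW : 0 ≤ W) : 0 ≤ PC c C Q Cw W D b := by
  unfold PC; positivity

theorem piece_sup (h : Curve c C p0 e Γ Γ1 Γ2 Γ3) (hk : Ker α β ζ Q) (hk' : Ker α (fun x => x * β x) ζ Q') (hχ : Amp C p0 χ χ1) (hχ' : Amp C p0 (fun t => Γ t * χ t) χ2)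
    {D : ℝ} (hD : ∀ x, |deriv ζ x| ≤ D) {w : ℝ → ℝ} {Ω Cw : ℝ} (hw : Wgt w Ω Cw)
    {b : ℕ} (hb : 1 ≤ b) {r0 : ℝ} (hr0 : 1 / 4 ≤ |r0|) (hr0' : |r0| ≤ 3)
    (hβ : ∀ x, β x ≠ 0 → |x - r0| ≤ 1 / (((2 ^ b) ^ 2 : ℕ):ℝ) ^ 2)
    {C0 : ℝ} {C1 : ℕ} (h1 : C ≤ C0) (h2 : 2 * C ^ 2 / c ^ 2 ≤ C0) (hC0 : 32 * C * (1 + C ^ 2 / c ^ 2) * (Ω + 6 * (16 * C) + 30) ≤ C0)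
    (hcount : ∀ {M : ℕ}, 1 ≤ M → ∀ {S H : ℕ → ℝ} {G : ℕ → ℕ → ℝ},
    CntHyp (c / C ^ 2) C0 M S H G → ∀ {P : Finset (ℕ × ℕ)}, PairOK C0 M S H P → P.card ≤ C1 * M)
    (hC1 : C1 ≤ 2 ^ b) (j : ℕ) {f : ℝ × ℝ → ℂ} (hf : Cls f) :
    ∃ R : ℝ × ℝ → ℝ≥0∞, Measurable R ∧ (∀ x, ∀ u ∈ Icc (1:ℝ) 2, ‖TT α β (2 ^ j) Γ (Ioc p0 (p0 + 3/2)) χ f (x, u)‖ₑ ^ 6 ≤ R x) ∧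
      ∫⁻ x, R x ≤ ENNReal.ofReal (32 * (PC c C Q Cw (∫ v, w v) D b + PC c C Q' Cw (∫ v, w v) D b) * (2:ℝ) ^ (-((j:ℝ) / 50))) * ∫⁻ x, ‖f x‖ₑ ^ 6 := by
  have hW : 0 ≤ ∫ v, w v := integral_nonneg hw.n
  have hl : (0:ℝ) < 2 ^ j := by positivity
  have hl1 : (1:ℝ) ≤ 2 ^ j := one_le_pow₀ (by norm_num)
  set β' : ℝ → ℝ := fun x => x * β x with hβ'
  set χ' : ℝ → ℝ := fun t => Γ t * χ t with hχ'd
  have P1 := piece h hk hχ hD hw hb hr0 hr0' hβ h1 h2 hC0 hcount hC1 j hf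
  have P2 := piece h hk' hχ' hD hw hb hr0 hr0' (fun x hx => hβ x (right_ne_zero_of_mul hx)) h1 h2 hC0 hcount hC1 j hf
  have M1 := TT_meas h hk hχ hl hf
  have M2 := TT_meas h hk' hχ' hl hf
  obtain ⟨Q'', hk''⟩ := exists_ker (ζ := ζ) (α := α) (β := fun x => x * β' x) hk.sa hk.ca (contDiff_id.mul hk'.sb) (hk'.cb.mul_left) hk.cut
    (fun x hx => hk'.lo x (right_ne_zero_of_mul hx)) (fun x hx => hk'.up x (right_ne_zero_of_mul hx))
  set F1 : ℝ × ℝ → ℝ≥0∞ := fun x => ∫⁻ v in Icc (1:ℝ) 2, ‖TT α β (2 ^ j) Γ (Ioc p0 (p0 + 3/2)) χ f (x, v)‖ₑ ^ 6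
  set F2 : ℝ × ℝ → ℝ≥0∞ := fun x => ∫⁻ v in Icc (1:ℝ) 2, ‖TT α β' (2 ^ j) Γ (Ioc p0 (p0 + 3/2)) χ' f (x, v)‖ₑ ^ 6
  have mF1 : Measurable F1 := Measurable.lintegral_prod_right' (f := fun y : (ℝ × ℝ) × ℝ => ‖TT α β (2 ^ j) Γ (Ioc p0 (p0 + 3/2)) χ f y‖ₑ ^ 6) (M1.enorm.pow_const 6)
  have mF2 : Measurable F2 := Measurable.lintegral_prod_right' (f := fun y : (ℝ × ℝ) × ℝ => ‖TT α β' (2 ^ j) Γ (Ioc p0 (p0 + 3/2)) χ' f y‖ₑ ^ 6) (M2.enorm.pow_const 6)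
  refine ⟨fun x => 32 * ENNReal.ofReal (2 ^ j) * (F1 x + F2 x), (mF1.add mF2).const_mul _, fun x u hu => ?_, ?_⟩
  · refine sob1 (L := 2 ^ j) hl1 (F := fun u => TT α β (2 ^ j) Γ (Ioc p0 (p0 + 3/2)) χ f (x, u)) (G := fun u => TT α β' (2 ^ j) Γ (Ioc p0 (p0 + 3/2)) χ' f (x, u)) (fun u => ?_) ?_ hu
    · exact TT_deriv h hk hk' hχ.m hχ.b hl hf x u
    · exact continuous_iff_continuousAt.2 fun u => (TT_deriv h hk' hk'' hχ'.m hχ'.b hl hf x u).continuousAt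
  · rw [lintegral_const_mul' _ _ (by finiteness), lintegral_add_left mF1]
    have s1 : ∫⁻ x, F1 x = ∫⁻ v in Icc (1:ℝ) 2, ∫⁻ x, ‖TT α β (2 ^ j) Γ (Ioc p0 (p0 + 3/2)) χ f (x, v)‖ₑ ^ 6 :=
      lintegral_lintegral_swap (f := fun x v => ‖TT α β (2 ^ j) Γ (Ioc p0 (p0 + 3/2)) χ f (x, v)‖ₑ ^ 6) (M1.enorm.pow_const 6).aemeasurable
    have s2 : ∫⁻ x, F2 x = ∫⁻ v in Icc (1:ℝ) 2, ∫⁻ x, ‖TT α β' (2 ^ j) Γ (Ioc p0 (p0 + 3/2)) χ' f (x, v)‖ₑ ^ 6 :=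
      lintegral_lintegral_swap (f := fun x v => ‖TT α β' (2 ^ j) Γ (Ioc p0 (p0 + 3/2)) χ' f (x, v)‖ₑ ^ 6) (M2.enorm.pow_const 6).aemeasurable
    rw [s1, s2]
    have n1 := PC_nn (c := c) (C := C) (Q := Q) (Cw := Cw) (D := D) (b := b) hW
    have n2 := PC_nn (c := c) (C := C) (Q := Q') (Cw := Cw) (D := D) (b := b) hW
    set A1 := PC c C Q Cw (∫ v, w v) D b
    set A2 := PC c C Q' Cw (∫ v, w v) D b
    calc _ ≤ 32 * ENNReal.ofReal (2 ^ j) * (ENNReal.ofReal (A1 * (2:ℝ) ^ (-(51 / 50 * (j:ℝ)))) * (∫⁻ x, ‖f x‖ₑ ^ 6) + ENNReal.ofReal (A2 * (2:ℝ) ^ (-(51 / 50 * (j:ℝ)))) * ∫⁻ x, ‖f x‖ₑ ^ 6) := by gcongr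
      _ = ENNReal.ofReal (32 * 2 ^ j * (A1 * (2:ℝ) ^ (-(51 / 50 * (j:ℝ))) + A2 * (2:ℝ) ^ (-(51 / 50 * (j:ℝ))))) * ∫⁻ x, ‖f x‖ₑ ^ 6 := by
        rw [ENNReal.ofReal_mul (p := 32 * 2 ^ j) (by positivity), ENNReal.ofReal_mul (p := 32) (by positivity), ENNReal.ofReal_add (by positivity) (by positivity), show ENNReal.ofReal 32 = 32 by simp]; ring
      _ = _ := by
        congr 2
        have : (2:ℝ) ^ j * (2:ℝ) ^ (-(51 / 50 * (j:ℝ))) = (2:ℝ) ^ (-((j:ℝ) / 50)) := by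
          rw [← Real.rpow_natCast, ← Real.rpow_add (by norm_num)]; congr 1; ring
        rw [← this]; ring
end

lemma exists_part {φ : ℝ → ℝ} (hs : ContDiff ℝ (⊤ : ℕ∞) φ) (hc : HasCompactSupport φ) (hsupp : ∀ x, φ x ≠ 0 → 1 / 2 ≤ |x| ∧ |x| ≤ 2) {K : ℕ} (hK : 1 ≤ K) :
    ∃ n : ℕ, ∃ β : Fin n → ℝ → ℝ, (∀ i, ContDiff ℝ (⊤ : ℕ∞) (β i)) ∧ (∀ i, HasCompactSupport (β i)) ∧ (∀ i x, β i x ≠ 0 → 1 / 2 ≤ |x| ∧ |x| ≤ 2) ∧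
      (∀ i, ∃ r0 : ℝ, 1 / 4 ≤ |r0| ∧ |r0| ≤ 3 ∧ ∀ x, β i x ≠ 0 → |x - r0| ≤ 1 / K) ∧ ∀ x, φ x = ∑ i, β i x := by
  set N : ℝ := 2 * K with hN
  have hK' : (1:ℝ) ≤ K := by exact_mod_cast hK
  have hN0 : 0 < N := by positivity
  set S := Real.smoothTransition with hS
  set θ : ℕ → ℝ → ℝ := fun k x => S (N * x + 3 * N - k) - S (N * x + 3 * N - (k + 1 : ℕ)) with hθ
  have hθs : ∀ k x, θ k x ≠ 0 → 0 < N * x + 3 * N - k ∧ N * x + 3 * N - k < 2 := by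
    intro k x hx
    constructor
    · by_contra h
      push Not at h
      apply hx
      simp only [hθ, hS]
      rw [Real.smoothTransition.zero_of_nonpos h, Real.smoothTransition.zero_of_nonpos (by push_cast; linarith)]; simp
    · by_contra h
      push Not at h
      apply hx
      simp only [hθ, hS]
      rw [Real.smoothTransition.one_of_one_le (by linarith), Real.smoothTransition.one_of_one_le (by push_cast; linarith)]; simp
  have hβs : ∀ (i : Fin (12 * K)) x, φ x * θ i x ≠ 0 → 1 / 2 ≤ |x| ∧ |x| ≤ 2 := fun i x hx => hsupp x (left_ne_zero_of_mul hx)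
  refine ⟨12 * K, fun i x => φ x * θ i x, fun i => ?_, fun i => hc.mul_right, hβs, fun i => ?_, fun x => ?_⟩
  · refine hs.mul ?_
    simp only [hθ]
    have hT : ContDiff ℝ (⊤ : ℕ∞) S := Real.smoothTransition.contDiff
    exact (hT.comp (by fun_prop)).sub (hT.comp (by fun_prop))
  · by_cases h : ∃ r, φ r * θ i r ≠ 0
    · obtain ⟨r, hr⟩ := h
      refine ⟨r, by linarith [(hβs i r hr).1], by linarith [(hβs i r hr).2], fun x hx => ?_⟩
      have h1 := hθs i x (right_ne_zero_of_mul hx)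
      have h2 := hθs i r (right_ne_zero_of_mul hr)
      rw [le_div_iff₀ (by positivity), ← abs_of_pos (show (0:ℝ) < K by positivity), ← abs_mul, abs_le]
      constructor <;> nlinarith
    · push Not at h
      exact ⟨1, by norm_num, by norm_num, fun x hx => absurd (h x) hx⟩
  · rw [← Finset.mul_sum]
    by_cases hx : φ x = 0
    · simp [hx]
    have hx2 := (hsupp x hx).2
    rw [abs_le] at hx2
    have : ∑ i : Fin (12 * K), θ i x = 1 := by
      rw [Fin.sum_univ_eq_sum_range (fun k => θ k x)]
      simp only [hθ]
      rw [Finset.sum_range_sub' (fun k : ℕ => S (N * x + 3 * N - k))]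
      simp only [hS]
      rw [Real.smoothTransition.one_of_one_le, Real.smoothTransition.zero_of_nonpos]
      · simp
      · push_cast; rw [hN]; nlinarith
      · push_cast; rw [hN]; nlinarith
    rw [this, mul_one]

lemma op_sum_mul {ι : Type*} (s : Finset ι) {m : ι → ℝ × ℝ → ℂ} {f : ℝ × ℝ → ℂ} (h1 : ∀ i, Cls (m i)) (hf : Cls f) (x) : op (fun ξ => ∑ i ∈ s, m i ξ) f x = ∑ i ∈ s, op (m i) f x := by
  simp only [op_eq]
  rw [← integral_finsetSum]
  · congr 1; ext ξ; rw [Finset.sum_mul, Finset.mul_sum]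
  · intro i _
    exact (((h1 i).mul_ft hf).i.bdd_mul (c := 1) (ex_meas.comp (pr_meas2 x)).aestronglyMeasurable (ae_of_all _ fun ξ => (ex_norm _).le))

lemma six_sum {ι : Type*} (s : Finset ι) (a : ι → ℂ) : ‖∑ i ∈ s, a i‖ₑ ^ 6 ≤ (s.card : ℝ≥0∞) ^ 5 * ∑ i ∈ s, ‖a i‖ₑ ^ 6 := by
  refine (pow_le_pow_left' (enorm_sum_le s a) 6).trans ?_
  have := ENNReal.rpow_sum_le_const_mul_sum_rpow s (fun i => ‖a i‖ₑ) (p := 6) (by norm_num)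
  norm_num at this
  exact_mod_cast this

theorem curve_sup {φ : ℝ → ℝ} (hs : ContDiff ℝ (⊤ : ℕ∞) φ) (hc : HasCompactSupport φ) (hsupp : ∀ x, φ x ≠ 0 → 1 / 2 ≤ |x| ∧ |x| ≤ 2)
    {c C : ℝ} (hc0 : 0 < c) (hC : 1 ≤ C) :
    ∃ K : ℝ, 0 < K ∧ ∀ {p0 e : ℝ} {Γ Γ1 Γ2 Γ3 χ χ1 χ2 : ℝ → ℝ}, Curve c C p0 e Γ Γ1 Γ2 Γ3 → Amp C p0 χ χ1 → Amp C p0 (fun t => Γ t * χ t) χ2 →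
      ∀ (j : ℕ) {f : ℝ × ℝ → ℂ}, Cls f → ∃ R : ℝ × ℝ → ℝ≥0∞, Measurable R ∧ (∀ x, ∀ u ∈ Icc (1:ℝ) 2, ‖TT φ φ (2 ^ j) Γ (Ioc p0 (p0 + 3/2)) χ f (x, u)‖ₑ ^ 6 ≤ R x) ∧
      ∫⁻ x, R x ≤ ENNReal.ofReal (K * (2:ℝ) ^ (-((j:ℝ) / 50))) * ∫⁻ x, ‖f x‖ₑ ^ 6 := by
  obtain ⟨w, Ω, w1, w2, w3, w4, w5, ⟨Cw, w6⟩, w7⟩ := exists_weight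
  have hw : Wgt w Ω Cw := ⟨w1, w2, w3, w4, w5, w6, w7⟩
  have hW : 0 ≤ ∫ v, w v := integral_nonneg hw.n
  obtain ⟨ζ, hζ⟩ := exists_cut
  obtain ⟨D, hD⟩ := (hζ.c.deriv).exists_bound_of_continuous (hζ.s.continuous_deriv (by simp))
  set C0 := C + 2 * C ^ 2 / c ^ 2 + 32 * C * (1 + C ^ 2 / c ^ 2) * (Ω + 6 * (16 * C) + 30) with hC0
  have hCp : 0 < C := by linarith
  have a1 : 0 ≤ 2 * C ^ 2 / c ^ 2 := by positivity
  have a2 : 0 ≤ 32 * C * (1 + C ^ 2 / c ^ 2) * (Ω + 6 * (16 * C) + 30) := by positivity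
  obtain ⟨C1, hcount⟩ := count_pairs (c0 := c / C ^ 2) (C0 := C0) (by positivity) (by linarith)
  set b := C1 + 1 with hb
  have hC1 : C1 ≤ 2 ^ b := (Nat.lt_two_pow_self (n := C1)).le.trans (Nat.pow_le_pow_right (by norm_num) (by omega))
  obtain ⟨n, β, b1, b2, b3, b4, b5⟩ := exists_part hs hc hsupp (K := ((2 ^ b) ^ 2) ^ 2) (Nat.one_le_pow _ _ (by positivity))
  have k1 : ∀ i, ∃ Q, Ker φ (β i) ζ Q := fun i => exists_ker hs hc (b1 i) (b2 i) hζ (fun x hx => by linarith [(b3 i x hx).1]) (fun x hx => by linarith [(b3 i x hx).2])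
  have k2 : ∀ i, ∃ Q, Ker φ (fun x => x * β i x) ζ Q := fun i => exists_ker hs hc (contDiff_id.mul (b1 i)) ((b2 i).mul_left) hζ
    (fun x hx => by linarith [(b3 i x (right_ne_zero_of_mul hx)).1]) (fun x hx => by linarith [(b3 i x (right_ne_zero_of_mul hx)).2])
  choose Q1 hQ1 using k1
  choose Q2 hQ2 using k2
  choose r0 hr1 hr2 hr3 using b4
  set A : Fin n → ℝ := fun i => 32 * (PC c C (Q1 i) Cw (∫ v, w v) D b + PC c C (Q2 i) Cw (∫ v, w v) D b) with hA
  have hAn : ∀ i, 0 ≤ A i := fun i => mul_nonneg (by norm_num) (add_nonneg (PC_nn hW) (PC_nn hW))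
  have hAs : 0 ≤ ∑ i, A i := Finset.sum_nonneg fun i _ => hAn i
  refine ⟨(n:ℝ) ^ 5 * ∑ i, A i + 1, by positivity, ?_⟩
  intro p0 e Γ Γ1 Γ2 Γ3 χ χ1 χ2 h hχ hχ' j f hf
  have hl : (0:ℝ) < 2 ^ j := by positivity
  have P := fun i => piece_sup h (hQ1 i) (hQ2 i) hχ hχ' hD hw (b := b) (by omega) (hr1 i) (hr2 i) (fun x hx => by have := hr3 i x hx; push_cast at this ⊢; exact this) (C0 := C0) (C1 := C1) (by linarith) (by linarith) (by linarith) hcount hC1 j hf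
  choose R R1 R2 R3 using P
  have hsum : ∀ x u, TT φ φ (2 ^ j) Γ (Ioc p0 (p0 + 3/2)) χ f (x, u) = ∑ i, TT φ (β i) (2 ^ j) Γ (Ioc p0 (p0 + 3/2)) χ f (x, u) := by
    intro x u
    unfold TT
    rw [← op_sum_mul]
    · congr 1; ext ξ
      rw [← Finset.sum_mul]; congr 1
      unfold mul0
      rw [← Finset.mul_sum, b5 (ξ.2 / 2 ^ j)]; push_cast; rfl
    · intro i
      exact (mul0_cls hs hc (b1 i) (b2 i) hl).mul_bdd (GS_meas h.m0 (chi_meas hχ) _) (GS_le (by simp) (fun ξ t ht => chi_bd hχ ξ t (Ioc_subset_Icc_self ht)) _)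
    · exact hf
  refine ⟨fun x => (n:ℝ≥0∞) ^ 5 * ∑ i, R i x, (Finset.measurable_sum _ fun i _ => R1 i).const_mul _, fun x u hu => ?_, ?_⟩
  · rw [hsum]
    refine (six_sum _ _).trans ?_
    rw [Finset.card_univ, Fintype.card_fin]
    exact mul_le_mul_right (Finset.sum_le_sum fun i _ => R2 i x u hu) _
  · rw [lintegral_const_mul' _ _ (by finiteness), lintegral_finsetSum _ (fun i _ => R1 i)]
    set X := (2:ℝ) ^ (-((j:ℝ) / 50)) with hX
    have hX0 : 0 ≤ X := by positivity
    calc _ ≤ (n:ℝ≥0∞) ^ 5 * ∑ i, ENNReal.ofReal (A i * X) * ∫⁻ x, ‖f x‖ₑ ^ 6 := by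
          exact mul_le_mul_right (Finset.sum_le_sum fun i _ => R3 i) _
      _ = ENNReal.ofReal ((n:ℝ) ^ 5 * ∑ i, A i * X) * ∫⁻ x, ‖f x‖ₑ ^ 6 := by
          rw [← Finset.sum_mul, ENNReal.ofReal_mul (by positivity), ENNReal.ofReal_sum_of_nonneg (fun i _ => mul_nonneg (hAn i) hX0), ENNReal.ofReal_pow (by positivity), ENNReal.ofReal_natCast, mul_assoc]
      _ ≤ _ := by
          gcongr ENNReal.ofReal ?_ * _
          rw [← Finset.sum_mul]; nlinarith

structure GH (γ : ℝ → ℝ) (c1 c2 C3 σ : ℝ) : Prop where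
  hc1 : 0 < c1
  hc2 : 0 < c2
  hC3 : 1 ≤ C3
  ms : Measurable γ
  d : ∀ k : ℕ, ∀ s, |s| < 1 → HasDerivAt (iteratedDeriv k γ) (iteratedDeriv (k + 1) γ s) s
  pos : ∀ s, 0 < s → s < 1 → 0 < γ s
  hσ : σ = 1 ∨ σ = -1
  par : ∀ t, γ (-t) = σ * γ t
  h1 : ∀ s, 0 < s → s < 1 → c1 * iteratedDeriv 2 γ s ^ 2 ≤ |iteratedDeriv 2 γ s ^ 2 - iteratedDeriv 1 γ s * iteratedDeriv 3 γ s|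
  h2 : ∀ s, 0 < s → s < 1 → c2 ≤ s ^ 2 * iteratedDeriv 2 γ s / γ s
  h3 : ∀ k : ℕ, 1 ≤ k → k ≤ 3 → ∀ s, 0 < s → s < 1 → |s ^ k * iteratedDeriv k γ s / γ s| ≤ C3

lemma GH_of {γ : ℝ → ℝ} 
    (hγ0 : γ 0 = 0)
    (hsmooth : ContDiffOn ℝ (⊤ : ℕ∞) γ (Set.Icc (-1 : ℝ) 1))
    (hparity : (∀ t, γ (-t) = γ t) ∨ (∀ t, γ (-t) = -γ t))
    (hmono : StrictMonoOn γ (Set.Icc (0 : ℝ) 1))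
    (hyp1 : ∃ c > (0 : ℝ), ∀ t ∈ Set.Ioc (0 : ℝ) 1,
      c ≤ |deriv (fun s => deriv γ s / deriv (deriv γ) s) t|)
    (hyp2 : ∃ c > (0 : ℝ), ∀ j ∈ ({1, 2} : Set ℕ), ∀ t ∈ Set.Ioc (0 : ℝ) 1,
      c ≤ |t ^ j * iteratedDeriv j γ t / γ t|)
    (hyp3 : ∃ C : ℝ, ∀ j : ℕ, 1 ≤ j → j ≤ 1000 → ∀ t ∈ Set.Ioc (0 : ℝ) 1,
      |t ^ j * iteratedDeriv j γ t / γ t| ≤ C)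
    (hconv : ∀ t ∈ Set.Ioc (0 : ℝ) 1, 0 < iteratedDeriv 2 γ t)
    (hcont : ContinuousOn γ (Set.Ici (0 : ℝ))) : ∃ c1 c2 C3 σ, GH γ c1 c2 C3 σ := by
  obtain ⟨c1, hc1, h1⟩ := hyp1
  obtain ⟨c2, hc2, h2⟩ := hyp2
  obtain ⟨C3, h3⟩ := hyp3
  obtain ⟨σ, hσ, par⟩ : ∃ σ : ℝ, (σ = 1 ∨ σ = -1) ∧ ∀ t, γ (-t) = σ * γ t := by
    rcases hparity with h | h
    · exact ⟨1, Or.inl rfl, fun t => by rw [h]; ring⟩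
    · exact ⟨-1, Or.inr rfl, fun t => by rw [h]; ring⟩
  have hpos : ∀ s, 0 < s → s < 1 → 0 < γ s := fun s h0 hs => by
    have := hmono (a := 0) (b := s) ⟨le_rfl, zero_le_one⟩ ⟨h0.le, hs.le⟩ h0
    rwa [hγ0] at this
  have hd : ∀ k : ℕ, ∀ s, |s| < 1 → HasDerivAt (iteratedDeriv k γ) (iteratedDeriv (k + 1) γ s) s := by
    intro k s hs
    rw [abs_lt] at hs
    have hD := (hsmooth.mono Ioo_subset_Icc_self).differentiableOn_iteratedDerivWithin (m := k)
      (by exact_mod_cast WithTop.coe_lt_top _) isOpen_Ioo.uniqueDiffOn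
    have := (hD.congr (fun x hx => (iteratedDerivWithin_of_isOpen isOpen_Ioo hx).symm)).differentiableAt
      (isOpen_Ioo.mem_nhds (show s ∈ Ioo (-1 : ℝ) 1 from hs))
    rw [iteratedDeriv_succ]
    exact this.hasDerivAt
  refine ⟨c1, c2, max C3 1, σ, hc1, hc2, le_max_right _ _, ?_, hd, hpos, hσ, par, ?_, ?_, ?_⟩
  · refine measurable_of_continuousOn_compl_singleton (0 : ℝ) (continuousOn_of_forall_continuousAt fun x hx => ?_)
    have hp : ∀ y, 0 < y → ContinuousAt γ y := fun y hy => hcont.continuousAt (Ici_mem_nhds hy)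
    rcases lt_or_gt_of_ne (show x ≠ 0 from hx) with h | h
    · have e1 : γ = fun y => σ * γ (-y) := by ext y; rw [← par, neg_neg]
      rw [e1]
      have := hp (-x) (by linarith)
      exact continuousAt_const.mul (ContinuousAt.comp (f := fun y : ℝ => -y) this continuousAt_neg)
    · exact hp x h
  · intro s h0 hs
    have hs' : |s| < 1 := by rw [abs_of_pos h0]; exact hs
    have hc := hconv s ⟨h0, hs.le⟩
    have e1 : (fun s => deriv γ s / deriv (deriv γ) s) = fun s => iteratedDeriv 1 γ s / iteratedDeriv 2 γ s := by
      ext s; simp [iteratedDeriv_succ, iteratedDeriv_zero]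
    have := h1 s ⟨h0, hs.le⟩
    rw [e1, ((hd 1 s hs').fun_div (hd 2 s hs') hc.ne').deriv, abs_div, abs_of_pos (pow_pos hc 2), le_div_iff₀ (pow_pos hc 2)] at this
    norm_num at this
    refine this.trans (le_of_eq ?_)
    congr 1; rw [iteratedDeriv_one]; ring
  · intro s h0 hs
    have := h2 2 (by simp) s ⟨h0, hs.le⟩
    rwa [abs_of_pos] at this
    have := hpos s h0 hs
    have := hconv s ⟨h0, hs.le⟩
    positivity
  · intro k hk hk' s h0 hs
    exact (h3 k hk (by omega) s ⟨h0, hs.le⟩).trans (le_max_left _ _)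

section
variable {γ : ℝ → ℝ} {c1 c2 C3 σ : ℝ}

lemma GH.ratio (h : GH γ c1 c2 C3 σ) {a t : ℝ} (ha : 0 < a) (ha' : a ≤ 1 / 4) (ht : t ∈ Icc (1/2 : ℝ) 2) :
    Real.exp (-(2 * C3)) ≤ γ (a * t) / γ a ∧ γ (a * t) / γ a ≤ Real.exp (2 * C3) := by
  have hC3 := h.hC3
  have hA := h.pos a ha (by linarith)
  have hat : a * t ∈ Icc (a / 2) (2 * a) := ⟨by nlinarith [ht.1], by nlinarith [ht.2]⟩
  have hB := h.pos (a * t) (by linarith [hat.1]) (by linarith [hat.2])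
  have key : |Real.log (γ (a * t)) - Real.log (γ a)| ≤ 2 * C3 := by
    have := Convex.norm_image_sub_le_of_norm_hasDerivWithin_le (f := fun s => Real.log (γ s)) (f' := fun s => iteratedDeriv 1 γ s / γ s) (s := Icc (a/2) (2 * a)) (C := 2 * C3 / a)
      (x := a) (y := a * t) ?_ ?_ (convex_Icc _ _) ⟨by linarith, by linarith⟩ hat
    · simp only [Real.norm_eq_abs] at this
      refine this.trans ?_
      rw [show a * t - a = a * (t - 1) by ring, abs_mul, abs_of_pos ha, show 2 * C3 / a * (a * |t - 1|) = 2 * C3 * |t - 1| by field_simp]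
      have : |t - 1| ≤ 1 := by rw [abs_le]; constructor <;> linarith [ht.1, ht.2]
      nlinarith
    · intro s hs
      have hs0 : 0 < s := by linarith [hs.1]
      have hs1 : s < 1 := by linarith [hs.2]
      have := h.d 0 s (by rw [abs_of_pos hs0]; exact hs1)
      rw [iteratedDeriv_zero] at this
      exact (this.log (h.pos s hs0 hs1).ne').hasDerivWithinAt
    · intro s hs
      have hs0 : 0 < s := by linarith [hs.1]
      have hs1 : s < 1 := by linarith [hs.2]
      have := h.h3 1 le_rfl (by norm_num) s hs0 hs1
      rw [pow_one, mul_div_assoc, abs_mul, abs_of_pos hs0] at this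
      rw [Real.norm_eq_abs, le_div_iff₀ ha]
      nlinarith [hs.1, abs_nonneg (iteratedDeriv 1 γ s / γ s)]
  rw [← Real.log_div hB.ne' hA.ne', abs_le] at key
  have hr : 0 < γ (a * t) / γ a := by positivity
  exact ⟨(Real.le_log_iff_exp_le hr).1 key.1, (Real.log_le_iff_le_exp hr).1 key.2⟩

noncomputable def Gk (γ : ℝ → ℝ) (a : ℝ) (k : ℕ) (t : ℝ) : ℝ := a ^ k * iteratedDeriv k γ (a * t) / γ a

lemma Gk_eq (h : GH γ c1 c2 C3 σ) {a t : ℝ} (ha : 0 < a) (ha' : a ≤ 1 / 4) (ht : t ∈ Icc (1/2 : ℝ) 2) (k : ℕ) :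
    Gk γ a k t = (1 / t ^ k) * ((a * t) ^ k * iteratedDeriv k γ (a * t) / γ (a * t)) * (γ (a * t) / γ a) := by
  have hA := h.pos a ha (by linarith)
  have ht0 : 0 < t := by linarith [ht.1]
  have hB := h.pos (a * t) (by positivity) (by nlinarith [ht.2])
  unfold Gk; rw [mul_pow]; field_simp

lemma Gk_neg (h : GH γ c1 c2 C3 σ) (a t : ℝ) (k : ℕ) : Gk γ a k (-t) = σ * (-1) ^ k * Gk γ a k t := by
  unfold Gk
  have e1 : γ = fun y => σ * γ (-y) := by
    ext y
    have := h.par (-y)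
    rw [neg_neg] at this; exact this
  have e2 : iteratedDeriv k γ (-(a * t)) = σ * ((-1) ^ k * iteratedDeriv k γ (a * t)) := by
    conv_lhs => rw [e1]
    rw [iteratedDeriv_const_mul_field (f := fun y => γ (-y)), iteratedDeriv_comp_neg, neg_neg, smul_eq_mul]
  rw [mul_neg, e2]; ring

lemma Gk_d (h : GH γ c1 c2 C3 σ) {a t : ℝ} (ha : 0 < a) (ha' : a ≤ 1 / 4) (ht : |t| ≤ 2) (k : ℕ) : HasDerivAt (Gk γ a k) (Gk γ a (k + 1) t) t := by
  have h1 := h.d k (a * t) (by rw [abs_mul, abs_of_pos ha]; nlinarith [abs_nonneg t])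
  have h2 : HasDerivAt (fun t => a * t) a t := by simpa using (hasDerivAt_id t).const_mul a
  have h3 := ((h1.comp t h2).const_mul (a ^ k)).div_const (γ a)
  unfold Gk
  refine h3.congr_deriv ?_
  rw [pow_succ]; ring

lemma Gk_bd (h : GH γ c1 c2 C3 σ) {a t : ℝ} (ha : 0 < a) (ha' : a ≤ 1 / 4) (ht : t ∈ Icc (1/2 : ℝ) 2) {k : ℕ} (hk : k ≤ 3) :
    |Gk γ a k t| ≤ 8 * C3 * Real.exp (2 * C3) := by
  have hA := h.pos a ha (by linarith)
  have hC3 := h.hC3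
  have ht0 : 0 < t := by linarith [ht.1]
  have hB := h.pos (a * t) (by positivity) (by nlinarith [ht.2])
  rw [Gk_eq h ha ha' ht, abs_mul, abs_mul]
  have b1 : |1 / t ^ k| ≤ 8 := by
    rw [abs_of_pos (by positivity), div_le_iff₀ (by positivity)]
    have h2 : (1/2 : ℝ) ^ k ≤ t ^ k := pow_le_pow_left₀ (by norm_num) ht.1 k
    have h3 : (1/2 : ℝ) ^ 3 ≤ (1/2 : ℝ) ^ k := pow_le_pow_of_le_one (by norm_num) (by norm_num) hk
    norm_num at h3; norm_num at h2; linarith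
  have b2 : |(a * t) ^ k * iteratedDeriv k γ (a * t) / γ (a * t)| ≤ C3 := by
    rcases Nat.eq_zero_or_pos k with rfl | hk0
    · rw [iteratedDeriv_zero, pow_zero, one_mul, div_self hB.ne', abs_one]; exact hC3
    · exact h.h3 k hk0 hk _ (by positivity) (by nlinarith [ht.2])
  have b3 : |γ (a * t) / γ a| ≤ Real.exp (2 * C3) := by rw [abs_of_pos (by positivity)]; exact (h.ratio ha ha' ht).2
  gcongr

lemma Gk_lo (h : GH γ c1 c2 C3 σ) {a t : ℝ} (ha : 0 < a) (ha' : a ≤ 1 / 4) (ht : t ∈ Icc (1/2 : ℝ) 2) :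
    1 / 4 * c2 * Real.exp (-(2 * C3)) ≤ Gk γ a 2 t := by
  have ht0 : 0 < t := by linarith [ht.1]
  have hc2 := h.hc2
  have h2 := h.h2 (a * t) (by positivity) (by nlinarith [ht.2])
  have h3 := (h.ratio ha ha' ht).1
  have h4 : 1 / 4 ≤ 1 / t ^ 2 := one_div_le_one_div_of_le (by positivity) (by nlinarith [ht.2])
  rw [Gk_eq h ha ha' ht]
  have := Real.exp_pos (-(2 * C3))
  have h5 := hc2.trans_le h2
  gcongr

lemma Gk_cv (h : GH γ c1 c2 C3 σ) {a t : ℝ} (ha : 0 < a) (ha' : a ≤ 1 / 4) (ht : t ∈ Icc (1/2 : ℝ) 2) :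
    c1 * (1 / 4 * c2 * Real.exp (-(2 * C3))) ^ 2 ≤ |Gk γ a 2 t ^ 2 - Gk γ a 1 t * Gk γ a 3 t| := by
  have ht0 : 0 < t := by linarith [ht.1]
  have hc2 := h.hc2
  have hc1 := h.hc1
  have hA := h.pos a ha (by linarith)
  have h1 := h.h1 (a * t) (by positivity) (by nlinarith [ht.2])
  have e1 : Gk γ a 2 t ^ 2 - Gk γ a 1 t * Gk γ a 3 t = (a ^ 4 / γ a ^ 2) * (iteratedDeriv 2 γ (a * t) ^ 2 - iteratedDeriv 1 γ (a * t) * iteratedDeriv 3 γ (a * t)) := by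
    unfold Gk; field_simp
  rw [e1, abs_mul, abs_of_pos (by positivity)]
  calc _ ≤ c1 * Gk γ a 2 t ^ 2 := by
        gcongr
        exact Gk_lo h ha ha' ht
    _ = (a ^ 4 / γ a ^ 2) * (c1 * iteratedDeriv 2 γ (a * t) ^ 2) := by unfold Gk; field_simp
    _ ≤ _ := by gcongr

lemma exists_curve (h : GH γ c1 c2 C3 σ) : ∃ c C, 0 < c ∧ 1 ≤ C ∧ ∀ C', C ≤ C' → ∀ l : ℕ, 2 ≤ l → ∀ p0 : ℝ, p0 = 1 / 2 ∨ p0 = -2 →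
    ∃ e Γ1 Γ2 Γ3, Curve c C' p0 e (gammaZ γ l) Γ1 Γ2 Γ3 ∧ ∀ t ∈ Icc p0 (p0 + 3/2), |gammaZ γ l t| ≤ C ∧ |Γ1 t| ≤ C := by
  have hc2 := h.hc2
  have hc1 := h.hc1
  have hC3 := h.hC3
  have hE : 1 ≤ Real.exp (2 * C3) := Real.one_le_exp (by linarith)
  have hE' := Real.exp_pos (-(2 * C3))
  set q := 1 / 4 * c2 * Real.exp (-(2 * C3)) with hq
  have hq0 : 0 < q := by positivity
  have hCb : 1 ≤ 8 * C3 * Real.exp (2 * C3) := by nlinarith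
  refine ⟨min q (c1 * q ^ 2), 8 * C3 * Real.exp (2 * C3), by positivity, hCb, ?_⟩
  intro C' hC' l hl p0 hp0
  set a : ℝ := 2 ^ (-(l:ℤ)) with ha
  have ha0 : 0 < a := by positivity
  have ha1 : a ≤ 1 / 4 := by
    have : a ≤ (2:ℝ) ^ (-(2:ℤ)) := zpow_le_zpow_right₀ (by norm_num) (by omega)
    norm_num at this; linarith
  have e0 : gammaZ γ l = Gk γ a 0 := by
    ext t; unfold gammaZ Gk; rw [iteratedDeriv_zero, pow_zero, one_mul]
  have habs : ∀ t ∈ Icc p0 (p0 + 3/2), |t| ≤ 2 := by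
    intro t ht; rw [abs_le]
    rcases hp0 with rfl | rfl <;> constructor <;> linarith [ht.1, ht.2]
  have hbd : ∀ k ≤ 3, ∀ t ∈ Icc p0 (p0 + 3/2), |Gk γ a k t| ≤ 8 * C3 * Real.exp (2 * C3) := by
    intro k hk t ht
    rcases hp0 with rfl | rfl
    · exact Gk_bd h ha0 ha1 ⟨ht.1, by linarith [ht.2]⟩ hk
    · have := Gk_bd h ha0 ha1 (t := -t) ⟨by linarith [ht.2], by linarith [ht.1]⟩ hk
      rw [Gk_neg h, abs_mul, abs_mul, abs_pow] at this
      rcases h.hσ with h1 | h1 <;> simpa [h1] using this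
  have hlo : ∃ e : ℝ, (e = 1 ∨ e = -1) ∧ ∀ t ∈ Icc p0 (p0 + 3/2), q ≤ e * Gk γ a 2 t := by
    rcases hp0 with rfl | rfl
    · exact ⟨1, Or.inl rfl, fun t ht => by rw [one_mul]; exact Gk_lo h ha0 ha1 ⟨ht.1, by linarith [ht.2]⟩⟩
    · refine ⟨σ, h.hσ, fun t ht => ?_⟩
      have := Gk_lo h ha0 ha1 (t := -t) ⟨by linarith [ht.2], by linarith [ht.1]⟩
      rw [Gk_neg h, ← hq] at this
      simpa using this
  have hcv : ∀ t ∈ Icc p0 (p0 + 3/2), c1 * q ^ 2 ≤ |Gk γ a 2 t ^ 2 - Gk γ a 1 t * Gk γ a 3 t| := by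
    intro t ht
    rcases hp0 with rfl | rfl
    · exact Gk_cv h ha0 ha1 ⟨ht.1, by linarith [ht.2]⟩
    · have := Gk_cv h ha0 ha1 (t := -t) ⟨by linarith [ht.2], by linarith [ht.1]⟩
      have hσ2 : σ ^ 2 = 1 := by rcases h.hσ with h1 | h1 <;> simp [h1]
      have e1 : Gk γ a 2 (-t) ^ 2 - Gk γ a 1 (-t) * Gk γ a 3 (-t) = Gk γ a 2 t ^ 2 - Gk γ a 1 t * Gk γ a 3 t := by
        simp only [Gk_neg h]
        linear_combination (Gk γ a 2 t ^ 2 - Gk γ a 1 t * Gk γ a 3 t) * hσ2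
      rwa [e1] at this
  obtain ⟨e, he, hlo⟩ := hlo
  refine ⟨e, Gk γ a 1, Gk γ a 2, Gk γ a 3, ⟨by positivity, hCb.trans hC', ?_, ?_, ?_, ?_, ?_, ?_, ?_, ?_, ?_, he, ?_, ?_⟩, ?_⟩
  · unfold gammaZ; exact (h.ms.comp (measurable_const.mul measurable_id)).div_const _
  · unfold Gk; rw [iteratedDeriv_one]
    exact (((measurable_deriv γ).comp (measurable_const.mul measurable_id)).const_mul _).div_const _
  · rw [e0]; exact fun t ht => Gk_d h ha0 ha1 (habs t ht) 0
  · exact fun t ht => Gk_d h ha0 ha1 (habs t ht) 1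
  · exact fun t ht => Gk_d h ha0 ha1 (habs t ht) 2
  · rw [e0]; exact fun t ht => (hbd 0 (by norm_num) t ht).trans hC'
  · exact fun t ht => (hbd 1 (by norm_num) t ht).trans hC'
  · exact fun t ht => (hbd 2 (by norm_num) t ht).trans hC'
  · exact fun t ht => (hbd 3 (by norm_num) t ht).trans hC'
  · exact fun t ht => (min_le_left _ _).trans (hlo t ht)
  · exact fun t ht => (min_le_right _ _).trans (hcv t ht)
  · rw [e0]; exact fun t ht => ⟨hbd 0 (by norm_num) t ht, hbd 1 (by norm_num) t ht⟩
end

lemma amp_chi {φ : ℝ → ℝ} (hs : ContDiff ℝ (⊤ : ℕ∞) φ) {B : ℝ} (hB : 0 ≤ B) (hb : ∀ t, |φ t| ≤ B) (hb1 : ∀ t, |deriv φ t| ≤ B) {p0 : ℝ}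
    (hp : p0 = 1 / 2 ∨ p0 = -2) {C : ℝ} (hC : 12 * B ≤ C) : Amp C p0 (fun t => φ t / t) (fun t => (deriv φ t * t - φ t) / t ^ 2) := by
  have ht : ∀ t ∈ Icc p0 (p0 + 3/2), 1 / 2 ≤ |t| ∧ |t| ≤ 2 := by
    intro t ht
    rcases hp with rfl | rfl
    · have h0 : 0 ≤ t := by linarith [ht.1]
      rw [abs_of_nonneg h0]; exact ⟨ht.1, by linarith [ht.2]⟩
    · have h0 : t ≤ 0 := by linarith [ht.2]
      rw [abs_of_nonpos h0]; exact ⟨by linarith [ht.2], by linarith [ht.1]⟩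
  refine ⟨hs.continuous.measurable.div measurable_id, fun t h => ?_, fun t h => ?_, fun t h => ?_⟩
  · have h0 : t ≠ 0 := by
      intro h0; have := (ht t h).1; rw [h0, abs_zero] at this; norm_num at this
    have hd := (hs.differentiable (by simp) t).hasDerivAt
    refine (hd.fun_div (hasDerivAt_id' t) h0).congr_deriv ?_
    simp
  · obtain ⟨h1, h2⟩ := ht t h
    rw [abs_div, div_le_iff₀ (by linarith)]
    have := hb t
    nlinarith
  · obtain ⟨h1, h2⟩ := ht t h
    have h3 : |deriv φ t * t - φ t| ≤ 3 * B := by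
      refine (abs_sub _ _).trans ?_
      rw [abs_mul]
      have := hb t; have := hb1 t
      have := mul_le_mul this h2 (abs_nonneg _) hB
      linarith
    rw [abs_div, abs_pow, div_le_iff₀ (by positivity)]
    have : (1 / 4 : ℝ) ≤ |t| ^ 2 := by nlinarith
    nlinarith

lemma amp_mul {C0 C1 C2 p0 c C e : ℝ} {Γ Γ1 Γ2 Γ3 χ χ1 : ℝ → ℝ} (h : Curve c C p0 e Γ Γ1 Γ2 Γ3) (hb : ∀ t ∈ Icc p0 (p0 + 3/2), |Γ t| ≤ C0 ∧ |Γ1 t| ≤ C0)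
    (hC0 : 0 ≤ C0) (hχ : Amp C1 p0 χ χ1) (hC1 : 0 ≤ C1) (hC : 2 * (C0 * C1) ≤ C2) : Amp C2 p0 (fun t => Γ t * χ t) (fun t => Γ1 t * χ t + Γ t * χ1 t) := by
  refine ⟨h.m0.mul hχ.m, fun t ht => (h.d0 t ht).mul (hχ.d t ht), fun t ht => ?_, fun t ht => ?_⟩
  · rw [abs_mul]
    have := mul_le_mul (hb t ht).1 (hχ.b t ht) (abs_nonneg _) hC0
    have := mul_nonneg hC0 hC1
    linarith
  · refine (abs_add_le _ _).trans ?_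
    rw [abs_mul, abs_mul]
    have := mul_le_mul (hb t ht).1 (hχ.b1 t ht) (abs_nonneg _) hC0
    have := mul_le_mul (hb t ht).2 (hχ.b t ht) (abs_nonneg _) hC0
    linarith

lemma Amp.mono {C C' p0 : ℝ} {χ χ1 : ℝ → ℝ} (h : Amp C p0 χ χ1) (hC : C ≤ C') : Amp C' p0 χ χ1 :=
  ⟨h.m, h.d, fun t ht => (h.b t ht).trans hC, fun t ht => (h.b1 t ht).trans hC⟩

lemma mjl_split {γ φ : ℝ → ℝ} (hsupp : ∀ x, φ x ≠ 0 → 1 / 2 ≤ |x| ∧ |x| ≤ 2) {j l : ℕ} {c C e Ce : ℝ} {Γ1 Γ2 Γ3 Γ1' Γ2' Γ3' χ1 χ1' : ℝ → ℝ}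
    (h : Curve c C (1/2) e (gammaZ γ l) Γ1 Γ2 Γ3) (h' : Curve c C (-2) Ce (gammaZ γ l) Γ1' Γ2' Γ3')
    (hχ : Amp C (1/2) (fun t => φ t / t) χ1) (hχ' : Amp C (-2) (fun t => φ t / t) χ1') (u : ℝ) (ξ : ℝ × ℝ) :
    mjl γ φ j l u ξ = mul0 φ φ (2 ^ j) ξ * GS (gammaZ γ l) (Ioc (1/2) (1/2 + 3/2)) (fun _ t => ((φ t / t : ℝ) : ℂ)) u ξ
      + mul0 φ φ (2 ^ j) ξ * GS (gammaZ γ l) (Ioc (-2) (-2 + 3/2)) (fun _ t => ((φ t / t : ℝ) : ℂ)) u ξ := by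
  have i1 := GS_int h (chi_meas hχ) (chi_bd hχ) u ξ
  have i2 := GS_int h' (chi_meas hχ') (chi_bd hχ') u ξ
  rw [← mul_add]
  unfold mjl mul0
  have e0 : (2 : ℝ) ^ (-(j : ℤ)) = (2 ^ j)⁻¹ := by rw [zpow_neg, zpow_natCast]
  rw [e0, Complex.ofReal_mul, inv_mul_eq_div, inv_mul_eq_div]
  congr 1
  unfold GS
  rw [← integrableOn_Icc_iff_integrableOn_Ioc] at i1 i2
  rw [← integral_Icc_eq_integral_Ioc, ← integral_Icc_eq_integral_Ioc, ← setIntegral_union _ measurableSet_Icc i1 i2]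
  · symm
    rw [setIntegral_eq_integral_of_forall_compl_eq_zero]
    · congr 1; ext t
      unfold ex ph
      rw [← Complex.exp_add, Complex.ofReal_div, ← mul_div_assoc]
      congr 3
      push_cast; ring
    · intro t ht
      have : φ t = 0 := by
        by_contra h0
        obtain ⟨h1, h2⟩ := hsupp t h0
        apply ht
        rcases le_total 0 t with h | h
        · rw [abs_of_nonneg h] at h1 h2
          exact Or.inl ⟨h1, by linarith⟩
        · rw [abs_of_nonpos h] at h1 h2
          exact Or.inr ⟨by linarith, by linarith⟩
      simp [this]
  · rw [Set.disjoint_left]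
    intro t h1 h2
    have := h1.1; have := h2.2
    linarith

lemma final6 {F : ℝ × ℝ → ℝ} {f : ℝ × ℝ → ℂ} {A : ℝ} (hA : 0 ≤ A) (h : ∫⁻ x, ‖F x‖ₑ ^ 6 ≤ ENNReal.ofReal (A ^ 6) * ∫⁻ x, ‖f x‖ₑ ^ 6) :
    eLpNorm F (ENNReal.ofReal 6) volume ≤ ENNReal.ofReal A * eLpNorm f (ENNReal.ofReal 6) volume := by
  have h6 : ENNReal.ofReal 6 ≠ 0 := by simp
  have h6' : (ENNReal.ofReal 6).toReal = 6 := by simp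
  rw [eLpNorm_eq_lintegral_rpow_enorm_toReal h6 (by simp), eLpNorm_eq_lintegral_rpow_enorm_toReal h6 (by simp), h6']
  have e : ∀ a : ℝ≥0∞, a ^ (6 : ℝ) = a ^ 6 := fun a => by exact_mod_cast ENNReal.rpow_natCast a 6
  simp only [e]
  refine (ENNReal.rpow_le_rpow h (by norm_num)).trans ?_
  rw [ENNReal.mul_rpow_of_nonneg _ _ (by norm_num), ENNReal.ofReal_pow hA, ← e, ← ENNReal.rpow_mul]
  norm_num

/-- Exponential-decay maximal bound for `m_j^l(u,D)`, uniform in `l`. -/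
theorem mjl_maximal_decay
    (γ : ℝ → ℝ)
    (hγ0 : γ 0 = 0)
    (hsmooth : ContDiffOn ℝ (⊤ : ℕ∞) γ (Set.Icc (-1 : ℝ) 1))
    (hparity : (∀ t, γ (-t) = γ t) ∨ (∀ t, γ (-t) = -γ t))
    (hmono : StrictMonoOn γ (Set.Icc (0 : ℝ) 1))
    (hyp1 : ∃ c > (0 : ℝ), ∀ t ∈ Set.Ioc (0 : ℝ) 1,
      c ≤ |deriv (fun s => deriv γ s / deriv (deriv γ) s) t|)
    (hyp2 : ∃ c > (0 : ℝ), ∀ j ∈ ({1, 2} : Set ℕ), ∀ t ∈ Set.Ioc (0 : ℝ) 1,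
      c ≤ |t ^ j * iteratedDeriv j γ t / γ t|)
    (hyp3 : ∃ C : ℝ, ∀ j : ℕ, 1 ≤ j → j ≤ 1000 → ∀ t ∈ Set.Ioc (0 : ℝ) 1,
      |t ^ j * iteratedDeriv j γ t / γ t| ≤ C)
    (hγ1 : γ 1 = 1)
    (hconv : ∀ t ∈ Set.Ioc (0 : ℝ) 1, 0 < iteratedDeriv 2 γ t)
    (hext : ∀ t : ℝ, 1 ≤ t → γ t = (γ t⁻¹)⁻¹)
    (hcont : ContinuousOn γ (Set.Ici (0 : ℝ)))
    (hmono2 : StrictMonoOn γ (Set.Ici (0 : ℝ)))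
    (hsurj : γ '' Set.Ici (0 : ℝ) = Set.Ici (0 : ℝ))
    (φ : ℝ → ℝ) (hφs : ContDiff ℝ (⊤ : ℕ∞) φ) (hφc : HasCompactSupport φ)
    (hφsupp : Function.support φ ⊆ {t : ℝ | 1/2 ≤ |t| ∧ |t| ≤ 2})
    (hφsum : ∀ t : ℝ, t ≠ 0 → HasSum (fun k : ℤ => φ ((2 : ℝ) ^ (-k) * t)) 1) :
    ∃ p : ℝ, 6 ≤ p ∧ ∃ δ C : ℝ, 0 < δ ∧ 0 < C ∧ ∃ L₀ : ℕ,
      ∀ j : ℕ, 1 ≤ j → ∀ l : ℕ, L₀ ≤ l → ∀ f : SchwartzMap (ℝ × ℝ) ℂ,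
        eLpNorm (fun x : ℝ × ℝ =>
            ⨆ u : Set.Icc (1 : ℝ) 2, ‖op (mjl γ φ j l ↑u) (⇑f) x‖)
          (ENNReal.ofReal p) volume ≤
        ENNReal.ofReal (C * (2 : ℝ) ^ (-(δ * (j : ℝ)))) *
          eLpNorm (⇑f) (ENNReal.ofReal p) volume := by
  have hsupp : ∀ x, φ x ≠ 0 → 1 / 2 ≤ |x| ∧ |x| ≤ 2 := fun x hx => hφsupp hx
  obtain ⟨c1, c2, C3, σ, hG⟩ := GH_of hγ0 hsmooth hparity hmono hyp1 hyp2 hyp3 hconv hcont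
  obtain ⟨c, C, hc, hC, hcur⟩ := exists_curve hG
  obtain ⟨B1, hB1⟩ := hφc.exists_bound_of_continuous hφs.continuous
  obtain ⟨B2, hB2⟩ := hφc.deriv.exists_bound_of_continuous (hφs.continuous_deriv (by simp))
  set B := max (max B1 B2) 0 with hB
  have hB0 : 0 ≤ B := le_max_right _ _
  have hb : ∀ t, |φ t| ≤ B := fun t => (hB1 t).trans ((le_max_left _ _).trans (le_max_left _ _))
  have hb1 : ∀ t, |deriv φ t| ≤ B := fun t => (hB2 t).trans ((le_max_right _ _).trans (le_max_left _ _))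
  set C' := C * (1 + 24 * B) with hC'
  have hCC' : C ≤ C' := by rw [hC']; nlinarith [mul_nonneg (zero_le_one.trans hC) hB0]
  have hBC' : 12 * B ≤ C' := by rw [hC']; nlinarith [mul_nonneg (sub_nonneg.2 hC) hB0]
  obtain ⟨K, hK, hsup⟩ := curve_sup hφs hφc hsupp hc (hC.trans hCC')
  refine ⟨6, le_rfl, 1 / 300, 64 * K + 1, by norm_num, by positivity, 2, fun j _ l hl f => ?_⟩
  have hf : Cls f := ⟨f.continuous.measurable, f.integrable, by
    obtain ⟨M, _, hM⟩ := f.decay 0 0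
    exact ⟨M, fun x => by simpa using hM x⟩⟩
  obtain ⟨e, Γ1, Γ2, Γ3, h, hbd⟩ := hcur C' hCC' l hl (1/2) (Or.inl rfl)
  obtain ⟨e', Γ1', Γ2', Γ3', h', hbd'⟩ := hcur C' hCC' l hl (-2) (Or.inr rfl)
  have a := amp_chi hφs hB0 hb hb1 (Or.inl rfl) (le_refl (12 * B))
  have a' := amp_chi hφs hB0 hb hb1 (Or.inr rfl) (le_refl (12 * B))
  have hm2 : 2 * (C * (12 * B)) ≤ C' := by rw [hC']; nlinarith
  have m := amp_mul h hbd (by linarith) a (by linarith) hm2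
  have m' := amp_mul h' hbd' (by linarith) a' (by linarith) hm2
  obtain ⟨R, hRm, hR, hRi⟩ := hsup h (a.mono hBC') m j hf
  obtain ⟨R', hRm', hR', hRi'⟩ := hsup h' (a'.mono hBC') m' j hf
  have key : ∀ x, ∀ u ∈ Icc (1 : ℝ) 2, ‖op (mjl γ φ j l u) f x‖ₑ ^ 6 ≤ 32 * (R x + R' x) := by
    intro x u hu
    have e1 : op (mjl γ φ j l u) f x = TT φ φ (2 ^ j) (gammaZ γ l) (Ioc (1/2) (1/2 + 3/2)) (fun t => φ t / t) f (x, u)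
        + TT φ φ (2 ^ j) (gammaZ γ l) (Ioc (-2) (-2 + 3/2)) (fun t => φ t / t) f (x, u) := by
      rw [show mjl γ φ j l u = _ from funext (mjl_split hsupp h h' (a.mono hBC') (a'.mono hBC') u)]
      have hm0 := mul0_cls hφs hφc hφs hφc (lam := 2 ^ j) (by positivity)
      exact op_add_mul
        (hm0.mul_bdd (GS_meas h.m0 (chi_meas a) u) (GS_le (by simp) (fun ξ t ht => chi_bd a ξ t (Ioc_subset_Icc_self ht)) u))
        (hm0.mul_bdd (GS_meas h'.m0 (chi_meas a') u) (GS_le (by simp) (fun ξ t ht => chi_bd a' ξ t (Ioc_subset_Icc_self ht)) u)) hf x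
    rw [e1]
    refine (six_add _ _).trans ?_
    gcongr
    · exact hR x u hu
    · exact hR' x u hu
  refine final6 (by positivity) ?_
  have pt : ∀ x, ‖⨆ u : Icc (1 : ℝ) 2, ‖op (mjl γ φ j l ↑u) f x‖‖ₑ ^ 6 ≤ 32 * (R x + R' x) := by
    intro x
    by_cases ht : 32 * (R x + R' x) = ⊤
    · rw [ht]; exact le_top
    set q := 32 * (R x + R' x)
    have h6 : (q ^ (1 / 6 : ℝ)) ^ 6 = q := by
      rw [← ENNReal.rpow_natCast, ← ENNReal.rpow_mul]; norm_num
    rw [← h6]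
    refine pow_le_pow_left' ?_ 6
    have hq : q ^ (1 / 6 : ℝ) ≠ ⊤ := ENNReal.rpow_ne_top_of_nonneg (by norm_num) ht
    have : Nonempty (Icc (1 : ℝ) 2) := ⟨⟨1, by norm_num⟩⟩
    rw [Real.enorm_of_nonneg (Real.iSup_nonneg fun _ => norm_nonneg _)]
    refine ENNReal.ofReal_le_of_le_toReal (ciSup_le fun u => ?_)
    rw [← toReal_enorm]
    refine ENNReal.toReal_mono hq ?_
    have := (key x u u.2).trans h6.ge
    exact le_of_not_gt fun hlt => absurd (ENNReal.pow_lt_pow_left (n := 6) (by norm_num) hlt) (not_lt.2 this)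
  refine (lintegral_mono pt).trans ?_
  rw [lintegral_const_mul _ (by fun_prop), lintegral_add_left hRm]
  refine (mul_le_mul_right (add_le_add hRi hRi') _).trans ?_
  rw [← two_mul, ← mul_assoc, ← mul_assoc]
  gcongr
  rw [show (32 : ℝ≥0∞) = ENNReal.ofReal 32 by simp, show (2 : ℝ≥0∞) = ENNReal.ofReal 2 by simp, ← ENNReal.ofReal_mul (by norm_num), ← ENNReal.ofReal_mul (by norm_num)]
  apply ENNReal.ofReal_le_ofReal
  rw [mul_pow, ← Real.rpow_natCast ((2 : ℝ) ^ (-(1 / 300 * (j : ℝ)))), ← Real.rpow_mul (by norm_num), ← mul_assoc]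
  rw [show -(1 / 300 * (j : ℝ)) * ((6 : ℕ) : ℝ) = -((j : ℝ) / 50) by push_cast; ring]
  gcongr
  have : 64 * K + 1 ≤ (64 * K + 1) ^ 6 := le_self_pow₀ (by linarith) (by norm_num)
  linarith
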